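/- (Openness in the method of continuity.) Let ᾱ ∈ (0,1) be the universal Hölder exponent for the two-dimensional C^{2,ᾱ} theory. Let F be of class C², uniformly elliptic with constants λ, Λ, with F(0) = 0, and let g ∈ C^{2,ᾱ}(∂B₁), B₁ ⊂ ℝ². Define A := { t ∈ [0,1] : there exists u ∈ C^{2,ᾱ}(B̄₁) with t·F(D²u) + (1−t)·Δu = 0 in B₁ and u = g on ∂B₁ }. Then A is open in [0,1]: if t₀ ∈ A, there exists ε > 0 such that (t₀−ε, t₀+ε) ∩ [0,1] ⊂ A. -/

import Mathlib

open Metric Set Real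
open scoped Classical

noncomputable section

abbrev E2 : Type := EuclideanSpace ℝ (Fin 2)
abbrev Mat2 : Type := Matrix (Fin 2) (Fin 2) ℝ

/-- `‖A⁺‖`: the sum of the positive parts of the eigenvalues of a symmetric matrix `A`. -/
noncomputable def posNorm (A : Mat2) : ℝ :=
  if h : A.IsHermitian then ∑ i, max (h.eigenvalues i) 0 else 0

/-- `‖A⁻‖`: the sum of the negative parts of the eigenvalues of a symmetric matrix `A`. -/
noncomputable def negNorm (A : Mat2) : ℝ :=
  if h : A.IsHermitian then ∑ i, max (-(h.eigenvalues i)) 0 else 0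

/-- A norm on 2×2 matrices: sum of absolute values of entries. -/
noncomputable def matNorm (A : Mat2) : ℝ := ∑ i, ∑ j, |A i j|

/-- `F` is uniformly elliptic with constants `0 < lam ≤ Lam`:
`F M - F N ≤ Lam ‖(M-N)⁺‖ - lam ‖(M-N)⁻‖` for all symmetric `M, N`. -/
def UniformlyElliptic (lam Lam : ℝ) (F : Mat2 → ℝ) : Prop :=
  ∀ M N : Mat2, M.IsHermitian → N.IsHermitian →
    F M - F N ≤ Lam * posNorm (M - N) - lam * negNorm (M - N)

/-- The Hessian matrix `D²u(x)` of `u : ℝ² → ℝ` at `x`. -/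
noncomputable def hess (u : E2 → ℝ) (x : E2) : Mat2 :=
  Matrix.of fun i j =>
    fderiv ℝ (fun y => fderiv ℝ u y (EuclideanSpace.single j 1)) x (EuclideanSpace.single i 1)

/-- `sup_s |u|`, the `L^∞` norm of `u` on `s`. -/
noncomputable def supAbs (u : E2 → ℝ) (s : Set E2) : ℝ := ⨆ x ∈ s, |u x|

/-- The point `(cos t, sin t)` on the unit circle `∂B₁`. -/
noncomputable def circPt (t : ℝ) : E2 :=
  (EuclideanSpace.equiv (Fin 2) ℝ).symm ![Real.cos t, Real.sin t]

/-- The trace of `g` on the unit circle, as a `2π`-periodic function on `ℝ`. -/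
noncomputable def onCircle (g : E2 → ℝ) : ℝ → ℝ := fun t => g (circPt t)

/-- `g ∈ C^{2,α}(∂B₁)`, via the arclength parametrization `t ↦ (cos t, sin t)`. -/
def MemHolderCircle (α : ℝ) (g : E2 → ℝ) : Prop :=
  ContDiff ℝ 2 (onCircle g) ∧
    ∃ H : ℝ, ∀ s t : ℝ,
      |deriv (deriv (onCircle g)) s - deriv (deriv (onCircle g)) t| ≤ H * |s - t| ^ α

/-- The `C^{2,α}` norm of `g` on the unit circle `∂B₁`. -/
noncomputable def holderNormCircle (α : ℝ) (g : E2 → ℝ) : ℝ :=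
  (⨆ t : ℝ, |onCircle g t|) + (⨆ t : ℝ, |deriv (onCircle g) t|) +
    (⨆ t : ℝ, |deriv (deriv (onCircle g)) t|) +
    ⨆ p : ℝ × ℝ,
      if p.1 ≠ p.2 then
        |deriv (deriv (onCircle g)) p.1 - deriv (deriv (onCircle g)) p.2| / |p.1 - p.2| ^ α
      else 0

/-- The Laplacian of `u`, the trace of the Hessian. -/
noncomputable def lapl (u : E2 → ℝ) (x : E2) : ℝ := ∑ i, hess u x i i

/-- `t` belongs to the set `A` of the method of continuity: the Dirichlet problem
`t·F(D²u) + (1−t)·Δu = 0` in `B₁`, `u = g` on `∂B₁` has a solution `u ∈ C^{2,α}(B̄₁)`. -/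
def SolvesAt (α : ℝ) (F : Mat2 → ℝ) (g : E2 → ℝ) (t : ℝ) : Prop :=
  ∃ u : E2 → ℝ,
    ContDiffOn ℝ 2 u (closedBall (0 : E2) 1) ∧
    (∃ H : ℝ, ∀ x ∈ ball (0 : E2) 1, ∀ y ∈ ball (0 : E2) 1,
      matNorm (hess u x - hess u y) ≤ H * ‖x - y‖ ^ α) ∧
    (∀ x ∈ ball (0 : E2) 1, t * F (hess u x) + (1 - t) * lapl u x = 0) ∧
    (∀ x ∈ sphere (0 : E2) 1, u x = g x)

/-! part 1 -/

namespace MC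
open MeasureTheory

/-- bounded measurable functions supported in a box are integrable -/
lemma integrable_box {f : ℝ × ℝ → ℝ} (hf : Measurable f) {m C : ℝ}
    (hb : ∀ z, |f z| ≤ C) (hs : ∀ z : ℝ × ℝ, (m < |z.1| ∨ m < |z.2|) → f z = 0) :
    Integrable f := by
  have hsub : Function.support f ⊆ Icc ((-m, -m) : ℝ × ℝ) (m, m) := by
    intro z hz
    by_contra hn
    apply hz
    apply hs
    by_contra! h
    apply hn
    have h1 := abs_le.1 h.1
    have h2 := abs_le.1 h.2
    exact ⟨⟨h1.1, h2.1⟩, ⟨h1.2, h2.2⟩⟩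
  rw [← integrableOn_iff_integrable_of_support_subset hsub]
  refine Measure.integrableOn_of_bounded (M := C) ?_ hf.aestronglyMeasurable ?_
  · exact (isCompact_Icc.measure_lt_top).ne
  · exact Filter.Eventually.of_forall fun z => by simpa using hb z

/-- one-dimensional vanishing of the integral of a derivative, exceptional point `0` -/
lemma integral_deriv_zero {f f' : ℝ → ℝ} {m : ℝ} (hc : Continuous f)
    (hd : ∀ x, x ≠ 0 → HasDerivAt f (f' x) x) (hi : Integrable f')
    (hs : ∀ x, m < |x| → f x = 0) (hs' : ∀ x, m < |x| → f' x = 0) : ∫ x, f' x = 0 := by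
  set n := |m| + 1 with hn
  have hmn : m < n := lt_of_le_of_lt (le_abs_self m) (by linarith)
  have hn0 : 0 < n := by positivity
  have h1 : ∫ x in (-n)..n, f' x = ∫ x, f' x := by
    apply intervalIntegral.integral_eq_integral_of_support_subset
    intro x hx
    have : ¬ m < |x| := fun h => hx (hs' x h)
    have h2 : |x| < n := by linarith
    have := abs_lt.1 h2
    exact ⟨this.1, this.2.le⟩
  rw [← h1, integral_eq_of_hasDerivAt_off_countable f f' (s := {0}) (countable_singleton 0)
    hc.continuousOn (fun x hx => hd x (by simpa using hx.2)) hi.intervalIntegrable]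
  rw [hs n (by rwa [abs_of_pos hn0]), hs (-n) (by rwa [abs_neg, abs_of_pos hn0]), sub_zero]

lemma bp_x {φ φ' G G' : ℝ × ℝ → ℝ} {m C : ℝ}
    (hφ : Continuous φ) (hφ' : Continuous φ') (hG : Continuous G) (hG' : Measurable G')
    (hφd : ∀ x y, HasDerivAt (fun x => φ (x, y)) (φ' (x, y)) x)
    (hGd : ∀ x y, x ≠ 0 → HasDerivAt (fun x => G (x, y)) (G' (x, y)) x)
    (hs : ∀ z : ℝ × ℝ, (m < |z.1| ∨ m < |z.2|) → φ z = 0)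
    (hs' : ∀ z : ℝ × ℝ, (m < |z.1| ∨ m < |z.2|) → φ' z = 0)
    (hb : ∀ z : ℝ × ℝ, |z.1| ≤ m → |z.2| ≤ m → |G' z| ≤ C) :
    Integrable (fun z => φ z * G' z) ∧ ∫ z, φ z * G' z = - ∫ z, φ' z * G z := by
  have hK : IsCompact (Icc ((-m, -m) : ℝ × ℝ) (m, m)) := isCompact_Icc
  have hmem : ∀ z : ℝ × ℝ, ¬ (m < |z.1| ∨ m < |z.2|) → z ∈ Icc ((-m, -m) : ℝ × ℝ) (m, m) := by
    intro z h
    push Not at h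
    have h1 := abs_le.1 h.1
    have h2 := abs_le.1 h.2
    exact ⟨⟨h1.1, h2.1⟩, ⟨h1.2, h2.2⟩⟩
  obtain ⟨Cφ, hCφ⟩ := hK.exists_bound_of_continuousOn hφ.continuousOn
  obtain ⟨Cp, hCp⟩ := hK.exists_bound_of_continuousOn (hφ'.mul hG).continuousOn
  have i1 : Integrable (fun z => φ z * G' z) := by
    refine integrable_box (m := m) (C := |Cφ| * |C|) (hφ.measurable.mul hG') ?_ ?_
    · intro z
      by_cases h : m < |z.1| ∨ m < |z.2|
      · rw [hs z h]; simp; positivity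
      · rw [abs_mul]
        have := hCφ z (hmem z h)
        rw [Real.norm_eq_abs] at this
        push Not at h
        exact mul_le_mul (this.trans (le_abs_self _)) ((hb z h.1 h.2).trans (le_abs_self _))
          (abs_nonneg _) (abs_nonneg _)
    · intro z h; rw [hs z h, zero_mul]
  have i2 : Integrable (fun z => φ' z * G z) := by
    refine integrable_box (m := m) (C := |Cp|) (hφ'.mul hG).measurable ?_ ?_
    · intro z
      by_cases h : m < |z.1| ∨ m < |z.2|
      · rw [hs' z h]; simp
      · have := hCp z (hmem z h)
        rw [Real.norm_eq_abs] at this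
        exact this.trans (le_abs_self _)
    · intro z h; rw [hs' z h, zero_mul]
  refine ⟨i1, ?_⟩
  have i3 := i2.add i1
  have : ∫ z, (φ' z * G z + φ z * G' z) = 0 := by
    have e := integral_prod_symm (μ := (volume : Measure ℝ)) (ν := (volume : Measure ℝ))
      (fun z : ℝ × ℝ => φ' z * G z + φ z * G' z) i3
    rw [← Measure.volume_eq_prod] at e
    rw [e]
    have hae := (Measure.volume_eq_prod ℝ ℝ ▸ i3 :
      Integrable (fun z : ℝ × ℝ => φ' z * G z + φ z * G' z)
        ((volume : Measure ℝ).prod (volume : Measure ℝ))).prod_left_ae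
    rw [integral_eq_zero_of_ae]
    filter_upwards [hae] with y hy
    refine integral_deriv_zero (f := fun x => φ (x, y) * G (x, y)) (m := m) ?_ ?_ hy ?_ ?_
    · fun_prop
    · intro x hx
      exact (hφd x y).mul (hGd x y hx)
    · intro x hx
      simp [hs (x, y) (Or.inl hx)]
    · intro x hx
      simp [hs (x, y) (Or.inl hx), hs' (x, y) (Or.inl hx)]
  rw [integral_add i2 i1] at this
  linarith

lemma bp_y {φ φ' G G' : ℝ × ℝ → ℝ} {m C : ℝ}
    (hφ : Continuous φ) (hφ' : Continuous φ') (hG : Continuous G) (hG' : Measurable G')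
    (hφd : ∀ x y, HasDerivAt (fun y => φ (x, y)) (φ' (x, y)) y)
    (hGd : ∀ x y, y ≠ 0 → HasDerivAt (fun y => G (x, y)) (G' (x, y)) y)
    (hs : ∀ z : ℝ × ℝ, (m < |z.1| ∨ m < |z.2|) → φ z = 0)
    (hs' : ∀ z : ℝ × ℝ, (m < |z.1| ∨ m < |z.2|) → φ' z = 0)
    (hb : ∀ z : ℝ × ℝ, |z.1| ≤ m → |z.2| ≤ m → |G' z| ≤ C) :
    Integrable (fun z => φ z * G' z) ∧ ∫ z, φ z * G' z = - ∫ z, φ' z * G z := by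
  have h := bp_x (φ := φ ∘ Prod.swap) (φ' := φ' ∘ Prod.swap) (G := G ∘ Prod.swap)
    (G' := G' ∘ Prod.swap) (m := m) (C := C) (hφ.comp continuous_swap) (hφ'.comp continuous_swap)
    (hG.comp continuous_swap) (hG'.comp measurable_swap)
    (fun x y => hφd y x) (fun x y hx => hGd y x hx)
    (fun z hz => hs z.swap hz.symm) (fun z hz => hs' z.swap hz.symm)
    (fun z h1 h2 => hb z.swap h2 h1)
  have sw : ∀ f : ℝ × ℝ → ℝ, ∫ z : ℝ × ℝ, f z.swap = ∫ z, f z := by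
    intro f
    have := integral_prod_swap (μ := (volume : Measure ℝ)) (ν := (volume : Measure ℝ)) f
    rwa [← Measure.volume_eq_prod] at this
  constructor
  · have := h.1
    have h3 := (Measure.volume_eq_prod ℝ ℝ ▸ this : Integrable _
      ((volume : Measure ℝ).prod (volume : Measure ℝ))).swap
    rw [← Measure.volume_eq_prod] at h3
    exact h3
  · have h2 := h.2
    have e1 := sw (fun z => φ z * G' z)
    have e2 := sw (fun z => φ' z * G z)
    rw [← e1, ← e2]
    exact h2

/-- the mixed identity `∫ Φ_y G_x = ∫ Φ_x G_y` -/
lemma mixed {Φx Φy Φxy G Gx Gy : ℝ × ℝ → ℝ} {m C : ℝ}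
    (hΦx : Continuous Φx) (hΦy : Continuous Φy) (hΦxy : Continuous Φxy)
    (hG : Continuous G) (hGx : Measurable Gx) (hGy : Measurable Gy)
    (hd1 : ∀ x y, HasDerivAt (fun y => Φx (x, y)) (Φxy (x, y)) y)
    (hd2 : ∀ x y, HasDerivAt (fun x => Φy (x, y)) (Φxy (x, y)) x)
    (hGd1 : ∀ x y, HasDerivAt (fun x => G (x, y)) (Gx (x, y)) x)
    (hGd2 : ∀ x y, y ≠ 0 → HasDerivAt (fun y => G (x, y)) (Gy (x, y)) y)
    (hs1 : ∀ z : ℝ × ℝ, (m < |z.1| ∨ m < |z.2|) → Φx z = 0)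
    (hs2 : ∀ z : ℝ × ℝ, (m < |z.1| ∨ m < |z.2|) → Φy z = 0)
    (hs3 : ∀ z : ℝ × ℝ, (m < |z.1| ∨ m < |z.2|) → Φxy z = 0)
    (hb1 : ∀ z : ℝ × ℝ, |z.1| ≤ m → |z.2| ≤ m → |Gx z| ≤ C)
    (hb2 : ∀ z : ℝ × ℝ, |z.1| ≤ m → |z.2| ≤ m → |Gy z| ≤ C) :
    Integrable (fun z => Φy z * Gx z) ∧ Integrable (fun z => Φx z * Gy z) ∧
    ∫ z, Φy z * Gx z = ∫ z, Φx z * Gy z := by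
  have h1 := bp_x hΦy hΦxy hG hGx hd2 (fun x y _ => hGd1 x y) hs2 hs3 hb1
  have h2 := bp_y hΦx hΦxy hG hGy hd1 hGd2 hs1 hs3 hb2
  exact ⟨h1.1, h2.1, by rw [h1.2, h2.2]⟩

end MC

/-! part 2 -/

namespace MC
open MeasureTheory

def kT (s : ℝ) : ℝ := Real.smoothTransition (2 * s - 1)
def kth : ℝ → ℝ := deriv kT
def kTt (s : ℝ) : ℝ := kT s / s

lemma kT_contDiff : ContDiff ℝ (⊤ : ℕ∞) kT :=
  Real.smoothTransition.contDiff.comp (by fun_prop)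

lemma kT_zero {s : ℝ} (h : s ≤ 1 / 2) : kT s = 0 :=
  Real.smoothTransition.zero_of_nonpos (by linarith)

lemma kT_one {s : ℝ} (h : 1 ≤ s) : kT s = 1 :=
  Real.smoothTransition.one_of_one_le (by linarith)

lemma kT_mono : Monotone kT := fun a b h => Real.smoothTransition.monotone (by linarith)

lemma kth_contDiff : ContDiff ℝ (⊤ : ℕ∞) kth := by
  have := (contDiff_infty_iff_deriv (f := kT)).1 kT_contDiff
  exact this.2

lemma kth_nonneg (s : ℝ) : 0 ≤ kth s := kT_mono.deriv_nonneg

lemma kth_zero {s : ℝ} (h : 1 < s) : kth s = 0 := by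
  have : kT =ᶠ[nhds s] fun _ => 1 := by
    filter_upwards [lt_mem_nhds h] with x hx using kT_one hx.le
  rw [kth, this.deriv_eq]; simp

lemma kth_zero' {s : ℝ} (h : s < 1 / 2) : kth s = 0 := by
  have : kT =ᶠ[nhds s] fun _ => 0 := by
    filter_upwards [gt_mem_nhds h] with x hx using kT_zero (le_of_lt hx)
  rw [kth, this.deriv_eq]; simp

lemma kth_pos : ∃ s, 0 < s ∧ kth s ≠ 0 := by
  by_contra! h
  have h0 : ∀ s, deriv kT s = 0 := by
    intro s
    by_cases hs : 0 < s
    · exact h s hs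
    · exact kth_zero' (by linarith)
  have := is_const_of_deriv_eq_zero (kT_contDiff.differentiable (by simp)) h0 0 1
  rw [kT_zero (by norm_num), kT_one le_rfl] at this
  norm_num at this

lemma kTt_contDiff : ContDiff ℝ (⊤ : ℕ∞) kTt := by
  rw [contDiff_iff_contDiffAt]
  intro s
  by_cases hs : s < 1 / 2
  · have : kTt =ᶠ[nhds s] fun _ => 0 := by
      filter_upwards [gt_mem_nhds hs] with x hx
      simp [kTt, kT_zero (le_of_lt hx)]
    exact contDiffAt_const.congr_of_eventuallyEq this
  · exact kT_contDiff.contDiffAt.div contDiffAt_id (by simp; linarith)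

lemma kTt_deriv (s : ℝ) : kTt s + s * deriv kTt s = kth s := by
  have h1 : HasDerivAt (fun s => s * kTt s) (1 * kTt s + s * deriv kTt s) s :=
    (hasDerivAt_id s).mul ((kTt_contDiff.differentiable (by simp)) s).hasDerivAt
  have h2 : (fun s => s * kTt s) = kT := by
    funext x
    by_cases hx : x = 0
    · subst hx; simp [kT_zero]
    · simp only [kTt]; field_simp
  rw [h2] at h1
  rw [kth, h1.deriv]; ring

/-- radial kernel profile -/
def kg (R ε s : ℝ) : ℝ := (kTt (s / R ^ 2) / R ^ 2 - kTt (s / ε ^ 2) / ε ^ 2) / 2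

lemma kg_contDiff (R ε : ℝ) : ContDiff ℝ (⊤ : ℕ∞) (kg R ε) := by
  have := kTt_contDiff
  unfold kg
  fun_prop

lemma kg_zero {R ε s : ℝ} (hε : 0 < ε) (hR : ε ≤ R) (hs : R ^ 2 ≤ s) : kg R ε s = 0 := by
  have hR0 : 0 < R := by linarith
  have hs0 : 0 < s := by have := pow_pos hR0 2; linarith
  have h1 : 1 ≤ s / R ^ 2 := by rw [le_div_iff₀ (by positivity)]; linarith
  have h2 : 1 ≤ s / ε ^ 2 := by
    rw [le_div_iff₀ (by positivity)]
    have : ε ^ 2 ≤ R ^ 2 := by gcongr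
    linarith
  simp only [kg, kTt, kT_one h1, kT_one h2]
  field_simp
  ring

def kη (ρ s : ℝ) : ℝ := kth (s / ρ ^ 2) / ρ ^ 2

lemma kη_cont (ρ : ℝ) : Continuous (kη ρ) := by
  have := kth_contDiff.continuous
  unfold kη
  fun_prop

lemma kη_nonneg (ρ s : ℝ) : 0 ≤ kη ρ s := div_nonneg (kth_nonneg _) (by positivity)

lemma kη_zero {ρ s : ℝ} (hρ : 0 < ρ) (h : ρ ^ 2 < s) : kη ρ s = 0 := by
  rw [kη, kth_zero, zero_div]
  rw [lt_div_iff₀ (by positivity)]; linarith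

lemma kg_lap (R ε s : ℝ) : 2 * kg R ε s + 2 * s * deriv (kg R ε) s = kη R s - kη ε s := by
  have hd := kTt_contDiff.differentiable (by simp)
  have h1 : ∀ ρ : ℝ, HasDerivAt (fun s => kTt (s / ρ ^ 2)) (deriv kTt (s / ρ ^ 2) * (1 / ρ ^ 2)) s := by
    intro ρ
    exact ((hd (s / ρ ^ 2)).hasDerivAt).comp s ((hasDerivAt_id s).div_const (ρ ^ 2))
  have h2 : HasDerivAt (kg R ε) ((deriv kTt (s / R ^ 2) * (1 / R ^ 2) / R ^ 2
      - deriv kTt (s / ε ^ 2) * (1 / ε ^ 2) / ε ^ 2) / 2) s :=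
    (((h1 R).div_const _).sub ((h1 ε).div_const _)).div_const 2
  rw [h2.deriv, kη, kη, ← kTt_deriv, ← kTt_deriv, kg]
  ring

def sq2 (X z : ℝ × ℝ) : ℝ := (z.1 - X.1) ^ 2 + (z.2 - X.2) ^ 2

lemma sq2_cont (X : ℝ × ℝ) : Continuous (sq2 X) := by unfold sq2; fun_prop

def kC : ℝ := ∫ z : ℝ × ℝ, kth (z.1 ^ 2 + z.2 ^ 2)

lemma kC_pos : 0 < kC := by
  obtain ⟨s, hs, hs'⟩ := kth_pos
  have hc : Continuous fun z : ℝ × ℝ => kth (z.1 ^ 2 + z.2 ^ 2) :=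
    kth_contDiff.continuous.comp (by fun_prop)
  refine hc.integral_pos_of_hasCompactSupport_nonneg_nonzero ?_ (fun z => kth_nonneg _)
    (x := (√s, 0)) ?_
  · refine HasCompactSupport.intro (isCompact_Icc : IsCompact (Icc ((-1, -1) : ℝ × ℝ) (1, 1))) ?_
    intro z hz
    apply kth_zero
    by_contra! h
    apply hz
    have h1 : |z.1| ≤ 1 := abs_le_one_iff_mul_self_le_one.2 (by nlinarith [sq_nonneg z.2])
    have h2 : |z.2| ≤ 1 := abs_le_one_iff_mul_self_le_one.2 (by nlinarith [sq_nonneg z.1])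
    rw [abs_le] at h1 h2
    exact ⟨⟨h1.1, h2.1⟩, ⟨h1.2, h2.2⟩⟩
  · simpa [Real.sq_sqrt hs.le] using hs'

lemma kη_integral {ρ : ℝ} (hρ : 0 < ρ) (X : ℝ × ℝ) : ∫ z, kη ρ (sq2 X z) = kC := by
  have h1 := integral_sub_right_eq_self (μ := (volume : Measure (ℝ × ℝ)))
    (fun z : ℝ × ℝ => kη ρ (z.1 ^ 2 + z.2 ^ 2)) X
  have h2 := Measure.integral_comp_inv_smul (volume : Measure (ℝ × ℝ))
    (fun z : ℝ × ℝ => kth (z.1 ^ 2 + z.2 ^ 2)) ρ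
  have e1 : ∫ z, kη ρ (sq2 X z) = ∫ z : ℝ × ℝ, kη ρ (z.1 ^ 2 + z.2 ^ 2) := by
    rw [← h1]; rfl
  rw [e1]
  simp only [kη]
  rw [integral_div]
  have e2 : ∀ z : ℝ × ℝ, (z.1 ^ 2 + z.2 ^ 2) / ρ ^ 2 = (ρ⁻¹ • z).1 ^ 2 + (ρ⁻¹ • z).2 ^ 2 := by
    intro z; simp; field_simp
  simp_rw [e2]
  rw [h2]
  have : Module.finrank ℝ (ℝ × ℝ) = 2 := by simp
  rw [this, abs_of_pos (by positivity), smul_eq_mul, kC]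
  field_simp

end MC

/-! part 3 -/

namespace MC
open MeasureTheory

def K11 (g : ℝ → ℝ) (X z : ℝ × ℝ) : ℝ := g (sq2 X z) + 2 * (z.1 - X.1) ^ 2 * deriv g (sq2 X z)
def K12 (g : ℝ → ℝ) (X z : ℝ × ℝ) : ℝ := 2 * (z.1 - X.1) * (z.2 - X.2) * deriv g (sq2 X z)
def K22 (g : ℝ → ℝ) (X z : ℝ × ℝ) : ℝ := g (sq2 X z) + 2 * (z.2 - X.2) ^ 2 * deriv g (sq2 X z)
def K112 (g : ℝ → ℝ) (X z : ℝ × ℝ) : ℝ := 2 * (z.2 - X.2) * deriv g (sq2 X z)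
  + 4 * (z.1 - X.1) ^ 2 * (z.2 - X.2) * deriv (deriv g) (sq2 X z)
def K122 (g : ℝ → ℝ) (X z : ℝ × ℝ) : ℝ := 2 * (z.1 - X.1) * deriv g (sq2 X z)
  + 4 * (z.1 - X.1) * (z.2 - X.2) ^ 2 * deriv (deriv g) (sq2 X z)

lemma sq2_dx (X : ℝ × ℝ) (x y : ℝ) : HasDerivAt (fun x => sq2 X (x, y)) (2 * (x - X.1)) x := by
  have : HasDerivAt (fun x => (x - X.1) ^ 2 + (y - X.2) ^ 2) (2 * (x - X.1) ^ 1 * 1) x := by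
    have := (((hasDerivAt_id x).sub_const X.1).pow 2).add_const ((y - X.2) ^ 2)
    simpa using this
  simpa [sq2] using this

lemma sq2_dy (X : ℝ × ℝ) (x y : ℝ) : HasDerivAt (fun y => sq2 X (x, y)) (2 * (y - X.2)) y := by
  have : HasDerivAt (fun y => (x - X.1) ^ 2 + (y - X.2) ^ 2) (2 * (y - X.2) ^ 1 * 1) y := by
    have := (((hasDerivAt_id y).sub_const X.2).pow 2).const_add ((x - X.1) ^ 2)
    simpa using this
  simpa [sq2] using this

lemma comp_dx {g : ℝ → ℝ} (hg : Differentiable ℝ g) (X : ℝ × ℝ) (x y : ℝ) :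
    HasDerivAt (fun x => g (sq2 X (x, y))) (deriv g (sq2 X (x, y)) * (2 * (x - X.1))) x :=
  ((hg _).hasDerivAt).comp x (sq2_dx X x y)

lemma comp_dy {g : ℝ → ℝ} (hg : Differentiable ℝ g) (X : ℝ × ℝ) (x y : ℝ) :
    HasDerivAt (fun y => g (sq2 X (x, y))) (deriv g (sq2 X (x, y)) * (2 * (y - X.2))) y :=
  ((hg _).hasDerivAt).comp y (sq2_dy X x y)


lemma hg1 {g : ℝ → ℝ} (hg : ContDiff ℝ (⊤ : ℕ∞) g) : ContDiff ℝ (⊤ : ℕ∞) (deriv g) := (contDiff_infty_iff_deriv.1 hg).2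
lemma hgd {g : ℝ → ℝ} (hg : ContDiff ℝ (⊤ : ℕ∞) g) : Differentiable ℝ g := hg.differentiable (by simp)

lemma K11_cont {g : ℝ → ℝ} (hg : ContDiff ℝ (⊤ : ℕ∞) g) (X : ℝ × ℝ) : Continuous (K11 g X) := by
  have := hg.continuous; have := (hg1 hg).continuous; have := sq2_cont X
  unfold K11; fun_prop
lemma K12_cont {g : ℝ → ℝ} (hg : ContDiff ℝ (⊤ : ℕ∞) g) (X : ℝ × ℝ) : Continuous (K12 g X) := by
  have := hg.continuous; have := (hg1 hg).continuous; have := sq2_cont X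
  unfold K12; fun_prop
lemma K22_cont {g : ℝ → ℝ} (hg : ContDiff ℝ (⊤ : ℕ∞) g) (X : ℝ × ℝ) : Continuous (K22 g X) := by
  have := hg.continuous; have := (hg1 hg).continuous; have := sq2_cont X
  unfold K22; fun_prop
lemma K112_cont {g : ℝ → ℝ} (hg : ContDiff ℝ (⊤ : ℕ∞) g) (X : ℝ × ℝ) : Continuous (K112 g X) := by
  have := hg.continuous; have := (hg1 hg).continuous; have := sq2_cont X
  have := (hg1 (hg1 hg)).continuous
  unfold K112; fun_prop
lemma K122_cont {g : ℝ → ℝ} (hg : ContDiff ℝ (⊤ : ℕ∞) g) (X : ℝ × ℝ) : Continuous (K122 g X) := by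
  have := hg.continuous; have := (hg1 hg).continuous; have := sq2_cont X
  have := (hg1 (hg1 hg)).continuous
  unfold K122; fun_prop

lemma K11_dy {g : ℝ → ℝ} (hg : ContDiff ℝ (⊤ : ℕ∞) g) (X : ℝ × ℝ) (x y : ℝ) :
    HasDerivAt (fun y => K11 g X (x, y)) (K112 g X (x, y)) y := by
  have h := (comp_dy (hgd hg) X x y).add ((comp_dy (hgd (hg1 hg)) X x y).const_mul (2 * (x - X.1) ^ 2))
  refine h.congr_deriv ?_
  simp only [K112]; ring

lemma K12_dy {g : ℝ → ℝ} (hg : ContDiff ℝ (⊤ : ℕ∞) g) (X : ℝ × ℝ) (x y : ℝ) :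
    HasDerivAt (fun y => K12 g X (x, y)) (K122 g X (x, y)) y := by
  have h := (((hasDerivAt_id y).sub_const X.2).const_mul (2 * (x - X.1))).mul
    (comp_dy (hgd (hg1 hg)) X x y)
  refine h.congr_deriv ?_
  simp only [K122, id]; ring

lemma K12_dx {g : ℝ → ℝ} (hg : ContDiff ℝ (⊤ : ℕ∞) g) (X : ℝ × ℝ) (x y : ℝ) :
    HasDerivAt (fun x => K12 g X (x, y)) (K112 g X (x, y)) x := by
  have h := ((((hasDerivAt_id x).sub_const X.1).const_mul 2).mul_const (y - X.2)).mul
    (comp_dx (hgd (hg1 hg)) X x y)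
  refine h.congr_deriv ?_
  simp only [K112, id]; ring

lemma K22_dx {g : ℝ → ℝ} (hg : ContDiff ℝ (⊤ : ℕ∞) g) (X : ℝ × ℝ) (x y : ℝ) :
    HasDerivAt (fun x => K22 g X (x, y)) (K122 g X (x, y)) x := by
  have h := (comp_dx (hgd hg) X x y).add ((comp_dx (hgd (hg1 hg)) X x y).const_mul (2 * (y - X.2) ^ 2))
  refine h.congr_deriv ?_
  simp only [K122]; ring

/-- primitives in `x` -/
lemma A_dx {g : ℝ → ℝ} (hg : ContDiff ℝ (⊤ : ℕ∞) g) (X : ℝ × ℝ) (x y : ℝ) :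
    HasDerivAt (fun x => (x - X.1) * g (sq2 X (x, y))) (K11 g X (x, y)) x := by
  have h := ((hasDerivAt_id x).sub_const X.1).mul (comp_dx (hgd hg) X x y)
  refine h.congr_deriv ?_
  simp only [K11, id]; ring

lemma B_dx {g : ℝ → ℝ} (hg : ContDiff ℝ (⊤ : ℕ∞) g) (X : ℝ × ℝ) (x y : ℝ) :
    HasDerivAt (fun x => (y - X.2) * g (sq2 X (x, y))) (K12 g X (x, y)) x := by
  have h := (comp_dx (hgd hg) X x y).const_mul (y - X.2)
  refine h.congr_deriv ?_
  simp only [K12]; ring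
lemma deriv_zero_of {g : ℝ → ℝ} {r : ℝ} (h : ∀ s, r < s → g s = 0) : ∀ s, r < s → deriv g s = 0 := by
  intro s hs
  have : g =ᶠ[nhds s] fun _ => 0 := by
    filter_upwards [lt_mem_nhds hs] with x hx using h x hx
  rw [this.deriv_eq]; simp

/-- the structure of (globally reflected) gradient data on the plane -/
structure GD (W1 W2 W11 W12 W22 : ℝ × ℝ → ℝ) : Prop where
  c1 : Continuous W1
  c2 : Continuous W2
  c11 : Continuous W11
  c12 : Continuous W12
  m22 : Measurable W22
  b22 : ∀ m : ℝ, ∃ C, ∀ z : ℝ × ℝ, |z.1| ≤ m → |z.2| ≤ m → |W22 z| ≤ C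
  d11 : ∀ x y, HasDerivAt (fun x => W1 (x, y)) (W11 (x, y)) x
  d12 : ∀ x y, y ≠ 0 → HasDerivAt (fun y => W1 (x, y)) (W12 (x, y)) y
  d21 : ∀ x y, HasDerivAt (fun x => W2 (x, y)) (W12 (x, y)) x
  d22 : ∀ x y, y ≠ 0 → HasDerivAt (fun y => W2 (x, y)) (W22 (x, y)) y

lemma bdd_box {f : ℝ × ℝ → ℝ} (hf : Continuous f) (m : ℝ) :
    ∃ C, ∀ z : ℝ × ℝ, |z.1| ≤ m → |z.2| ≤ m → |f z| ≤ C := by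
  obtain ⟨C, hC⟩ := (isCompact_Icc : IsCompact (Icc ((-m, -m) : ℝ × ℝ) (m, m))).exists_bound_of_continuousOn
    hf.continuousOn
  refine ⟨C, fun z h1 h2 => ?_⟩
  rw [abs_le] at h1 h2
  exact hC z ⟨⟨h1.1, h2.1⟩, ⟨h1.2, h2.2⟩⟩

lemma sq2_far {X z : ℝ × ℝ} {R m : ℝ} (hR : 0 < R) (hm : |X.1| + |X.2| + R ≤ m)
    (h : m < |z.1| ∨ m < |z.2|) : R ^ 2 < sq2 X z := by
  unfold sq2
  rcases h with h | h
  · have h1 : R < |z.1 - X.1| := by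
      have := abs_sub_abs_le_abs_sub z.1 X.1
      have := abs_nonneg X.2
      linarith
    have : R ^ 2 < (z.1 - X.1) ^ 2 := by rw [← sq_abs (z.1 - X.1)]; gcongr
    nlinarith [sq_nonneg (z.2 - X.2)]
  · have h1 : R < |z.2 - X.2| := by
      have := abs_sub_abs_le_abs_sub z.2 X.2
      have := abs_nonneg X.1
      linarith
    have : R ^ 2 < (z.2 - X.2) ^ 2 := by rw [← sq_abs (z.2 - X.2)]; gcongr
    nlinarith [sq_nonneg (z.1 - X.1)]

lemma rep {W1 W2 W11 W12 W22 : ℝ × ℝ → ℝ} (h : GD W1 W2 W11 W12 W22)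
    {g : ℝ → ℝ} (hg : ContDiff ℝ (⊤ : ℕ∞) g) {R : ℝ} (hR : 0 < R) (hz : ∀ s, R ^ 2 < s → g s = 0)
    (X : ℝ × ℝ) :
    (∫ z, (K11 g X z + K22 g X z) * W11 z = ∫ z, K11 g X z * (W11 z + W22 z)) ∧
    (∫ z, (K11 g X z + K22 g X z) * W12 z = ∫ z, K12 g X z * (W11 z + W22 z)) := by
  set m := |X.1| + |X.2| + R with hm
  have hz1 := deriv_zero_of hz
  have hz2 := deriv_zero_of hz1
  have far : ∀ z : ℝ × ℝ, (m < |z.1| ∨ m < |z.2|) → R ^ 2 < sq2 X z :=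
    fun z => sq2_far hR le_rfl
  have s11 : ∀ z : ℝ × ℝ, (m < |z.1| ∨ m < |z.2|) → K11 g X z = 0 := fun z h => by
    simp [K11, hz _ (far z h), hz1 _ (far z h)]
  have s12 : ∀ z : ℝ × ℝ, (m < |z.1| ∨ m < |z.2|) → K12 g X z = 0 := fun z h => by
    simp [K12, hz1 _ (far z h)]
  have s22 : ∀ z : ℝ × ℝ, (m < |z.1| ∨ m < |z.2|) → K22 g X z = 0 := fun z h => by
    simp [K22, hz _ (far z h), hz1 _ (far z h)]
  have s112 : ∀ z : ℝ × ℝ, (m < |z.1| ∨ m < |z.2|) → K112 g X z = 0 := fun z h => by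
    simp [K112, hz2 _ (far z h), hz1 _ (far z h)]
  have s122 : ∀ z : ℝ × ℝ, (m < |z.1| ∨ m < |z.2|) → K122 g X z = 0 := fun z h => by
    simp [K122, hz2 _ (far z h), hz1 _ (far z h)]
  obtain ⟨C1, hC1⟩ := bdd_box h.c11 m
  obtain ⟨C2, hC2⟩ := bdd_box h.c12 m
  obtain ⟨C3, hC3⟩ := h.b22 m
  have q1 := fun z h1 h2 => (hC1 z h1 h2).trans ((le_max_left C1 C2).trans (le_max_left _ C3))
  have q2 := fun z h1 h2 => (hC2 z h1 h2).trans ((le_max_right C1 C2).trans (le_max_left _ C3))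
  have q3 := fun z h1 h2 => (hC3 z h1 h2).trans (le_max_right (max C1 C2) C3)
  obtain ⟨i1, i2, e1⟩ := mixed (K11_cont hg X) (K12_cont hg X) (K112_cont hg X) h.c1
    h.c11.measurable h.c12.measurable (K11_dy hg X) (K12_dx hg X) h.d11 h.d12 s11 s12 s112 q1 q2
  obtain ⟨i3, i4, e2⟩ := mixed (K12_cont hg X) (K22_cont hg X) (K122_cont hg X) h.c1
    h.c11.measurable h.c12.measurable (K12_dy hg X) (K22_dx hg X) h.d11 h.d12 s12 s22 s122 q1 q2
  obtain ⟨i5, i6, e3⟩ := mixed (K11_cont hg X) (K12_cont hg X) (K112_cont hg X) h.c2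
    h.c12.measurable h.m22 (K11_dy hg X) (K12_dx hg X) h.d21 h.d22 s11 s12 s112 q2 q3
  obtain ⟨i7, i8, e4⟩ := mixed (K12_cont hg X) (K22_cont hg X) (K122_cont hg X) h.c2
    h.c12.measurable h.m22 (K12_dy hg X) (K22_dx hg X) h.d21 h.d22 s12 s22 s122 q2 q3
  have i9 : Integrable fun z => K11 g X z * W11 z := by
    obtain ⟨Ck, hCk⟩ := bdd_box ((K11_cont hg X).mul h.c11) m
    refine integrable_box (m := m) (C := |Ck|) ((K11_cont hg X).mul h.c11).measurable ?_ ?_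
    · intro z
      by_cases hz : m < |z.1| ∨ m < |z.2|
      · rw [s11 z hz]; simp
      · push Not at hz
        exact (hCk z hz.1 hz.2).trans (le_abs_self _)
    · intro z hz; rw [s11 z hz, zero_mul]
  simp only [add_mul, mul_add]
  constructor
  · rw [integral_add i9 i3, integral_add i9 i6, e2, ← e3]
  · rw [integral_add i2 i7, integral_add i1 i8, e1, e4]

end MC

/-! part 4 -/

namespace MC
open MeasureTheory

/-- integral against a function with bounded values supported in the square of radius `ρ` -/
lemma integral_bound_sq {f : ℝ × ℝ → ℝ} {X : ℝ × ℝ} {ρ C : ℝ} (hρ : 0 ≤ ρ) (hC : 0 ≤ C)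
    (hb : ∀ z, dist z X ≤ ρ → |f z| ≤ C) (hs : ∀ z, ρ < dist z X → f z = 0) :
    |∫ z, f z| ≤ C * (2 * ρ) ^ 2 := by
  have e : ∫ z, f z = ∫ z in closedBall X ρ, f z := by
    symm
    apply setIntegral_eq_integral_of_forall_compl_eq_zero
    intro z hz
    apply hs
    simpa using hz
  rw [e]
  have hv : (volume : Measure (ℝ × ℝ)).real (closedBall X ρ) = (2 * ρ) ^ 2 := by
    have : closedBall X ρ = closedBall X.1 ρ ×ˢ closedBall X.2 ρ :=
      (closedBall_prod_same X.1 X.2 ρ).symm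
    rw [this, Measure.volume_eq_prod, measureReal_prod_prod]
    simp [Measure.real, Real.volume_closedBall, hρ]
    ring
  have := norm_setIntegral_le_of_norm_le_const (μ := (volume : Measure (ℝ × ℝ)))
    (s := closedBall X ρ) (f := f) (C := C) (isCompact_closedBall X ρ).measure_lt_top
    (fun z hz => hb z hz)
  rw [hv] at this
  exact this

lemma dist_far {X z : ℝ × ℝ} {ρ : ℝ} (hρ : 0 ≤ ρ) (h : ρ < dist z X) : ρ ^ 2 < sq2 X z := by
  rw [Prod.dist_eq, lt_max_iff] at h
  unfold sq2
  rcases h with h | h <;> rw [Real.dist_eq] at h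
  · have : ρ ^ 2 < (z.1 - X.1) ^ 2 := by rw [← sq_abs (z.1 - X.1)]; gcongr
    nlinarith [sq_nonneg (z.2 - X.2)]
  · have : ρ ^ 2 < (z.2 - X.2) ^ 2 := by rw [← sq_abs (z.2 - X.2)]; gcongr
    nlinarith [sq_nonneg (z.1 - X.1)]

lemma integrable_of_supp {f D : ℝ × ℝ → ℝ} (hf : Continuous f) (hD : Continuous D) {X : ℝ × ℝ} {ρ : ℝ}
    (hs : ∀ z, ρ < dist z X → f z = 0) : Integrable fun z => f z * D z := by
  apply (hf.mul hD).integrable_of_hasCompactSupport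
  refine HasCompactSupport.intro (isCompact_closedBall X ρ) ?_
  intro z hz
  rw [Pi.mul_apply, hs z (by simpa using hz), zero_mul]

lemma kη_supp {ρ : ℝ} (hρ : 0 < ρ) (X z : ℝ × ℝ) (h : ρ < dist z X) : kη ρ (sq2 X z) = 0 :=
  kη_zero hρ (dist_far hρ.le h)

/-- first term : averaging at small scale -/
lemma small_scale {D : ℝ × ℝ → ℝ} (hD : Continuous D) {X : ℝ × ℝ} {ε C : ℝ} (hε : 0 < ε)
    (hb : ∀ z, dist z X ≤ ε → |D X - D z| ≤ C) :
    |kC * D X - ∫ z, kη ε (sq2 X z) * D z| ≤ kC * C := by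
  have hk : Continuous fun z => kη ε (sq2 X z) := (kη_cont ε).comp (sq2_cont X)
  have i1 := integrable_of_supp hk hD (kη_supp hε X)
  have i0 : Integrable fun z => kη ε (sq2 X z) := by
    simpa using integrable_of_supp hk (continuous_const (y := (1 : ℝ))) (kη_supp hε X)
  rw [← kη_integral hε X, ← integral_mul_const, ← integral_sub (i0.mul_const _) i1,
    ← integral_mul_const]
  rw [← Real.norm_eq_abs]
  refine norm_integral_le_of_norm_le (i0.mul_const C) (Filter.Eventually.of_forall fun z => ?_)
  rw [← mul_sub, norm_mul, Real.norm_eq_abs, Real.norm_eq_abs, abs_of_nonneg (kη_nonneg _ _)]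
  by_cases h : dist z X ≤ ε
  · exact mul_le_mul_of_nonneg_left (hb z h) (kη_nonneg _ _)
  · rw [kη_supp hε X z (not_le.1 h)]; simp

lemma kth_lip : ∃ L : ℝ, 0 ≤ L ∧ ∀ s t, |kth s - kth t| ≤ L * |s - t| := by
  have hc : Continuous (deriv kth) := (hg1 kth_contDiff).continuous
  have hs : HasCompactSupport kth := by
    refine HasCompactSupport.intro (isCompact_Icc : IsCompact (Icc (0 : ℝ) 1)) ?_
    intro s h
    rw [mem_Icc, not_and_or] at h
    rcases h with h | h
    · exact kth_zero' (by linarith)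
    · exact kth_zero (by linarith)
  obtain ⟨C, hC⟩ := hs.deriv.exists_bound_of_continuous hc
  refine ⟨C, (norm_nonneg _).trans (hC 0), fun s t => ?_⟩
  exact Convex.norm_image_sub_le_of_norm_deriv_le (s := univ) (f := kth)
    (fun x _ => (kth_contDiff.differentiable (by simp)) x) (fun x _ => hC x) convex_univ
    (mem_univ t) (mem_univ s)

/-- second term: averages at large scale vary slowly -/
lemma large_scale {D : ℝ × ℝ → ℝ} (hD : Continuous D) {X Y : ℝ × ℝ} {R c L C : ℝ} (hR : 0 < R)
    (hc : 0 ≤ c) (hcR : c ≤ R) (hC : 0 ≤ C) (hL : 0 ≤ L)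
    (hlip : ∀ s t, |kth s - kth t| ≤ L * |s - t|) (hXY : dist X Y ≤ c)
    (hb : ∀ z, dist z X ≤ 2 * R → |D z - D X| ≤ C) :
    |(∫ z, kη R (sq2 X z) * D z) - ∫ z, kη R (sq2 Y z) * D z| ≤ 160 * L * c / R * C := by
  have hk : ∀ X, Continuous fun z => kη R (sq2 X z) := fun X => (kη_cont R).comp (sq2_cont X)
  have i1 := fun X => integrable_of_supp (hk X) hD (kη_supp hR X)
  have i0 : ∀ X, Integrable fun z => kη R (sq2 X z) := fun X => by
    simpa using integrable_of_supp (hk X) (continuous_const (y := (1 : ℝ))) (kη_supp hR X)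
  have e : (∫ z, kη R (sq2 X z) * D z) - ∫ z, kη R (sq2 Y z) * D z
      = ∫ z, (kη R (sq2 X z) - kη R (sq2 Y z)) * (D z - D X) := by
    have : ∫ z, (kη R (sq2 X z) - kη R (sq2 Y z)) * (D z - D X)
        = ∫ z, ((kη R (sq2 X z) * D z - kη R (sq2 Y z) * D z) -
          (kη R (sq2 X z) * D X - kη R (sq2 Y z) * D X)) := by
      congr 1; funext z; ring
    have i2 : Integrable (fun z => kη R (sq2 X z) * D z - kη R (sq2 Y z) * D z) := (i1 X).sub (i1 Y)
    have i3 : Integrable (fun z => kη R (sq2 X z) * D X - kη R (sq2 Y z) * D X) :=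
      ((i0 X).mul_const _).sub ((i0 Y).mul_const _)
    rw [this, integral_sub i2 i3,
      integral_sub (i1 X) (i1 Y), integral_sub ((i0 X).mul_const _) ((i0 Y).mul_const _),
      integral_mul_const, integral_mul_const, kη_integral hR, kη_integral hR]
    ring
  rw [e]
  have key := integral_bound_sq (f := fun z => (kη R (sq2 X z) - kη R (sq2 Y z)) * (D z - D X))
    (X := X) (ρ := 2 * R) (C := (10 * L * c / R ^ 3) * C) (by positivity) (by positivity) ?_ ?_
  · refine key.trans (le_of_eq ?_)
    field_simp
    ring
  · intro z hz
    rw [abs_mul]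
    refine mul_le_mul ?_ (hb z hz) (abs_nonneg _) (by positivity)
    have h1 : |kη R (sq2 X z) - kη R (sq2 Y z)| ≤ L * |sq2 X z / R ^ 2 - sq2 Y z / R ^ 2| / R ^ 2 := by
      simp only [kη]
      rw [← sub_div, abs_div, abs_of_pos (show (0 : ℝ) < R ^ 2 by positivity)]
      gcongr
      exact hlip _ _
    have h2 : |sq2 X z - sq2 Y z| ≤ 10 * R * c := by
      rw [Prod.dist_eq, max_le_iff, Real.dist_eq, Real.dist_eq] at hz hXY
      have a1 : |z.1 - Y.1| ≤ 3 * R := by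
        have := abs_sub_le z.1 X.1 Y.1; linarith [hz.1, hXY.1]
      have a2 : |z.2 - Y.2| ≤ 3 * R := by
        have := abs_sub_le z.2 X.2 Y.2; linarith [hz.2, hXY.2]
      have e1 : sq2 X z - sq2 Y z = (Y.1 - X.1) * ((z.1 - X.1) + (z.1 - Y.1))
          + (Y.2 - X.2) * ((z.2 - X.2) + (z.2 - Y.2)) := by unfold sq2; ring
      have b1 : |(Y.1 - X.1) * ((z.1 - X.1) + (z.1 - Y.1))| ≤ c * (5 * R) := by
        rw [abs_mul]
        refine mul_le_mul (by rw [abs_sub_comm]; exact hXY.1) ?_ (abs_nonneg _) hc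
        exact (abs_add_le _ _).trans (by linarith [hz.1])
      have b2 : |(Y.2 - X.2) * ((z.2 - X.2) + (z.2 - Y.2))| ≤ c * (5 * R) := by
        rw [abs_mul]
        refine mul_le_mul (by rw [abs_sub_comm]; exact hXY.2) ?_ (abs_nonneg _) hc
        exact (abs_add_le _ _).trans (by linarith [hz.2])
      rw [e1]
      exact (abs_add_le _ _).trans (by linarith)
    refine h1.trans ?_
    rw [← sub_div, abs_div, abs_of_pos (show (0 : ℝ) < R ^ 2 by positivity)]
    calc L * (|sq2 X z - sq2 Y z| / R ^ 2) / R ^ 2 ≤ L * ((10 * R * c) / R ^ 2) / R ^ 2 := by gcongr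
      _ = 10 * L * c / R ^ 3 := by field_simp
  · intro z hz
    have h1 : R < dist z X := by linarith
    have h2 : R < dist z Y := by
      have := dist_triangle z Y X
      rw [dist_comm Y X] at this
      linarith
    rw [kη_supp hR X z h1, kη_supp hR Y z h2]; simp

/-- third term : tangential cancellation -/
lemma tangential {K Φ H : ℝ × ℝ → ℝ} {X : ℝ × ℝ} {R CK C : ℝ} (hR : 0 < R) (hCK : 0 ≤ CK) (hC : 0 ≤ C)
    (hK : Continuous K) (hΦ : Continuous Φ)
    (hd : ∀ x y, HasDerivAt (fun x => Φ (x, y)) (K (x, y)) x)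
    (hs : ∀ z, R < dist z X → K z = 0) (hsΦ : ∀ z, R < dist z X → Φ z = 0)
    (hKb : ∀ z, |K z| ≤ CK) (hHm : Measurable H)
    (hHb : ∀ m : ℝ, ∃ C, ∀ z : ℝ × ℝ, |z.1| ≤ m → |z.2| ≤ m → |H z| ≤ C)
    (hH : ∀ z, dist z X ≤ R → |H z - H (X.1, z.2)| ≤ C) :
    |∫ z, K z * H z| ≤ CK * C * (2 * R) ^ 2 := by
  set m := |X.1| + |X.2| + R with hm
  have far : ∀ z : ℝ × ℝ, (m < |z.1| ∨ m < |z.2|) → R < dist z X := by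
    intro z h
    rw [Prod.dist_eq, lt_max_iff, Real.dist_eq, Real.dist_eq]
    rcases h with h | h
    · left
      have := abs_sub_abs_le_abs_sub z.1 X.1
      have := abs_nonneg X.2
      linarith
    · right
      have := abs_sub_abs_le_abs_sub z.2 X.2
      have := abs_nonneg X.1
      linarith
  obtain ⟨CH, hCH⟩ := hHb m
  have i1 : Integrable fun z => K z * H z := by
    refine integrable_box (m := m) (C := CK * |CH|) (hK.measurable.mul hHm) ?_ ?_
    · intro z
      by_cases h : m < |z.1| ∨ m < |z.2|
      · rw [hs z (far z h)]; simp; positivity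
      · push Not at h
        rw [abs_mul]
        exact mul_le_mul (hKb z) ((hCH z h.1 h.2).trans (le_abs_self _)) (abs_nonneg _) hCK
    · intro z h; rw [hs z (far z h), zero_mul]
  have hX1 : |X.1| ≤ m := by have := abs_nonneg X.2; linarith
  have i2 : Integrable fun z : ℝ × ℝ => K z * H (X.1, z.2) := by
    refine integrable_box (m := m) (C := CK * |CH|)
      (hK.measurable.mul (hHm.comp (by fun_prop))) ?_ ?_
    · intro z
      by_cases h : m < |z.1| ∨ m < |z.2|
      · rw [hs z (far z h)]; simp; positivity
      · push Not at h
        rw [abs_mul]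
        exact mul_le_mul (hKb z) ((hCH (X.1, z.2) hX1 h.2).trans (le_abs_self _)) (abs_nonneg _) hCK
    · intro z h; rw [hs z (far z h), zero_mul]
  have z0 : ∫ z : ℝ × ℝ, K z * H (X.1, z.2) = 0 := by
    have e := integral_prod_symm (μ := (volume : Measure ℝ)) (ν := (volume : Measure ℝ))
      (fun z : ℝ × ℝ => K z * H (X.1, z.2)) i2
    rw [← Measure.volume_eq_prod] at e
    rw [e]
    have : ∀ y, ∫ x, K (x, y) * H (X.1, y) = 0 := by
      intro y
      rw [integral_mul_const]
      rw [integral_deriv_zero (f := fun x => Φ (x, y)) (m := m) (by fun_prop) (fun x _ => hd x y)]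
      · simp
      · apply Continuous.integrable_of_hasCompactSupport (by fun_prop)
        refine HasCompactSupport.intro (isCompact_Icc : IsCompact (Icc (-m) m)) ?_
        intro x hx
        apply hs _ (far _ (Or.inl _))
        by_contra! h
        exact hx (abs_le.1 h)
      · intro x hx; exact hsΦ _ (far _ (Or.inl hx))
      · intro x hx; exact hs _ (far _ (Or.inl hx))
    simp [this]
  have e : ∫ z, K z * H z = ∫ z : ℝ × ℝ, K z * (H z - H (X.1, z.2)) := by
    simp only [mul_sub]
    rw [integral_sub i1 i2, z0, sub_zero]
  rw [e]
  apply integral_bound_sq hR.le (by positivity)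
  · intro z hz
    rw [abs_mul]
    exact mul_le_mul (hKb z) (hH z hz) (abs_nonneg _) hCK
  · intro z hz; rw [hs z hz, zero_mul]

end MC

/-! part 5 -/

namespace MC
open MeasureTheory

lemma K_shift {K : ℝ × ℝ → ℝ × ℝ → ℝ} (hsh : ∀ X z, K X z = K 0 (z - X)) (hc : Continuous (K 0)) {R : ℝ}
    (hs : ∀ z, R < dist z 0 → K 0 z = 0) : ∃ C, 0 ≤ C ∧ ∀ X z, |K X z| ≤ C := by
  have h : HasCompactSupport (K 0) := HasCompactSupport.intro (isCompact_closedBall 0 R) (by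
    intro z hz; exact hs z (by simpa using hz))
  obtain ⟨C, hC⟩ := h.exists_bound_of_continuous hc
  exact ⟨C, (norm_nonneg _).trans (hC 0), fun X z => by rw [hsh]; exact hC _⟩

lemma K11_shift (g : ℝ → ℝ) (X z : ℝ × ℝ) : K11 g X z = K11 g 0 (z - X) := by simp [K11, sq2]
lemma K12_shift (g : ℝ → ℝ) (X z : ℝ × ℝ) : K12 g X z = K12 g 0 (z - X) := by simp [K12, sq2]

/-- combination of the three terms, for one kernel -/
lemma core_aux {D H : ℝ × ℝ → ℝ} {K Φ : ℝ × ℝ → ℝ × ℝ → ℝ} {X1 X2 : ℝ × ℝ} {R ε c L N J CK : ℝ} (hD : Continuous D)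
    (hε : 0 < ε) (hεR : ε ≤ R) (hc : 0 ≤ c) (hcR : c ≤ R) (hL : 0 ≤ L)
    (hlip : ∀ s t, |kth s - kth t| ≤ L * |s - t|) (hX : dist X1 X2 ≤ c) (hN : 0 ≤ N) (hJ : 0 ≤ J) (hCK : 0 ≤ CK)
    (hK : ∀ X, Continuous (K X)) (hΦ : ∀ X, Continuous (Φ X))
    (hd : ∀ X x y, HasDerivAt (fun x => Φ X (x, y)) (K X (x, y)) x)
    (hs : ∀ X z, R < dist z X → K X z = 0) (hsΦ : ∀ X z, R < dist z X → Φ X z = 0)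
    (hKb : ∀ X z, |K X z| ≤ CK) (hHm : Measurable H)
    (hHb : ∀ m : ℝ, ∃ C, ∀ z : ℝ × ℝ, |z.1| ≤ m → |z.2| ≤ m → |H z| ≤ C)
    (hrep : ∀ X, ∫ z, (kη R (sq2 X z) - kη ε (sq2 X z)) * D z = ∫ z, K X z * H z)
    (hDN : ∀ p ∈ closedBall X1 (2 * R), ∀ q ∈ closedBall X1 (2 * R), |D p - D q| ≤ N * √(dist p q))
    (hHJ : ∀ x x' y, (x, y) ∈ closedBall X1 (2 * R) → (x', y) ∈ closedBall X1 (2 * R) →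
      |H (x, y) - H (x', y)| ≤ J * √|x - x'|) :
    kC * |D X1 - D X2| ≤ 2 * (kC * (N * √ε)) + 160 * L * c / R * (N * √(2 * R)) +
      2 * (CK * (J * √R) * (2 * R) ^ 2) := by
  have hR : 0 < R := hε.trans_le hεR
  have hk : ∀ ρ X, Continuous fun z => kη ρ (sq2 X z) := fun ρ X => (kη_cont ρ).comp (sq2_cont X)
  have e : ∀ X, (∫ z, kη R (sq2 X z) * D z) - ∫ z, kη ε (sq2 X z) * D z = ∫ z, K X z * H z := by
    intro X
    rw [← hrep X, ← integral_sub (integrable_of_supp (hk R X) hD (kη_supp hR X))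
      (integrable_of_supp (hk ε X) hD (kη_supp hε X))]
    congr 1; funext z; ring
  have inb : ∀ X, dist X X1 ≤ R → ∀ z, dist z X ≤ R → z ∈ closedBall X1 (2 * R) := by
    intro X h z hz
    rw [mem_closedBall]
    linarith [dist_triangle z X X1]
  have h1 : dist X1 X1 ≤ R := by rw [dist_self]; exact hR.le
  have h2 : dist X2 X1 ≤ R := by rw [dist_comm]; linarith
  have S : ∀ X, dist X X1 ≤ R → |kC * D X - ∫ z, kη ε (sq2 X z) * D z| ≤ kC * (N * √ε) := by
    intro X h
    apply small_scale hD hε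
    intro z hz
    refine (hDN X (inb X h X (by rw [dist_self]; exact hR.le)) z (inb X h z (by linarith))).trans ?_
    rw [dist_comm]
    gcongr
  have T : ∀ X, dist X X1 ≤ R → |∫ z, K X z * H z| ≤ CK * (J * √R) * (2 * R) ^ 2 := by
    intro X h
    apply tangential hR hCK (by positivity) (hK X) (hΦ X) (hd X) (hs X) (hsΦ X) (hKb X) hHm hHb
    intro z hz
    have hz1 : dist z.1 X.1 ≤ R := (le_max_left _ _).trans hz
    have hz2 : dist z.2 X.2 ≤ R := (le_max_right _ _).trans hz
    refine (hHJ z.1 X.1 z.2 (inb X h _ hz) (inb X h _ ?_)).trans ?_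
    · rw [Prod.dist_eq]; simp [hz2, hR.le]
    · rw [Real.dist_eq] at hz1
      gcongr
  have Lg := large_scale hD hR hc hcR (by positivity : 0 ≤ N * √(2 * R)) hL hlip hX (by
    intro z hz
    refine (hDN z hz X1 (inb X1 h1 X1 h1)).trans ?_
    gcongr)
  have s1 := S X1 h1
  have s2 := S X2 h2
  have t1 := T X1 h1
  have t2 := T X2 h2
  rw [← e] at t1 t2
  rw [← abs_of_pos kC_pos, ← abs_mul, abs_of_pos kC_pos]
  rw [abs_le] at *
  constructor <;> linarith [s1.1, s1.2, s2.1, s2.2, t1.1, t1.2, t2.1, t2.2, Lg.1, Lg.2]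

lemma core (c δ : ℝ) (hc : 0 ≤ c) (hδ : 0 < δ) : ∃ R C : ℝ, 0 < R ∧ 0 ≤ C ∧
    ∀ W1 W2 W11 W12 W22 : ℝ × ℝ → ℝ, GD W1 W2 W11 W12 W22 → ∀ X1 X2 : ℝ × ℝ, dist X1 X2 ≤ c →
    ∀ N J : ℝ, 0 ≤ N → 0 ≤ J →
    (∀ p ∈ closedBall X1 (2 * R), ∀ q ∈ closedBall X1 (2 * R), |W11 p - W11 q| ≤ N * √(dist p q)) →
    (∀ p ∈ closedBall X1 (2 * R), ∀ q ∈ closedBall X1 (2 * R), |W12 p - W12 q| ≤ N * √(dist p q)) →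
    (∀ x x' y, (x, y) ∈ closedBall X1 (2 * R) → (x', y) ∈ closedBall X1 (2 * R) →
      |(W11 (x, y) + W22 (x, y)) - (W11 (x', y) + W22 (x', y))| ≤ J * √|x - x'|) →
    |W11 X1 - W11 X2| ≤ δ * N + C * J ∧ |W12 X1 - W12 X2| ≤ δ * N + C * J := by
  obtain ⟨L, hL, hlip⟩ := kth_lip
  have hk := kC_pos
  set M := 160 * L * c * √2 * 2 / (kC * δ) with hM
  have hM0 : 0 ≤ M := by positivity
  set q := c + 1 + M with hq
  have hq1 : 1 ≤ q := by linarith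
  set R := q ^ 2 with hR
  have hqR : q ≤ R := by nlinarith
  have hR1 : 1 ≤ R := by linarith
  set ε := (min 1 (δ / 4)) ^ 2 with hε
  have hm : 0 < min 1 (δ / 4) := by positivity
  have hε0 : 0 < ε := by positivity
  have hεR : ε ≤ R := by
    have : min 1 (δ / 4) ≤ 1 := min_le_left _ _
    nlinarith
  have hsε : √ε ≤ δ / 4 := by rw [hε, Real.sqrt_sq hm.le]; exact min_le_right _ _
  have hsR : √(2 * R) = √2 * q := by
    rw [Real.sqrt_mul (by norm_num), hR, Real.sqrt_sq (by linarith)]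
  have hgc := kg_contDiff R ε
  have hgz : ∀ s, R ^ 2 < s → kg R ε s = 0 := fun s h => kg_zero hε0 hεR h.le
  have hgz1 := deriv_zero_of hgz
  have far : ∀ X z : ℝ × ℝ, R < dist z X → R ^ 2 < sq2 X z := fun X z h => dist_far (by linarith) h
  have s11 : ∀ X z, R < dist z X → K11 (kg R ε) X z = 0 := fun X z h => by
    simp [K11, hgz _ (far X z h), hgz1 _ (far X z h)]
  have s12 : ∀ X z, R < dist z X → K12 (kg R ε) X z = 0 := fun X z h => by
    simp [K12, hgz1 _ (far X z h)]
  obtain ⟨C1, hC1, hb1⟩ := K_shift (K11_shift (kg R ε)) (K11_cont hgc 0) (s11 0)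
  obtain ⟨C2, hC2, hb2⟩ := K_shift (K12_shift (kg R ε)) (K12_cont hgc 0) (s12 0)
  set CK := max C1 C2
  have hCK : 0 ≤ CK := hC1.trans (le_max_left _ _)
  refine ⟨R, (2 * (CK * √R * (2 * R) ^ 2)) / kC, by linarith, by positivity, ?_⟩
  intro W1 W2 W11 W12 W22 hW X1 X2 hX N J hN hJ h11 h12 hH
  have hHm : Measurable fun z => W11 z + W22 z := hW.c11.measurable.add hW.m22
  have hHb : ∀ m : ℝ, ∃ C, ∀ z : ℝ × ℝ, |z.1| ≤ m → |z.2| ≤ m → |W11 z + W22 z| ≤ C := by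
    intro m
    obtain ⟨A, hA⟩ := bdd_box hW.c11 m
    obtain ⟨B, hB⟩ := hW.b22 m
    exact ⟨A + B, fun z h1 h2 => (abs_add_le _ _).trans (add_le_add (hA z h1 h2) (hB z h1 h2))⟩
  have hsum : ∀ X z, K11 (kg R ε) X z + K22 (kg R ε) X z = kη R (sq2 X z) - kη ε (sq2 X z) := by
    intro X z
    rw [← kg_lap]; simp only [K11, K22]
    have : sq2 X z = (z.1 - X.1) ^ 2 + (z.2 - X.2) ^ 2 := rfl
    linear_combination (-2 * deriv (kg R ε) (sq2 X z)) * this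
  have hrep := fun X => rep hW hgc (R := R) (by linarith) hgz X
  simp only [hsum] at hrep
  have fin : ∀ d : ℝ, kC * d ≤ 2 * (kC * (N * √ε)) + 160 * L * c / R * (N * √(2 * R)) +
      2 * (CK * (J * √R) * (2 * R) ^ 2) → d ≤ δ * N + (2 * (CK * √R * (2 * R) ^ 2)) / kC * J := by
    intro d hd
    have b1 : 160 * L * c / R * (N * √(2 * R)) ≤ kC * (δ / 2 * N) := by
      have : 160 * L * c / R * (N * √(2 * R)) = (160 * L * c * √2 / q) * N := by
        rw [hsR, hR]; field_simp
      rw [this]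
      have h3 : 160 * L * c * √2 / q ≤ kC * (δ / 2) := by
        rw [div_le_iff₀ (by linarith)]
        have : M ≤ q := by linarith
        rw [hM, div_le_iff₀ (by positivity)] at this
        linarith
      calc _ ≤ kC * (δ / 2) * N := by gcongr
        _ = _ := by ring
    have b2 : 2 * (kC * (N * √ε)) ≤ kC * (δ / 2 * N) := by
      have : kC * N * √ε ≤ kC * N * (δ / 4) := by gcongr
      linarith
    have : kC * d ≤ kC * (δ * N + (2 * (CK * √R * (2 * R) ^ 2)) / kC * J) := by
      have : kC * (δ * N + (2 * (CK * √R * (2 * R) ^ 2)) / kC * J)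
        = kC * (δ * N) + 2 * (CK * √R * (2 * R) ^ 2) * J := by field_simp
      rw [this]; linarith
    exact le_of_mul_le_mul_left this hk
  have scont : ∀ X : ℝ × ℝ, Continuous fun z => kg R ε (sq2 X z) := fun X => hgc.continuous.comp (sq2_cont X)
  constructor
  · apply fin
    exact core_aux (K := K11 (kg R ε)) (Φ := fun X z => (z.1 - X.1) * kg R ε (sq2 X z)) hW.c11 hε0 hεR hc (by linarith) hL hlip hX hN hJ hCK
      (fun X => K11_cont hgc X) (fun X => (by fun_prop : Continuous fun z : ℝ × ℝ => z.1 - X.1).mul (scont X))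
      (fun X x y => A_dx hgc X x y) s11 (fun X z h => by simp [hgz _ (far X z h)])
      (fun X z => (hb1 X z).trans (le_max_left _ _)) hHm hHb (fun X => (hrep X).1) h11 hH
  · apply fin
    exact core_aux (K := K12 (kg R ε)) (Φ := fun X z => (z.2 - X.2) * kg R ε (sq2 X z)) hW.c12 hε0 hεR hc (by linarith) hL hlip hX hN hJ hCK
      (fun X => K12_cont hgc X) (fun X => (by fun_prop : Continuous fun z : ℝ × ℝ => z.2 - X.2).mul (scont X))
      (fun X x y => B_dx hgc X x y) s12 (fun X z h => by simp [hgz _ (far X z h)])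
      (fun X z => (hb2 X z).trans (le_max_right _ _)) hHm hHb (fun X => (hrep X).2) h12 hH

end MC

/-! part 6 -/

namespace MC
open MeasureTheory

def fold (z : ℝ × ℝ) : ℝ × ℝ := (z.1, |z.2|)
def evE (f : ℝ × ℝ → ℝ) (z : ℝ × ℝ) : ℝ := f (fold z)
def odE (f : ℝ × ℝ → ℝ) (z : ℝ × ℝ) : ℝ := if 0 ≤ z.2 then f (fold z) else -f (fold z)
abbrev HPl : Set (ℝ × ℝ) := {z | 0 ≤ z.2}

lemma fold_cont : Continuous fold := by unfold fold; fun_prop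
lemma fold_mem (z : ℝ × ℝ) : fold z ∈ HPl := abs_nonneg z.2
lemma fold_id {z : ℝ × ℝ} (h : 0 ≤ z.2) : fold z = z := by simp [fold, abs_of_nonneg h]
lemma fold_dist (z w : ℝ × ℝ) : dist (fold z) (fold w) ≤ dist z w := by
  rw [Prod.dist_eq, Prod.dist_eq]
  apply max_le_max le_rfl
  simpa [Real.dist_eq, fold] using abs_abs_sub_abs_le z.2 w.2
lemma evE_cont {f : ℝ × ℝ → ℝ} (hf : ContinuousOn f HPl) : Continuous (evE f) :=
  hf.comp_continuous fold_cont fold_mem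
lemma odE_cont {f : ℝ × ℝ → ℝ} (hf : ContinuousOn f HPl) (h0 : ∀ x, f (x, 0) = 0) : Continuous (odE f) := by
  refine Continuous.if_le (evE_cont hf) (evE_cont hf).neg continuous_const continuous_snd ?_
  intro z hz
  have : fold z = (z.1, 0) := by simp [fold, ← hz]
  simp [evE, this, h0]
lemma odE_meas {f : ℝ × ℝ → ℝ} (hf : ContinuousOn f HPl) : Measurable (odE f) :=
  Measurable.ite (measurableSet_le measurable_const measurable_snd) (evE_cont hf).measurable
    (evE_cont hf).neg.measurable
lemma odE_abs (f : ℝ × ℝ → ℝ) (z : ℝ × ℝ) : |odE f z| = |evE f z| := by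
  unfold odE evE; split_ifs <;> simp

/-- gradient data on the half plane -/
structure HD (w1 w2 w11 w12 w22 : ℝ × ℝ → ℝ) : Prop where
  c1 : ContinuousOn w1 HPl
  c2 : ContinuousOn w2 HPl
  c11 : ContinuousOn w11 HPl
  c12 : ContinuousOn w12 HPl
  c22 : ContinuousOn w22 HPl
  d11 : ∀ x y, 0 ≤ y → HasDerivAt (fun x => w1 (x, y)) (w11 (x, y)) x
  d12 : ∀ x y, 0 < y → HasDerivAt (fun y => w1 (x, y)) (w12 (x, y)) y
  d21 : ∀ x y, 0 ≤ y → HasDerivAt (fun x => w2 (x, y)) (w12 (x, y)) x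
  d22 : ∀ x y, 0 < y → HasDerivAt (fun y => w2 (x, y)) (w22 (x, y)) y
  z1 : ∀ x, w1 (x, 0) = 0

lemma HD.z11 {w1 w2 w11 w12 w22 : ℝ × ℝ → ℝ} (h : HD w1 w2 w11 w12 w22) (x : ℝ) : w11 (x, 0) = 0 := by
  have := h.d11 x 0 le_rfl
  simp only [h.z1] at this
  exact this.unique (hasDerivAt_const x 0)

lemma odE_dx {f f' : ℝ × ℝ → ℝ} (h : ∀ x y, 0 ≤ y → HasDerivAt (fun x => f (x, y)) (f' (x, y)) x) (x y : ℝ) :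
    HasDerivAt (fun x => odE f (x, y)) (odE f' (x, y)) x := by
  by_cases hy : 0 ≤ y
  · simpa [odE, hy, fold, abs_of_nonneg hy] using h x y hy
  · simpa [odE, hy, fold] using (h x |y| (abs_nonneg _)).fun_neg

lemma odE_dy {f f' : ℝ × ℝ → ℝ} (h : ∀ x y, 0 < y → HasDerivAt (fun y => f (x, y)) (f' (x, y)) y) (x y : ℝ)
    (hy : y ≠ 0) : HasDerivAt (fun y => odE f (x, y)) (evE f' (x, y)) y := by
  rcases lt_or_gt_of_ne hy with hy | hy
  · have e : (fun y => odE f (x, y)) =ᶠ[nhds y] fun y => -f (x, -y) := by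
      filter_upwards [gt_mem_nhds hy] with t ht
      simp [odE, not_le.2 ht, fold, abs_of_neg ht]
    refine HasDerivAt.congr_of_eventuallyEq ?_ e
    have h1 := h x (-y) (by linarith)
    have h2 := (h1.comp y (hasDerivAt_neg y)).fun_neg
    simpa [evE, fold, abs_of_neg hy, Function.comp_def] using h2
  · have e : (fun y => odE f (x, y)) =ᶠ[nhds y] fun y => f (x, y) := by
      filter_upwards [lt_mem_nhds hy] with t ht
      simp [odE, ht.le, fold, abs_of_pos ht]
    refine HasDerivAt.congr_of_eventuallyEq ?_ e
    simpa [evE, fold, abs_of_pos hy] using h x y hy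

lemma evE_dx {f f' : ℝ × ℝ → ℝ} (h : ∀ x y, 0 ≤ y → HasDerivAt (fun x => f (x, y)) (f' (x, y)) x) (x y : ℝ) :
    HasDerivAt (fun x => evE f (x, y)) (evE f' (x, y)) x := by
  simpa [evE, fold] using (h x |y| (abs_nonneg _))

lemma evE_dy {f f' : ℝ × ℝ → ℝ} (h : ∀ x y, 0 < y → HasDerivAt (fun y => f (x, y)) (f' (x, y)) y) (x y : ℝ)
    (hy : y ≠ 0) : HasDerivAt (fun y => evE f (x, y)) (odE f' (x, y)) y := by
  rcases lt_or_gt_of_ne hy with hy | hy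
  · have e : (fun y => evE f (x, y)) =ᶠ[nhds y] fun y => f (x, -y) := by
      filter_upwards [gt_mem_nhds hy] with t ht
      simp [evE, fold, abs_of_neg ht]
    refine HasDerivAt.congr_of_eventuallyEq ?_ e
    have h1 := h x (-y) (by linarith)
    have h2 := (h1.comp y (hasDerivAt_neg y))
    simpa [odE, not_le.2 hy, fold, abs_of_neg hy, Function.comp_def] using h2
  · have e : (fun y => evE f (x, y)) =ᶠ[nhds y] fun y => f (x, y) := by
      filter_upwards [lt_mem_nhds hy] with t ht
      simp [evE, fold, abs_of_pos ht]
    refine HasDerivAt.congr_of_eventuallyEq ?_ e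
    simpa [odE, hy.le, fold, abs_of_pos hy] using h x y hy

lemma HD.gd {w1 w2 w11 w12 w22 : ℝ × ℝ → ℝ} (h : HD w1 w2 w11 w12 w22) :
    GD (odE w1) (evE w2) (odE w11) (evE w12) (odE w22) where
  c1 := odE_cont h.c1 h.z1
  c2 := evE_cont h.c2
  c11 := odE_cont h.c11 h.z11
  c12 := evE_cont h.c12
  m22 := odE_meas h.c22
  b22 := fun m => by
    obtain ⟨C, hC⟩ := bdd_box (evE_cont h.c22) m
    exact ⟨C, fun z h1 h2 => by rw [odE_abs]; exact hC z h1 h2⟩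
  d11 := odE_dx h.d11
  d12 := odE_dy h.d12
  d21 := evE_dx h.d21
  d22 := evE_dy h.d22

lemma HP0 (c δ : ℝ) (hc : 0 ≤ c) (hδ : 0 < δ) : ∃ R C : ℝ, 0 < R ∧ 0 ≤ C ∧
    ∀ w1 w2 w11 w12 w22 : ℝ × ℝ → ℝ, HD w1 w2 w11 w12 w22 → ∀ X1 X2 : ℝ × ℝ, 0 ≤ X1.2 → 0 ≤ X2.2 → dist X1 X2 ≤ c →
    ∀ N J : ℝ, 0 ≤ N → 0 ≤ J →
    (∀ p ∈ closedBall X1 R, ∀ q ∈ closedBall X1 R, 0 ≤ p.2 → 0 ≤ q.2 → |w11 p - w11 q| ≤ N * √(dist p q)) →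
    (∀ p ∈ closedBall X1 R, ∀ q ∈ closedBall X1 R, 0 ≤ p.2 → 0 ≤ q.2 → |w12 p - w12 q| ≤ N * √(dist p q)) →
    (∀ p ∈ closedBall X1 R, ∀ q ∈ closedBall X1 R, 0 ≤ p.2 → 0 ≤ q.2 →
      |(w11 p + w22 p) - (w11 q + w22 q)| ≤ J * √(dist p q)) →
    |w11 X1 - w11 X2| ≤ δ * N + C * J ∧ |w12 X1 - w12 X2| ≤ δ * N + C * J := by
  obtain ⟨R, C, hR, hC, H⟩ := core c (δ / 2) hc (by positivity)
  refine ⟨2 * R, C, by positivity, hC, ?_⟩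
  intro w1 w2 w11 w12 w22 hw X1 X2 y1 y2 hX N J hN hJ h11 h12 hH
  have fb : ∀ p ∈ closedBall X1 (2 * R), fold p ∈ closedBall X1 (2 * R) := by
    intro p hp
    rw [mem_closedBall] at *
    have := fold_dist p X1
    rw [fold_id y1] at this
    exact this.trans hp
  have k1 : ∀ f : ℝ × ℝ → ℝ, (∀ p ∈ closedBall X1 (2 * R), ∀ q ∈ closedBall X1 (2 * R), 0 ≤ p.2 → 0 ≤ q.2 → |f p - f q| ≤ N * √(dist p q)) →
      ∀ p ∈ closedBall X1 (2 * R), ∀ q ∈ closedBall X1 (2 * R), |f (fold p) - f (fold q)| ≤ N * √(dist p q) := by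
    intro f hf p hp q hq
    refine (hf _ (fb p hp) _ (fb q hq) (fold_mem p) (fold_mem q)).trans ?_
    have := fold_dist p q
    gcongr
  have cr : ∀ p ∈ closedBall X1 (2 * R), ∀ q ∈ closedBall X1 (2 * R), 0 ≤ p.2 → q.2 < 0 →
      |w11 (fold p) + w11 (fold q)| ≤ 2 * N * √(dist p q) := by
    intro p hp q hq hp2 hq2
    have e : ∀ r ∈ closedBall X1 (2 * R), |r.2| ≤ dist p q → |w11 (fold r)| ≤ N * √(dist p q) := by
      intro r hr hrd
      have hm : (r.1, (0 : ℝ)) ∈ closedBall X1 (2 * R) := by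
        rw [mem_closedBall, Prod.dist_eq, max_le_iff] at hr hq ⊢
        refine ⟨hr.1, ?_⟩
        have := hq.2
        rw [Real.dist_eq, abs_le] at *
        constructor <;> dsimp <;> linarith
      have := h11 _ (fb r hr) _ hm (fold_mem r) le_rfl
      rw [hw.z11, sub_zero] at this
      refine this.trans ?_
      have : dist (fold r) (r.1, (0 : ℝ)) ≤ dist p q := by
        rw [Prod.dist_eq]
        simp [fold, Real.dist_eq, hrd]
      gcongr
    have d2 : |p.2 - q.2| ≤ dist p q := le_max_right (dist p.1 q.1) (dist p.2 q.2)
    rw [abs_of_nonneg (by linarith)] at d2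
    have := e p hp (by rw [abs_of_nonneg hp2]; linarith)
    have := e q hq (by rw [abs_of_neg hq2]; linarith)
    refine (abs_add_le _ _).trans ?_
    linarith
  have := H _ _ _ _ _ hw.gd X1 X2 hX (2 * N) J (by positivity) hJ ?_ ?_ ?_
  · simpa [odE, evE, y1, y2, fold_id y1, fold_id y2, show δ / 2 * (2 * N) = δ * N by ring] using this
  · intro p hp q hq
    have i : N * √(dist p q) ≤ 2 * N * √(dist p q) := by gcongr; linarith
    by_cases hp2 : 0 ≤ p.2 <;> by_cases hq2 : 0 ≤ q.2 <;> simp only [odE, hp2, hq2, if_true, if_false]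
    · exact (k1 _ h11 p hp q hq).trans i
    · rw [sub_neg_eq_add]; exact cr p hp q hq hp2 (not_le.1 hq2)
    · have := cr q hq p hp hq2 (not_le.1 hp2)
      rw [dist_comm]
      rw [show -w11 (fold p) - w11 (fold q) = -(w11 (fold q) + w11 (fold p)) by ring, abs_neg]
      exact this
    · rw [show -w11 (fold p) - -w11 (fold q) = -(w11 (fold p) - w11 (fold q)) by ring, abs_neg]
      exact (k1 _ h11 p hp q hq).trans i
  · intro p hp q hq
    have i : N * √(dist p q) ≤ 2 * N * √(dist p q) := by gcongr; linarith
    exact (k1 _ h12 p hp q hq).trans i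
  · intro x x' y hx hx'
    have := hH _ (fb _ hx) _ (fb _ hx') (fold_mem _) (fold_mem _)
    have e : dist (fold (x, y)) (fold (x', y)) = |x - x'| := by simp [fold, Prod.dist_eq, Real.dist_eq]
    rw [e] at this
    by_cases hy : 0 ≤ y <;> simp only [odE, hy, if_true, if_false]
    · exact this
    · rw [show ∀ a b c d : ℝ, -a + -b - (-c + -d) = -(a + b - (c + d)) by intros; ring, abs_neg]
      exact this

end MC

/-! part 7 -/

namespace MC
open MeasureTheory

abbrev Lin : Type := ℂ →L[ℝ] ℝ
abbrev Bil : Type := ℂ →L[ℝ] ℂ →L[ℝ] ℝ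
instance nBil : NormedAddCommGroup Bil := inferInstance
instance nsBil : NormedSpace ℝ Bil := inferInstance
abbrev UH : Set ℂ := {z | 0 ≤ z.im}

/-- gradient data on the closed upper half plane, vanishing tangentially -/
structure HC (p : ℂ → Lin) (Q : ℂ → Bil) : Prop where
  d : ∀ z, 0 ≤ z.im → HasFDerivWithinAt p (Q z) UH z
  cQ : ContinuousOn Q UH
  sym : ∀ z, 0 ≤ z.im → ∀ a b, Q z a b = Q z b a
  z0 : ∀ x : ℝ, p x 1 = 0

lemma HC.line {p : ℂ → Lin} {Q : ℂ → Bil} (h : HC p Q) (τ b : ℂ) {c : ℝ → ℂ} {s : Set ℝ} {t : ℝ}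
    (hc : HasDerivAt c τ t) (hs : s ∈ nhds t) (hm : ∀ u ∈ s, 0 ≤ (c u).im) :
    HasDerivAt (fun u => p (c u) b) (Q (c t) τ b) t := by
  have h1 := (h.d (c t) (hm t (mem_of_mem_nhds hs))).comp_hasDerivWithinAt t hc.hasDerivWithinAt (s := s) hm
  have h2 := h1.hasDerivAt hs
  have h3 := h2.clm_apply (hasDerivAt_const t b)
  simpa using h3

def aff (x0 : ℝ) (τ1 τ2 : ℂ) (X : ℝ × ℝ) : ℂ := x0 + X.1 * τ1 + X.2 * τ2

lemma aff_im {x0 : ℝ} {τ1 τ2 : ℂ} (h1 : τ1.im = 0) (X : ℝ × ℝ) : (aff x0 τ1 τ2 X).im = X.2 * τ2.im := by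
  simp [aff, h1]

lemma aff_re (x0 : ℝ) (τ1 τ2 : ℂ) (X : ℝ × ℝ) : (aff x0 τ1 τ2 X).re = x0 + X.1 * τ1.re + X.2 * τ2.re := by
  simp [aff]

lemma HC.hd {p : ℂ → Lin} {Q : ℂ → Bil} (h : HC p Q) (x0 : ℝ) {τ1 τ2 : ℂ} (h1 : τ1.im = 0) (h2 : 0 < τ2.im) :
    HD (fun X => p (aff x0 τ1 τ2 X) τ1) (fun X => p (aff x0 τ1 τ2 X) τ2)
      (fun X => Q (aff x0 τ1 τ2 X) τ1 τ1) (fun X => Q (aff x0 τ1 τ2 X) τ1 τ2)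
      (fun X => Q (aff x0 τ1 τ2 X) τ2 τ2) := by
  have hc : Continuous (aff x0 τ1 τ2) := by unfold aff; fun_prop
  have hm : ∀ X : ℝ × ℝ, 0 ≤ X.2 → 0 ≤ (aff x0 τ1 τ2 X).im := fun X hX => by
    rw [aff_im h1]; positivity
  have hmt : MapsTo (aff x0 τ1 τ2) HPl UH := fun X hX => hm X hX
  have cp : ContinuousOn p UH := fun z hz => (h.d z hz).continuousWithinAt
  have cpb : ∀ b, ContinuousOn (fun X => p (aff x0 τ1 τ2 X) b) HPl := fun b =>
    (cp.comp hc.continuousOn hmt).clm_apply continuousOn_const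
  have cQb : ∀ a b, ContinuousOn (fun X => Q (aff x0 τ1 τ2 X) a b) HPl := fun a b =>
    ((h.cQ.comp hc.continuousOn hmt).clm_apply continuousOn_const).clm_apply continuousOn_const
  have dx : ∀ x y, HasDerivAt (fun x : ℝ => aff x0 τ1 τ2 (x, y)) τ1 x := by
    intro x y
    unfold aff
    have := (((Complex.ofRealCLM.hasDerivAt (x := x)).mul_const τ1).const_add (x0 : ℂ)).add_const ((y : ℂ) * τ2)
    simpa using this
  have dy : ∀ x y, HasDerivAt (fun y : ℝ => aff x0 τ1 τ2 (x, y)) τ2 y := by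
    intro x y
    unfold aff
    have := ((Complex.ofRealCLM.hasDerivAt (x := y)).mul_const τ2).const_add ((x0 : ℂ) + x * τ1)
    simpa using this
  refine ⟨cpb _, cpb _, cQb _ _, cQb _ _, cQb _ _, ?_, ?_, ?_, ?_, ?_⟩
  · intro x y hy
    exact h.line τ1 τ1 (dx x y) Filter.univ_mem (fun u _ => hm (u, y) hy)
  · intro x y hy
    rw [h.sym _ (hm (x, y) hy.le)]
    exact h.line τ2 τ1 (dy x y) (Ici_mem_nhds hy) (fun u hu => hm (x, u) hu)
  · intro x y hy
    exact h.line τ1 τ2 (dx x y) Filter.univ_mem (fun u _ => hm (u, y) hy)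
  · intro x y hy
    exact h.line τ2 τ2 (dy x y) (Ici_mem_nhds hy) (fun u hu => hm (x, u) hu)
  · intro x
    have e1 : τ1 = τ1.re • (1 : ℂ) := by apply Complex.ext <;> simp [h1]
    have e2 : aff x0 τ1 τ2 (x, 0) = ((x0 + x * τ1.re : ℝ) : ℂ) := by
      apply Complex.ext <;> simp [aff, h1]
    show p (aff x0 τ1 τ2 (x, 0)) τ1 = 0
    rw [e2, e1, map_smul, h.z0, smul_zero]

/-- a symmetric form is controlled by its values on a basis -/
lemma bil_bound {κ K : ℝ} (hκ : 0 < κ) (hK : κ ≤ K) {σ1 σ2 : ℂ} (h1 : σ1.im = 0) (h1' : κ ≤ σ1.re) (h2 : κ ≤ σ2.im)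
    (h2K : ‖σ2‖ ≤ K) {B : Bil} (hB : ∀ a b, B a b = B b a) {M : ℝ}
    (b11 : |B σ1 σ1| ≤ M) (b12 : |B σ1 σ2| ≤ M) (b22 : |B σ2 σ2| ≤ M) :
    ‖B‖ ≤ 4 * ((1 + K / κ) / κ) ^ 2 * M := by
  have hM : 0 ≤ M := (abs_nonneg _).trans b11
  have hK0 : 0 < K := hκ.trans_le hK
  set c := (1 + K / κ) / κ with hc
  have hc0 : 0 < c := by positivity
  have ha : 0 < σ1.re := by linarith
  have hs : 0 < σ2.im := by linarith
  have dec : ∀ x : ℂ, ∃ α β : ℝ, x = α • σ1 + β • σ2 ∧ |α| ≤ c * ‖x‖ ∧ |β| ≤ c * ‖x‖ := by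
    intro x
    have hb : |x.im / σ2.im| ≤ ‖x‖ / κ := by
      rw [abs_div, abs_of_pos hs]
      exact div_le_div₀ (norm_nonneg _) (Complex.abs_im_le_norm x) hκ h2
    refine ⟨(x.re - x.im / σ2.im * σ2.re) / σ1.re, x.im / σ2.im, ?_, ?_, ?_⟩
    · apply Complex.ext
      · simp; field_simp; ring
      · simp [h1]; field_simp
    · rw [abs_div, abs_of_pos ha]
      have : |x.re - x.im / σ2.im * σ2.re| ≤ ‖x‖ + ‖x‖ / κ * K := by
        refine (abs_sub _ _).trans (add_le_add (Complex.abs_re_le_norm x) ?_)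
        rw [abs_mul]
        exact mul_le_mul hb ((Complex.abs_re_le_norm _).trans h2K) (abs_nonneg _) (by positivity)
      calc _ ≤ (‖x‖ + ‖x‖ / κ * K) / κ := div_le_div₀ (by positivity) this hκ h1'
        _ = c * ‖x‖ := by rw [hc]; field_simp
    · refine hb.trans ?_
      rw [hc]
      have : ‖x‖ / κ = (1 / κ) * ‖x‖ := by ring
      rw [this]
      gcongr
      have : 0 ≤ K / κ := by positivity
      linarith
  refine ContinuousLinearMap.opNorm_le_bound₂ _ (by positivity) ?_
  intro x y
  obtain ⟨α, β, rfl, hα, hβ⟩ := dec x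
  obtain ⟨α', β', rfl, hα', hβ'⟩ := dec y
  set x := α • σ1 + β • σ2
  set y := α' • σ1 + β' • σ2
  have e : B x y = α * α' * B σ1 σ1 + α * β' * B σ1 σ2 + β * α' * B σ1 σ2 + β * β' * B σ2 σ2 := by
    simp only [x, y, map_add, map_smul, add_apply, smul_apply, smul_eq_mul, hB σ2 σ1]
    ring
  rw [e, Real.norm_eq_abs]
  have t : ∀ u v w : ℝ, |u| ≤ c * ‖x‖ → |v| ≤ c * ‖y‖ → |w| ≤ M → |u * v * w| ≤ c ^ 2 * M * ‖x‖ * ‖y‖ := by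
    intro u v w hu hv hw
    rw [abs_mul, abs_mul]
    calc |u| * |v| * |w| ≤ (c * ‖x‖) * (c * ‖y‖) * M := by gcongr
      _ = _ := by ring
  refine (abs_add_le _ _).trans ?_
  refine (add_le_add_left ((abs_add_le _ _).trans (add_le_add_left (abs_add_le _ _) _)) _).trans ?_
  linarith [t α α' _ hα hα' b11, t α β' _ hα hβ' b12, t β α' _ hβ hα' b12, t β β' _ hβ hβ' b22]

lemma HP (κ K δ : ℝ) (hκ : 0 < κ) (hK : κ ≤ K) (hδ : 0 < δ) : ∃ m C : ℝ, 0 < m ∧ 0 ≤ C ∧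
    ∀ p Q, HC p Q → ∀ ζ1 ζ2 : ℂ, 0 ≤ ζ1.im → 0 ≤ ζ2.im →
    ∀ σ1 σ2 : ℂ, σ1.im = 0 → κ ≤ σ1.re → κ ≤ σ2.im → ‖σ1‖ ≤ K → ‖σ2‖ ≤ K →
    ∀ N J : ℝ, 0 ≤ N → 0 ≤ J →
    (∀ z ∈ closedBall ζ1 (m * ‖ζ1 - ζ2‖), ∀ w ∈ closedBall ζ1 (m * ‖ζ1 - ζ2‖), 0 ≤ z.im → 0 ≤ w.im →
      ‖Q z - Q w‖ ≤ N * √‖z - w‖) →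
    (∀ z ∈ closedBall ζ1 (m * ‖ζ1 - ζ2‖), ∀ w ∈ closedBall ζ1 (m * ‖ζ1 - ζ2‖), 0 ≤ z.im → 0 ≤ w.im →
      |(Q z σ1 σ1 + Q z σ2 σ2) - (Q w σ1 σ1 + Q w σ2 σ2)| ≤ J * √‖z - w‖) →
    ‖Q ζ1 - Q ζ2‖ ≤ (δ * N + C * J) * √‖ζ1 - ζ2‖ := by
  have hK0 : 0 < K := hκ.trans_le hK
  set c := (1 + K / κ) / κ with hc
  have hc0 : 0 < c := by positivity
  set δ' := δ / (4 * c ^ 2 * K ^ 2 * √(2 * K)) with hδ'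
  have hδ'0 : 0 < δ' := by positivity
  obtain ⟨R, C, hR, hC, H⟩ := HP0 c δ' hc0.le hδ'0
  refine ⟨max (2 * K * R) 1, 4 * c ^ 2 * (1 + C * √(2 * K)), by positivity, by positivity, ?_⟩
  intro p Q h ζ1 ζ2 i1 i2 σ1 σ2 s1 s1' s2' n1 n2 N J hN hJ hQ hh
  rcases eq_or_ne ζ1 ζ2 with rfl | hne
  · rw [sub_self (Q ζ1)]
    refine (le_of_eq (norm_zero (E := Bil))).trans ?_
    positivity
  set r := ‖ζ1 - ζ2‖ with hr
  have hr0 : 0 < r := norm_pos_iff.2 (sub_ne_zero.2 hne)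
  have ha : 0 < σ1.re := by linarith
  have hs : 0 < σ2.im := by linarith
  set τ1 : ℂ := r • σ1 with hτ1
  set τ2 : ℂ := r • σ2 with hτ2
  have t1 : τ1.im = 0 := by simp [hτ1, s1]
  have t2 : 0 < τ2.im := by simp [hτ2]; positivity
  have hd := h.hd 0 t1 t2
  -- coordinates
  have co : ∀ ζ : ℂ, 0 ≤ ζ.im → ∃ X : ℝ × ℝ, 0 ≤ X.2 ∧ aff 0 τ1 τ2 X = ζ := by
    intro ζ hζ
    refine ⟨((ζ.re - ζ.im / σ2.im * σ2.re) / (r * σ1.re), ζ.im / (r * σ2.im)), by positivity, ?_⟩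
    apply Complex.ext
    · rw [aff_re]; simp [hτ1, hτ2]; field_simp; ring
    · rw [aff_im t1]; simp [hτ2]; field_simp
  obtain ⟨X1, y1, e1⟩ := co ζ1 i1
  obtain ⟨X2, y2, e2⟩ := co ζ2 i2
  have dif : ∀ X Y : ℝ × ℝ, aff 0 τ1 τ2 X - aff 0 τ1 τ2 Y = (r * (X.1 - Y.1)) • σ1 + (r * (X.2 - Y.2)) • σ2 := by
    intro X Y; simp [aff, hτ1, hτ2]; ring
  have lip : ∀ X Y : ℝ × ℝ, ‖aff 0 τ1 τ2 X - aff 0 τ1 τ2 Y‖ ≤ 2 * K * r * dist X Y := by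
    intro X Y
    rw [dif]
    have d1 : |X.1 - Y.1| ≤ dist X Y := le_max_left (dist X.1 Y.1) (dist X.2 Y.2)
    have d2 : |X.2 - Y.2| ≤ dist X Y := le_max_right (dist X.1 Y.1) (dist X.2 Y.2)
    refine (norm_add_le _ _).trans ?_
    rw [norm_smul, norm_smul, norm_mul, norm_mul, Real.norm_eq_abs, Real.norm_eq_abs, Real.norm_eq_abs, abs_of_pos hr0]
    calc _ ≤ r * dist X Y * K + r * dist X Y * K := by gcongr
      _ = _ := by ring
  have hX : dist X1 X2 ≤ c := by
    have e := dif X1 X2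
    rw [e1, e2] at e
    have eim := congrArg Complex.im e
    have ere := congrArg Complex.re e
    simp [s1] at eim ere
    have b2 : |X1.2 - X2.2| ≤ 1 / κ := by
      have h3 : r * |X1.2 - X2.2| * σ2.im ≤ r := by
        have : |(ζ1 - ζ2).im| ≤ r := Complex.abs_im_le_norm _
        rw [Complex.sub_im, eim, abs_mul, abs_mul, abs_of_pos hr0, abs_of_pos hs] at this
        exact this
      rw [le_div_iff₀ hκ]
      have h4 : |X1.2 - X2.2| * σ2.im ≤ 1 := by
        by_contra! hcon
        nlinarith
      exact (mul_le_mul_of_nonneg_left s2' (abs_nonneg _)).trans h4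
    have b1 : |X1.1 - X2.1| ≤ c := by
      have h3 : |r * (X1.1 - X2.1) * σ1.re| ≤ r + r * (1 / κ) * K := by
        have : r * (X1.1 - X2.1) * σ1.re = (ζ1 - ζ2).re - r * (X1.2 - X2.2) * σ2.re := by
          rw [Complex.sub_re]; linarith
        rw [this]
        refine (abs_sub _ _).trans (add_le_add (Complex.abs_re_le_norm _) ?_)
        rw [abs_mul, abs_mul, abs_of_pos hr0]
        have := (Complex.abs_re_le_norm σ2).trans n2
        gcongr
      rw [abs_mul, abs_mul, abs_of_pos hr0, abs_of_pos ha] at h3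
      have h5 : |X1.1 - X2.1| * σ1.re ≤ 1 + K / κ := by
        have : r * (|X1.1 - X2.1| * σ1.re) ≤ r * (1 + K / κ) := by
          calc _ = r * |X1.1 - X2.1| * σ1.re := by ring
            _ ≤ _ := h3
            _ = _ := by ring
        exact le_of_mul_le_mul_left this hr0
      rw [hc, le_div_iff₀ hκ]
      exact (mul_le_mul_of_nonneg_left s1' (abs_nonneg _)).trans h5
    rw [Prod.dist_eq]
    refine max_le b1 (b2.trans ?_)
    rw [hc]
    gcongr
    have : 0 ≤ K / κ := by positivity
    linarith
  have inb : ∀ X ∈ closedBall X1 R, aff 0 τ1 τ2 X ∈ closedBall ζ1 (max (2 * K * R) 1 * r) := by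
    intro X hX
    rw [mem_closedBall] at hX
    rw [mem_closedBall, dist_eq_norm, ← e1]
    refine (lip X X1).trans ?_
    calc 2 * K * r * dist X X1 ≤ 2 * K * r * R := by gcongr
      _ = (2 * K * R) * r := by ring
      _ ≤ _ := by gcongr; exact le_max_left _ _
  have im0 : ∀ X : ℝ × ℝ, 0 ≤ X.2 → 0 ≤ (aff 0 τ1 τ2 X).im := fun X hX => by
    rw [aff_im t1]; positivity
  have sq : ∀ X Y : ℝ × ℝ, √‖aff 0 τ1 τ2 X - aff 0 τ1 τ2 Y‖ ≤ √(2 * K) * √r * √(dist X Y) := by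
    intro X Y
    rw [← Real.sqrt_mul (by positivity), ← Real.sqrt_mul (by positivity)]
    exact Real.sqrt_le_sqrt (lip X Y)
  have bQ : ∀ a b : ℂ, ‖a‖ ≤ r * K → ‖b‖ ≤ r * K → ∀ X ∈ closedBall X1 R, ∀ Y ∈ closedBall X1 R, 0 ≤ X.2 → 0 ≤ Y.2 →
      |Q (aff 0 τ1 τ2 X) a b - Q (aff 0 τ1 τ2 Y) a b| ≤ (r ^ 2 * K ^ 2 * √(2 * K) * √r * N) * √(dist X Y) := by
    intro a b ha hb X hX Y hY hX2 hY2
    rw [show Q (aff 0 τ1 τ2 X) a b - Q (aff 0 τ1 τ2 Y) a b = (Q (aff 0 τ1 τ2 X) - Q (aff 0 τ1 τ2 Y)) a b from rfl,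
      ← Real.norm_eq_abs]
    refine (ContinuousLinearMap.le_opNorm₂ _ _ _).trans ?_
    have := hQ _ (inb X hX) _ (inb Y hY) (im0 X hX2) (im0 Y hY2)
    have := this.trans (mul_le_mul_of_nonneg_left (sq X Y) hN)
    calc _ ≤ (N * (√(2 * K) * √r * √(dist X Y))) * (r * K) * (r * K) := by gcongr
      _ = _ := by ring
  have nt1 : ‖τ1‖ ≤ r * K := by rw [hτ1, norm_smul, Real.norm_eq_abs, abs_of_pos hr0]; gcongr
  have nt2 : ‖τ2‖ ≤ r * K := by rw [hτ2, norm_smul, Real.norm_eq_abs, abs_of_pos hr0]; gcongr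
  have res := H _ _ _ _ _ hd X1 X2 y1 y2 hX (r ^ 2 * K ^ 2 * √(2 * K) * √r * N) (r ^ 2 * √(2 * K) * √r * J) (by positivity)
    (by positivity) (bQ _ _ nt1 nt1) (bQ _ _ nt1 nt2) (by
      intro X hX Y hY hX2 hY2
      have := hh _ (inb X hX) _ (inb Y hY) (im0 X hX2) (im0 Y hY2)
      have := this.trans (mul_le_mul_of_nonneg_left (sq X Y) hJ)
      have e : ∀ z w : ℂ, (Q z τ1 τ1 + Q z τ2 τ2) - (Q w τ1 τ1 + Q w τ2 τ2) =
          r ^ 2 * ((Q z σ1 σ1 + Q z σ2 σ2) - (Q w σ1 σ1 + Q w σ2 σ2)) := by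
        intro z w; simp only [hτ1, hτ2, map_smul, smul_apply, smul_eq_mul]; ring
      rw [e, abs_mul, abs_of_pos (by positivity : 0 < r ^ 2)]
      calc _ ≤ r ^ 2 * (J * (√(2 * K) * √r * √(dist X Y))) := by gcongr
        _ = _ := by ring)
  simp only [e1, e2] at res
  set M := (δ' * (K ^ 2 * √(2 * K)) * N + (1 + C * √(2 * K)) * J) * √r with hM
  have sc : ∀ a b : ℂ, |Q ζ1 (r • a) (r • b) - Q ζ2 (r • a) (r • b)| ≤ δ' * (r ^ 2 * K ^ 2 * √(2 * K) * √r * N) + C * (r ^ 2 * √(2 * K) * √r * J) →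
      |(Q ζ1 - Q ζ2) a b| ≤ (δ' * (K ^ 2 * √(2 * K)) * N + C * √(2 * K) * J) * √r := by
    intro a b hab
    have e : Q ζ1 (r • a) (r • b) - Q ζ2 (r • a) (r • b) = r ^ 2 * (Q ζ1 - Q ζ2) a b := by
      simp only [map_smul, smul_apply, smul_eq_mul, sub_apply]; ring
    rw [e, abs_mul, abs_of_pos (by positivity : 0 < r ^ 2)] at hab
    refine le_of_mul_le_mul_left (hab.trans (le_of_eq ?_)) (by positivity : 0 < r ^ 2)
    ring
  have r11 := sc _ _ res.1
  have r12 := sc _ _ res.2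
  have hJr : 0 ≤ J * √r := by positivity
  have r22 : |(Q ζ1 - Q ζ2) σ2 σ2| ≤ M := by
    have hz : ζ1 ∈ closedBall ζ1 (max (2 * K * R) 1 * r) := mem_closedBall_self (by positivity)
    have hz2 : ζ2 ∈ closedBall ζ1 (max (2 * K * R) 1 * r) := by
      rw [mem_closedBall, dist_eq_norm, norm_sub_rev, ← hr]
      nlinarith [le_max_right (2 * K * R) 1]
    have h3 := hh ζ1 hz ζ2 hz2 i1 i2
    have e : (Q ζ1 - Q ζ2) σ2 σ2 = ((Q ζ1 σ1 σ1 + Q ζ1 σ2 σ2) - (Q ζ2 σ1 σ1 + Q ζ2 σ2 σ2)) - (Q ζ1 - Q ζ2) σ1 σ1 := by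
      simp only [sub_apply]; ring
    rw [e]
    refine (abs_sub _ _).trans ((add_le_add h3 r11).trans (le_of_eq ?_))
    rw [hM, ← hr]; ring
  have := bil_bound hκ hK s1 s1' s2' n2 (B := Q ζ1 - Q ζ2) (fun a b => by
    simp only [sub_apply, h.sym ζ1 i1 a b, h.sym ζ2 i2 a b]) (M := M)
    (r11.trans (by rw [hM]; linarith)) (r12.trans (by rw [hM]; linarith)) r22
  refine this.trans (le_of_eq ?_)
  rw [hM, hδ']
  rw [← hc]
  field_simp

end MC

/-! part 8 -/

namespace MC
open MeasureTheory

abbrev DualN (V : Type) [NormedAddCommGroup V] [NormedSpace ℝ V] : Type := V →L[ℝ] ℝ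
abbrev Cof : Type := DualN Bil
lemma cof_sub (ℓ : Cof) (x y : Bil) : ℓ (x - y) = ℓ x - ℓ y := by
  rw [eq_sub_iff_add_eq, ← map_add]
  congr 1
  exact sub_add_cancel x y
def ten (η θ : ℂ) : Bil := (innerSL ℝ η).smulRight (innerSL ℝ θ)

lemma ten_apply (η θ a b : ℂ) : ten η θ a b = (η.re * a.re + η.im * a.im) * (θ.re * b.re + θ.im * b.im) := by
  simp [ten, Complex.inner]; ring

def Ell (lam Lam : ℝ) (ℓ : Cof) : Prop := ∀ η : ℂ, lam * ‖η‖ ^ 2 ≤ ℓ (ten η η) ∧ ℓ (ten η η) ≤ Lam * ‖η‖ ^ 2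

lemma bil_ext {B C : Bil} (h : ∀ a b, B a b = C a b) : B = C := by
  ext a b <;> exact h _ _

lemma ell_decomp {lam Lam : ℝ} (hl : 0 < lam) {ℓ : Cof} (h : Ell lam Lam ℓ) {ω : ℂ} (hω : ‖ω‖ = 1) :
    ∃ p q s : ℝ, √lam ≤ p ∧ √lam ≤ s ∧ p ≤ √Lam ∧ |q| ≤ √Lam ∧ s ≤ √Lam ∧
      ∀ B : Bil, (∀ a b, B a b = B b a) → ℓ B = B (p * ω) (p * ω) + B ((q + s * Complex.I) * ω) ((q + s * Complex.I) * ω) := by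
  have hω2 : ω.re ^ 2 + ω.im ^ 2 = 1 := by
    have := Complex.sq_norm ω
    rw [hω, Complex.normSq_apply] at this
    nlinarith
  set f2 := Complex.I * ω with hf2
  have f2re : f2.re = -ω.im := by simp [hf2]
  have f2im : f2.im = ω.re := by simp [hf2]
  set a11 := ℓ (ten ω ω) with h11
  set a12 := (ℓ (ten ω f2) + ℓ (ten f2 ω)) / 2 with h12
  set a22 := ℓ (ten f2 f2) with h22
  have form : ∀ x y : ℝ, lam * (x ^ 2 + y ^ 2) ≤ a11 * x ^ 2 + 2 * a12 * x * y + a22 * y ^ 2 ∧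
      a11 * x ^ 2 + 2 * a12 * x * y + a22 * y ^ 2 ≤ Lam * (x ^ 2 + y ^ 2) := by
    intro x y
    have e : ten (x * ω + y * f2) (x * ω + y * f2) =
        (x ^ 2) • ten ω ω + (x * y) • ten ω f2 + (x * y) • ten f2 ω + (y ^ 2) • ten f2 f2 := by
      apply bil_ext; intro a b
      simp only [add_apply, smul_apply, ten_apply, smul_eq_mul]
      simp
      ring
    have n : ‖(x * ω + y * f2 : ℂ)‖ ^ 2 = x ^ 2 + y ^ 2 := by
      rw [Complex.sq_norm, Complex.normSq_apply]
      simp [f2re, f2im]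
      linear_combination (x ^ 2 + y ^ 2) * hω2
    have := h (x * ω + y * f2)
    rw [n, e] at this
    simp only [map_add, map_smul, smul_eq_mul] at this
    rw [← h11, ← h22] at this
    constructor
    · calc _ ≤ _ := this.1
        _ = _ := by rw [h12]; ring
    · calc _ = _ := by rw [h12]; ring
        _ ≤ _ := this.2
  have g1 := form 1 0
  have g2 := form 0 1
  norm_num at g1 g2
  have a22p : 0 < a22 := by linarith
  have g3 := form 1 (-a12 / a22)
  set s := √a22 with hs
  have hs2 : s ^ 2 = a22 := Real.sq_sqrt a22p.le
  have hs0 : 0 < s := Real.sqrt_pos.2 a22p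
  set q := a12 / s with hq
  have hqs : q * s = a12 := by rw [hq]; field_simp
  have e3 : a11 * 1 ^ 2 + 2 * a12 * 1 * (-a12 / a22) + a22 * (-a12 / a22) ^ 2 = a11 - q ^ 2 := by
    rw [hq, div_pow a12 s, hs2]; field_simp; ring
  rw [e3] at g3
  have g4 : lam ≤ a11 - q ^ 2 := by
    have : lam ≤ lam * (1 ^ 2 + (-a12 / a22) ^ 2) := by nlinarith [sq_nonneg (-a12 / a22)]
    linarith [g3.1]
  set p := √(a11 - q ^ 2) with hp
  have hp2 : p ^ 2 = a11 - q ^ 2 := Real.sq_sqrt (by linarith)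
  refine ⟨p, q, s, Real.sqrt_le_sqrt g4, Real.sqrt_le_sqrt g2.1, Real.sqrt_le_sqrt (by nlinarith [sq_nonneg q]),
    Real.abs_le_sqrt (by nlinarith [sq_nonneg q]), Real.sqrt_le_sqrt g2.2, ?_⟩
  intro B hB
  have eB : B = (B ω ω) • ten ω ω + (B ω f2) • ten ω f2 + (B ω f2) • ten f2 ω + (B f2 f2) • ten f2 f2 := by
    apply bil_ext; intro a b
    have dec : ∀ a : ℂ, a = (ω.re * a.re + ω.im * a.im) • ω + (-ω.im * a.re + ω.re * a.im) • f2 := by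
      intro a
      apply Complex.ext
      · simp [f2re]; linear_combination (-a.re) * hω2
      · simp [f2im]; linear_combination (-a.im) * hω2
    have : B a b = B ((ω.re * a.re + ω.im * a.im) • ω + (-ω.im * a.re + ω.re * a.im) • f2)
       ((ω.re * b.re + ω.im * b.im) • ω + (-ω.im * b.re + ω.re * b.im) • f2) := by rw [← dec, ← dec]
    rw [this]
    simp only [map_add, map_smul, add_apply, smul_apply, ten_apply, smul_eq_mul, f2re, f2im, hB f2 ω]
    ring
  have e1 : ((p : ℂ) * ω) = p • ω := by simp
  have e2 : ((q : ℂ) + s * Complex.I) * ω = q • ω + s • f2 := by simp [hf2]; ring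
  rw [e1, e2]
  have lhs : ℓ B = B ω ω * a11 + 2 * B ω f2 * a12 + B f2 f2 * a22 := by
    conv_lhs => rw [eB]
    simp only [map_add, map_smul, smul_eq_mul]
    rw [← h11, ← h22, h12]; ring
  rw [lhs]
  simp only [map_add, map_smul, add_apply, smul_apply, smul_eq_mul, hB f2 ω]
  linear_combination (-B ω ω) * hp2 - 2 * B ω f2 * hqs - B f2 f2 * hs2

/-! charts -/

def ct (ζ : ℂ) : ℂ := (1 - Complex.I * ζ)⁻¹
def psi (σ ζ : ℂ) : ℂ := σ * (2 * ct ζ - 1)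
def psi1 (σ ζ : ℂ) : ℂ := σ * (2 * Complex.I * ct ζ ^ 2)
def psi2 (σ ζ : ℂ) : ℂ := σ * (-4 * ct ζ ^ 3)

lemma u_norm {ζ : ℂ} (h : 0 ≤ ζ.im) : 1 ≤ ‖1 - Complex.I * ζ‖ := by
  have := Complex.abs_re_le_norm (1 - Complex.I * ζ)
  simp at this
  rw [abs_of_nonneg (by linarith)] at this
  linarith

lemma u_ne {ζ : ℂ} (h : 0 ≤ ζ.im) : 1 - Complex.I * ζ ≠ 0 := by
  intro e; have := u_norm h; rw [e] at this; norm_num at this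

lemma ct_norm {ζ : ℂ} (h : 0 ≤ ζ.im) : ‖ct ζ‖ ≤ 1 := by
  rw [ct, norm_inv]; exact inv_le_one_of_one_le₀ (u_norm h)

lemma ct_lip {ζ ξ : ℂ} (h : 0 ≤ ζ.im) (h' : 0 ≤ ξ.im) : ‖ct ζ - ct ξ‖ ≤ ‖ζ - ξ‖ := by
  have e : ct ζ - ct ξ = ct ζ * ct ξ * (Complex.I * (ζ - ξ)) := by
    unfold ct
    have := u_ne h
    have := u_ne h'
    field_simp
    ring
  rw [e, norm_mul, norm_mul, norm_mul, Complex.norm_I, one_mul]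
  have := ct_norm h
  have := ct_norm h'
  calc _ ≤ 1 * 1 * ‖ζ - ξ‖ := by gcongr
    _ = _ := by ring

lemma ct_lip2 {ζ ξ : ℂ} (h : 0 ≤ ζ.im) (h' : 0 ≤ ξ.im) : ‖ct ζ ^ 2 - ct ξ ^ 2‖ ≤ 2 * ‖ζ - ξ‖ := by
  rw [show ct ζ ^ 2 - ct ξ ^ 2 = (ct ζ + ct ξ) * (ct ζ - ct ξ) by ring, norm_mul]
  have := (norm_add_le (ct ζ) (ct ξ)).trans (add_le_add (ct_norm h) (ct_norm h'))
  have := ct_lip h h'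
  calc _ ≤ (1 + 1) * ‖ζ - ξ‖ := by gcongr
    _ = _ := by ring

lemma ct_lip3 {ζ ξ : ℂ} (h : 0 ≤ ζ.im) (h' : 0 ≤ ξ.im) : ‖ct ζ ^ 3 - ct ξ ^ 3‖ ≤ 3 * ‖ζ - ξ‖ := by
  rw [show ct ζ ^ 3 - ct ξ ^ 3 = (ct ζ ^ 2 - ct ξ ^ 2) * ct ζ + ct ξ ^ 2 * (ct ζ - ct ξ) by ring]
  refine (norm_add_le _ _).trans ?_
  rw [norm_mul, norm_mul, norm_pow]
  have := ct_lip h h'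
  have := ct_lip2 h h'
  have := ct_norm h
  have := ct_norm h'
  calc _ ≤ (2 * ‖ζ - ξ‖) * 1 + 1 ^ 2 * ‖ζ - ξ‖ := by gcongr
    _ = _ := by ring

lemma ct_deriv {ζ : ℂ} (h : 0 ≤ ζ.im) : HasDerivAt ct (Complex.I * ct ζ ^ 2) ζ := by
  have := (((hasDerivAt_id ζ).const_mul Complex.I).const_sub 1).inv (u_ne h)
  refine this.congr_deriv ?_
  simp [ct]; ring

lemma psi_deriv (σ : ℂ) {ζ : ℂ} (h : 0 ≤ ζ.im) : HasDerivAt (psi σ) (psi1 σ ζ) ζ := by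
  have := (((ct_deriv h).const_mul 2).sub_const 1).const_mul σ
  refine this.congr_deriv ?_
  simp only [psi1]; ring

lemma psi1_deriv (σ : ℂ) {ζ : ℂ} (h : 0 ≤ ζ.im) : HasDerivAt (psi1 σ) (psi2 σ ζ) ζ := by
  have := (((ct_deriv h).pow 2).const_mul (2 * Complex.I)).const_mul σ
  refine this.congr_deriv ?_
  simp only [psi2]
  push_cast
  linear_combination (4 * σ * ct ζ ^ 3) * Complex.I_sq

section
variable {σ : ℂ} (hσ : ‖σ‖ = 1) {ζ ξ : ℂ} (h : 0 ≤ ζ.im) (h' : 0 ≤ ξ.im)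

lemma psi_norm (hσ : ‖σ‖ = 1) (h : 0 ≤ ζ.im) : ‖psi σ ζ‖ ≤ 1 := by
  have e : 2 * ct ζ - 1 = (1 + Complex.I * ζ) * ct ζ := by
    unfold ct
    have := u_ne h
    field_simp; ring
  rw [psi, e, norm_mul, norm_mul, hσ, one_mul, ct, norm_inv, ← div_eq_mul_inv,
    div_le_one (by linarith [u_norm h])]
  apply le_of_sq_le_sq _ (norm_nonneg _)
  rw [Complex.sq_norm, Complex.sq_norm, Complex.normSq_apply, Complex.normSq_apply]
  simp
  nlinarith

lemma psi1_norm (hσ : ‖σ‖ = 1) (h : 0 ≤ ζ.im) : ‖psi1 σ ζ‖ ≤ 2 := by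
  have := ct_norm h
  simp only [psi1, norm_mul, hσ, norm_pow, Complex.norm_I]
  norm_num
  nlinarith [norm_nonneg (ct ζ)]

lemma psi2_norm (hσ : ‖σ‖ = 1) (h : 0 ≤ ζ.im) : ‖psi2 σ ζ‖ ≤ 4 := by
  have := ct_norm h
  simp only [psi2, norm_mul, hσ, norm_pow, norm_neg]
  have := pow_le_one₀ (n := 3) (norm_nonneg (ct ζ)) this
  norm_num
  linarith

lemma psi_lip (hσ : ‖σ‖ = 1) (h : 0 ≤ ζ.im) (h' : 0 ≤ ξ.im) : ‖psi σ ζ - psi σ ξ‖ ≤ 2 * ‖ζ - ξ‖ := by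
  rw [show psi σ ζ - psi σ ξ = σ * (2 * (ct ζ - ct ξ)) by simp only [psi]; ring, norm_mul, norm_mul, hσ]
  have := ct_lip h h'
  norm_num
  linarith

lemma psi1_lip (hσ : ‖σ‖ = 1) (h : 0 ≤ ζ.im) (h' : 0 ≤ ξ.im) : ‖psi1 σ ζ - psi1 σ ξ‖ ≤ 4 * ‖ζ - ξ‖ := by
  rw [show psi1 σ ζ - psi1 σ ξ = σ * (2 * Complex.I * (ct ζ ^ 2 - ct ξ ^ 2)) by simp only [psi1]; ring]
  simp only [norm_mul, hσ, Complex.norm_I]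
  have := ct_lip2 h h'
  norm_num
  linarith

lemma psi2_lip (hσ : ‖σ‖ = 1) (h : 0 ≤ ζ.im) (h' : 0 ≤ ξ.im) : ‖psi2 σ ζ - psi2 σ ξ‖ ≤ 12 * ‖ζ - ξ‖ := by
  rw [show psi2 σ ζ - psi2 σ ξ = σ * (-4 * (ct ζ ^ 3 - ct ξ ^ 3)) by simp only [psi2]; ring]
  simp only [norm_mul, hσ, norm_neg]
  have := ct_lip3 h h'
  norm_num
  linarith

lemma psi1_lower (hσ : ‖σ‖ = 1) (h : 0 ≤ ζ.im) (hz : ‖ζ‖ ≤ 2) : 2 / 9 ≤ ‖psi1 σ ζ‖ := by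
  have h3 : ‖1 - Complex.I * ζ‖ ≤ 3 := by
    refine (norm_sub_le _ _).trans ?_
    rw [norm_mul, Complex.norm_I, norm_one]; linarith
  have h1 := u_norm h
  have : (1 / 3 : ℝ) ≤ ‖ct ζ‖ := by
    rw [ct, norm_inv, ← one_div]
    exact one_div_le_one_div_of_le (by linarith) h3
  simp only [psi1, norm_mul, hσ, norm_pow, Complex.norm_I]
  norm_num
  nlinarith
end

/-- gradient data on the disc -/
structure DP (p : ℂ → Lin) (Q : ℂ → Bil) : Prop where
  d : ∀ z ∈ closedBall (0 : ℂ) 1, HasFDerivWithinAt p (Q z) (closedBall 0 1) z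
  cQ : ContinuousOn Q (closedBall 0 1)
  sym : ∀ z ∈ closedBall (0 : ℂ) 1, ∀ a b, Q z a b = Q z b a
  z0 : ∀ z : ℂ, ‖z‖ = 1 → p z (Complex.I * z) = 0

abbrev mulL (c : ℂ) : ℂ →L[ℝ] ℂ := ContinuousLinearMap.mul ℝ ℂ c

def pt (p : ℂ → Lin) (σ ζ : ℂ) : Lin := (p (psi σ ζ)).comp (mulL (psi1 σ ζ))
def Qt (p : ℂ → Lin) (Q : ℂ → Bil) (σ ζ : ℂ) : Bil :=
  (Q (psi σ ζ)).bilinearComp (mulL (psi1 σ ζ)) (mulL (psi1 σ ζ)) +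
    (ContinuousLinearMap.compL ℝ ℂ ℂ ℝ (p (psi σ ζ))).comp
      ((ContinuousLinearMap.mul ℝ ℂ).comp (mulL (psi2 σ ζ)))

lemma Qt_apply (p : ℂ → Lin) (Q : ℂ → Bil) (σ ζ a b : ℂ) : Qt p Q σ ζ a b =
    Q (psi σ ζ) (psi1 σ ζ * a) (psi1 σ ζ * b) + p (psi σ ζ) (psi2 σ ζ * a * b) := by
  simp [Qt]

lemma DP.hc {p : ℂ → Lin} {Q : ℂ → Bil} (h : DP p Q) {σ : ℂ} (hσ : ‖σ‖ = 1) : HC (pt p σ) (Qt p Q σ) := by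
  have hm : MapsTo (psi σ) UH (closedBall 0 1) := fun ζ hζ => by
    rw [mem_closedBall_zero_iff]; exact psi_norm hσ hζ
  have cp : ContinuousOn p (closedBall 0 1) := fun z hz => (h.d z hz).continuousWithinAt
  have c0 : ContinuousOn (psi σ) UH := fun ζ hζ => (psi_deriv σ hζ).continuousAt.continuousWithinAt
  have c1 : ContinuousOn (psi1 σ) UH := fun ζ hζ => (psi1_deriv σ hζ).continuousAt.continuousWithinAt
  have c2 : ContinuousOn (psi2 σ) UH := fun ζ hζ => by
    have : ContinuousAt ct ζ := (ct_deriv hζ).continuousAt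
    exact (continuousAt_const.mul (continuousAt_const.mul (this.pow 3))).continuousWithinAt
  refine ⟨?_, ?_, ?_, ?_⟩
  · intro ζ hζ
    have hz := hm hζ
    have e : ∀ c : ℂ, (ContinuousLinearMap.toSpanSingleton ℂ c).restrictScalars ℝ = mulL c := by
      intro c; ext x; simp [mul_comm]
    have d1 : HasFDerivWithinAt (psi σ) (mulL (psi1 σ ζ)) UH ζ := by
      rw [← e]; exact ((psi_deriv σ hζ).hasFDerivAt.restrictScalars ℝ).hasFDerivWithinAt
    have d2 : HasFDerivWithinAt (psi1 σ) (mulL (psi2 σ ζ)) UH ζ := by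
      rw [← e]; exact ((psi1_deriv σ hζ).hasFDerivAt.restrictScalars ℝ).hasFDerivWithinAt
    have d3 := (h.d _ hz).comp ζ d1 hm
    have d4 : HasFDerivWithinAt (fun ζ => mulL (psi1 σ ζ)) ((ContinuousLinearMap.mul ℝ ℂ).comp (mulL (psi2 σ ζ))) UH ζ :=
      (ContinuousLinearMap.mul ℝ ℂ).hasFDerivAt.comp_hasFDerivWithinAt ζ d2
    have d5 := d3.clm_comp d4
    refine d5.congr_fderiv ?_
    apply bil_ext
    intro a b
    rw [Qt_apply]
    simp
    ring
  · rw [continuousOn_clm_apply]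
    intro a
    rw [continuousOn_clm_apply]
    intro b
    simp only [Qt_apply]
    have q1 : ContinuousOn (fun ζ => Q (psi σ ζ)) UH := h.cQ.comp c0 hm
    have q2 : ContinuousOn (fun ζ => p (psi σ ζ)) UH := cp.comp c0 hm
    exact ((q1.clm_apply (c1.mul continuousOn_const)).clm_apply (c1.mul continuousOn_const)).add
      (q2.clm_apply ((c2.mul continuousOn_const).mul continuousOn_const))
  · intro ζ hζ a b
    rw [Qt_apply, Qt_apply, h.sym _ (hm hζ), mul_right_comm]
  · intro x
    have hx : (0 : ℝ) ≤ (x : ℂ).im := by simp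
    have hu := u_ne hx
    have e0 : (2 * ct x - 1) = (1 + Complex.I * x) * ct x := by
      unfold ct; field_simp; ring
    have hxx : ((1 + x ^ 2 : ℝ) : ℂ) ≠ 0 := by
      rw [Complex.ofReal_ne_zero]; positivity
    have hct : (1 - Complex.I * x) * ct x = 1 := by unfold ct; field_simp
    have e1 : psi1 σ x * 1 = (2 / (1 + x ^ 2) : ℝ) • (Complex.I * psi σ x) := by
      rw [Complex.real_smul, psi1, psi, e0, Complex.ofReal_div, div_mul_eq_mul_div, eq_div_iff hxx]
      push_cast
      have : (1 + (x : ℂ) ^ 2) * ct x = 1 + Complex.I * x := by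
        linear_combination (1 + Complex.I * x) * hct + (x ^ 2 * ct x) * Complex.I_sq
      linear_combination (σ * 2 * Complex.I * ct x) * this
    have e2 : ‖psi σ x‖ = 1 := by
      rw [psi, e0, norm_mul, norm_mul, hσ, one_mul, ct, norm_inv, ← div_eq_mul_inv,
        div_eq_one_iff_eq (by linarith [u_norm hx])]
      rw [← sq_eq_sq₀ (norm_nonneg _) (norm_nonneg _), Complex.sq_norm, Complex.sq_norm,
        Complex.normSq_apply, Complex.normSq_apply]
      simp
    show p (psi σ x) (psi1 σ x * 1) = 0
    rw [e1, map_smul, h.z0 _ e2, smul_zero]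

end MC

/-! part 9 -/

namespace MC
open MeasureTheory

abbrev DB : Set ℂ := closedBall (0 : ℂ) 1

lemma le_two_sqrt {x : ℝ} (h0 : 0 ≤ x) (h : x ≤ 4) : x ≤ 2 * √x := by
  have h1 := Real.mul_self_sqrt h0
  have h2 : √x ≤ 2 := by rw [show (2 : ℝ) = √4 by rw [show (4 : ℝ) = 2 ^ 2 by norm_num]; exact (Real.sqrt_sq (by norm_num)).symm]; exact Real.sqrt_le_sqrt h
  nlinarith [Real.sqrt_nonneg x]

lemma bil_diff (B : Bil) (a b a' b' : ℂ) : |B a b - B a' b'| ≤ ‖B‖ * (‖a - a'‖ * ‖b‖ + ‖a'‖ * ‖b - b'‖) := by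
  have e : B a b - B a' b' = B (a - a') b + B a' (b - b') := by
    simp only [map_sub, sub_apply]; ring
  rw [e]
  refine (abs_add_le _ _).trans ?_
  have h1 := B.le_opNorm₂ (a - a') b
  have h2 := B.le_opNorm₂ a' (b - b')
  rw [Real.norm_eq_abs] at h1 h2
  linarith

structure Hyp (p : ℂ → Lin) (Q : ℂ → Bil) (ℓ : ℂ → Cof) (lam Lam A N S F : ℝ) : Prop where
  dp : DP p Q
  ell : ∀ z ∈ DB, Ell lam Lam (ℓ z)
  hl : ∀ z ∈ DB, ∀ w ∈ DB, ‖ℓ z - ℓ w‖ ≤ A * √‖z - w‖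
  hQ : ∀ z ∈ DB, ∀ w ∈ DB, ‖Q z - Q w‖ ≤ N * √‖z - w‖
  sQ : ∀ z ∈ DB, ‖Q z‖ ≤ S
  sp : ∀ z ∈ DB, ‖p z‖ ≤ S
  hF : ∀ z ∈ DB, ∀ w ∈ DB, |ℓ z (Q z) - ℓ w (Q w)| ≤ F * √‖z - w‖
  hA0 : 0 ≤ A
  hN0 : 0 ≤ N
  hS0 : 0 ≤ S
  hF0 : 0 ≤ F

variable {p : ℂ → Lin} {Q : ℂ → Bil} {ℓ : ℂ → Cof} {lam Lam A N S F : ℝ}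

lemma Hyp.lipp (H : Hyp p Q ℓ lam Lam A N S F) {z w : ℂ} (hz : z ∈ DB) (hw : w ∈ DB) : ‖p z - p w‖ ≤ S * ‖z - w‖ :=
  Convex.norm_image_sub_le_of_norm_hasFDerivWithin_le (s := DB) H.dp.d H.sQ (convex_closedBall 0 1) hw hz

lemma psi_mem {σ ζ : ℂ} (hσ : ‖σ‖ = 1) (h : 0 ≤ ζ.im) : psi σ ζ ∈ DB := by
  rw [mem_closedBall_zero_iff]; exact psi_norm hσ h

lemma sqrt_psi {σ ζ ξ : ℂ} (hσ : ‖σ‖ = 1) (h : 0 ≤ ζ.im) (h' : 0 ≤ ξ.im) :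
    √‖psi σ ζ - psi σ ξ‖ ≤ 3 / 2 * √‖ζ - ξ‖ := by
  refine (Real.sqrt_le_sqrt (psi_lip hσ h h')).trans ?_
  rw [Real.sqrt_mul (by norm_num)]
  gcongr
  rw [Real.sqrt_le_left (by norm_num)]; norm_num

lemma Hyp.Qpsi (H : Hyp p Q ℓ lam Lam A N S F) {σ ζ ξ : ℂ} (hσ : ‖σ‖ = 1) (h : 0 ≤ ζ.im) (h' : 0 ≤ ξ.im) :
    ‖Q (psi σ ζ) - Q (psi σ ξ)‖ ≤ 3 / 2 * N * √‖ζ - ξ‖ := by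
  refine (H.hQ _ (psi_mem hσ h) _ (psi_mem hσ h')).trans ?_
  calc _ ≤ N * (3 / 2 * √‖ζ - ξ‖) := mul_le_mul_of_nonneg_left (sqrt_psi hσ h h') H.hN0
    _ = _ := by ring

lemma Hyp.pterm (H : Hyp p Q ℓ lam Lam A N S F) {σ ζ ξ : ℂ} (hσ : ‖σ‖ = 1) (h : 0 ≤ ζ.im) (h' : 0 ≤ ξ.im) (e : ℂ) :
    |p (psi σ ζ) (psi2 σ ζ * e) - p (psi σ ξ) (psi2 σ ξ * e)| ≤ 20 * S * ‖ζ - ξ‖ * ‖e‖ := by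
  have e1 : p (psi σ ζ) (psi2 σ ζ * e) - p (psi σ ξ) (psi2 σ ξ * e) =
      (p (psi σ ζ) - p (psi σ ξ)) (psi2 σ ζ * e) + p (psi σ ξ) ((psi2 σ ζ - psi2 σ ξ) * e) := by
    simp only [sub_apply, sub_mul, map_sub]; ring
  rw [e1]
  have b1 := (p (psi σ ζ) - p (psi σ ξ)).le_opNorm (psi2 σ ζ * e)
  have b2 := (p (psi σ ξ)).le_opNorm ((psi2 σ ζ - psi2 σ ξ) * e)
  rw [Real.norm_eq_abs, norm_mul] at b1 b2
  have c1 := H.lipp (psi_mem hσ h) (psi_mem hσ h')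
  have c2 := psi_lip hσ h h'
  have c3 := psi2_norm hσ h
  have c4 := psi2_lip hσ h h'
  have c5 := H.sp _ (psi_mem hσ h')
  have hS := H.hS0
  have d1 : ‖p (psi σ ζ) - p (psi σ ξ)‖ ≤ S * (2 * ‖ζ - ξ‖) := c1.trans (by gcongr)
  refine (abs_add_le _ _).trans ((add_le_add b1 b2).trans ?_)
  calc _ ≤ (S * (2 * ‖ζ - ξ‖)) * (4 * ‖e‖) + S * (12 * ‖ζ - ξ‖ * ‖e‖) := by gcongr
    _ = _ := by ring

lemma Hyp.Qt_holder (H : Hyp p Q ℓ lam Lam A N S F) {σ ζ ξ : ℂ} (hσ : ‖σ‖ = 1) (h : 0 ≤ ζ.im) (h' : 0 ≤ ξ.im)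
    (h4 : ‖ζ - ξ‖ ≤ 4) : ‖Qt p Q σ ζ - Qt p Q σ ξ‖ ≤ (6 * N + 72 * S) * √‖ζ - ξ‖ := by
  have hN := H.hN0
  have hS := H.hS0
  refine ContinuousLinearMap.opNorm_le_bound₂ _ (by positivity) ?_
  intro a b
  simp only [sub_apply, Qt_apply, Real.norm_eq_abs]
  set D := ‖ζ - ξ‖ with hD
  have hD0 : 0 ≤ D := norm_nonneg _
  have e : Q (psi σ ζ) (psi1 σ ζ * a) (psi1 σ ζ * b) + p (psi σ ζ) (psi2 σ ζ * a * b) -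
      (Q (psi σ ξ) (psi1 σ ξ * a) (psi1 σ ξ * b) + p (psi σ ξ) (psi2 σ ξ * a * b)) =
      (Q (psi σ ζ) - Q (psi σ ξ)) (psi1 σ ζ * a) (psi1 σ ζ * b) +
      (Q (psi σ ξ) (psi1 σ ζ * a) (psi1 σ ζ * b) - Q (psi σ ξ) (psi1 σ ξ * a) (psi1 σ ξ * b)) +
      (p (psi σ ζ) (psi2 σ ζ * (a * b)) - p (psi σ ξ) (psi2 σ ξ * (a * b))) := by
    simp only [sub_apply, mul_assoc]; ring
  rw [e]
  have b1 := (Q (psi σ ζ) - Q (psi σ ξ)).le_opNorm₂ (psi1 σ ζ * a) (psi1 σ ζ * b)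
  have b2 := bil_diff (Q (psi σ ξ)) (psi1 σ ζ * a) (psi1 σ ζ * b) (psi1 σ ξ * a) (psi1 σ ξ * b)
  have b3 := H.pterm hσ h h' (a * b)
  rw [← sub_mul, ← sub_mul] at b2
  simp only [norm_mul, Real.norm_eq_abs] at b1 b2 b3
  rw [← hD] at b3
  have c1 := H.Qpsi hσ h h'
  have c2 := psi1_norm hσ h
  have c3 := psi1_norm hσ h'
  have c4 := psi1_lip hσ h h'
  have c5 := H.sQ _ (psi_mem hσ h')
  rw [← hD] at c1 c4
  have f1 := b1.trans (show _ ≤ (3 / 2 * N * √D) * (2 * ‖a‖) * (2 * ‖b‖) by gcongr)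
  have f2 := b2.trans (show _ ≤ S * (4 * D * ‖a‖ * (2 * ‖b‖) + 2 * ‖a‖ * (4 * D * ‖b‖)) by gcongr)
  have sD := le_two_sqrt hD0 h4
  refine (abs_add_le _ _).trans ((add_le_add ((abs_add_le _ _).trans (add_le_add f1 f2)) b3).trans ?_)
  calc _ = (6 * N * √D + 36 * S * D) * ‖a‖ * ‖b‖ := by ring
    _ ≤ (6 * N * √D + 36 * S * (2 * √D)) * ‖a‖ * ‖b‖ := by gcongr
    _ = _ := by ring

lemma Hyp.Qt_norm (H : Hyp p Q ℓ lam Lam A N S F) {σ ζ : ℂ} (hσ : ‖σ‖ = 1) (h : 0 ≤ ζ.im) :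
    ‖Qt p Q σ ζ‖ ≤ 8 * S := by
  have hS := H.hS0
  refine ContinuousLinearMap.opNorm_le_bound₂ _ (by positivity) ?_
  intro a b
  simp only [Qt_apply, Real.norm_eq_abs]
  have b1 := (Q (psi σ ζ)).le_opNorm₂ (psi1 σ ζ * a) (psi1 σ ζ * b)
  have b2 := (p (psi σ ζ)).le_opNorm (psi2 σ ζ * a * b)
  simp only [norm_mul, Real.norm_eq_abs] at b1 b2
  have c2 := psi1_norm hσ h
  have c3 := psi2_norm hσ h
  have c5 := H.sQ _ (psi_mem hσ h)
  have c6 := H.sp _ (psi_mem hσ h)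
  have f1 := b1.trans (show _ ≤ S * (2 * ‖a‖) * (2 * ‖b‖) by gcongr)
  have f2 := b2.trans (show _ ≤ S * (4 * ‖a‖ * ‖b‖) by gcongr)
  refine (abs_add_le _ _).trans ((add_le_add f1 f2).trans (le_of_eq ?_))
  ring

/-- the frozen operator on the disc -/
lemma Hyp.frozen (H : Hyp p Q ℓ lam Lam A N S F) {z0 z w : ℂ} (h0 : z0 ∈ DB) (hz : z ∈ DB) (hw : w ∈ DB) :
    |ℓ z0 (Q z - Q w)| ≤ (A * √‖z0 - z‖ * N + F + A * S) * √‖z - w‖ := by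
  have e : ℓ z0 (Q z - Q w) = (ℓ z0 - ℓ z) (Q z - Q w) + (ℓ z (Q z) - ℓ w (Q w)) - (ℓ z - ℓ w) (Q w) := by
    simp only [sub_apply, cof_sub]; ring
  rw [e]
  have b1 := (ℓ z0 - ℓ z).le_opNorm (Q z - Q w)
  have b2 := (ℓ z - ℓ w).le_opNorm (Q w)
  have b3 := H.hF z hz w hw
  rw [Real.norm_eq_abs] at b1 b2
  have hA := H.hA0
  have hN := H.hN0
  have hS := H.hS0
  have f1 := b1.trans (show _ ≤ (A * √‖z0 - z‖) * (N * √‖z - w‖) from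
    mul_le_mul (H.hl _ h0 _ hz) (H.hQ _ hz _ hw) (by positivity) (by positivity))
  have f2 := b2.trans (show _ ≤ (A * √‖z - w‖) * S from
    mul_le_mul (H.hl _ hz _ hw) (H.sQ _ hw) (by positivity) (by positivity))
  refine (abs_sub _ _).trans ((add_le_add ((abs_add_le _ _).trans (add_le_add f1 b3)) f2).trans (le_of_eq ?_))
  ring

end MC

/-! part 10 -/

namespace MC
open MeasureTheory

variable {p : ℂ → Lin} {Q : ℂ → Bil} {ℓ : ℂ → Cof} {lam Lam A N S F : ℝ}

lemma le_self_sqrt {x : ℝ} (h0 : 0 ≤ x) (h : x ≤ 1) : x ≤ √x := by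
  have h1 := Real.mul_self_sqrt h0
  have h2 : √x ≤ 1 := Real.sqrt_le_iff.2 ⟨by norm_num, by linarith⟩
  nlinarith [Real.sqrt_nonneg x]

lemma Hyp.term (H : Hyp p Q ℓ lam Lam A N S F) {σ ζ1 z w : ℂ} (hσ : ‖σ‖ = 1) (h1 : 0 ≤ ζ1.im)
    (hz : 0 ≤ z.im) (hw : 0 ≤ w.im) {ν T : ℝ} (hν : ν ≤ 1) (hzν : ‖z - ζ1‖ ≤ ν) (hwν : ‖w - ζ1‖ ≤ ν)
    {s : ℂ} (hs : ‖s‖ ≤ 9 / 2 * T) (hT : ‖psi1 σ ζ1 * s‖ ≤ T) :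
    |(Qt p Q σ z s s - Qt p Q σ w s s) - (Q (psi σ z) - Q (psi σ w)) (psi1 σ ζ1 * s) (psi1 σ ζ1 * s)| ≤
      (270 * (√ν * N) + 1458 * S) * T ^ 2 * √‖z - w‖ := by
  have hN := H.hN0
  have hS := H.hS0
  have hν0 : 0 ≤ ν := (norm_nonneg _).trans hzν
  have hT0 : 0 ≤ T := (norm_nonneg _).trans hT
  simp only [Qt_apply]
  set D := ‖z - w‖ with hD
  have hD0 : 0 ≤ D := norm_nonneg _
  have hD2 : D ≤ 2 := by
    have : z - w = (z - ζ1) - (w - ζ1) := by ring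
    rw [hD, this]; refine (norm_sub_le _ _).trans (by linarith)
  have e : Q (psi σ z) (psi1 σ z * s) (psi1 σ z * s) + p (psi σ z) (psi2 σ z * s * s) -
      (Q (psi σ w) (psi1 σ w * s) (psi1 σ w * s) + p (psi σ w) (psi2 σ w * s * s)) -
      (Q (psi σ z) - Q (psi σ w)) (psi1 σ ζ1 * s) (psi1 σ ζ1 * s) =
      ((Q (psi σ z) - Q (psi σ w)) (psi1 σ z * s) (psi1 σ z * s) -
        (Q (psi σ z) - Q (psi σ w)) (psi1 σ ζ1 * s) (psi1 σ ζ1 * s)) +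
      (Q (psi σ w) (psi1 σ z * s) (psi1 σ z * s) - Q (psi σ w) (psi1 σ w * s) (psi1 σ w * s)) +
      (p (psi σ z) (psi2 σ z * (s * s)) - p (psi σ w) (psi2 σ w * (s * s))) := by
    simp only [sub_apply, mul_assoc]; ring
  rw [e]
  have b1 := bil_diff (Q (psi σ z) - Q (psi σ w)) (psi1 σ z * s) (psi1 σ z * s) (psi1 σ ζ1 * s) (psi1 σ ζ1 * s)
  have b2 := bil_diff (Q (psi σ w)) (psi1 σ z * s) (psi1 σ z * s) (psi1 σ w * s) (psi1 σ w * s)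
  have b3 := H.pterm hσ hz hw (s * s)
  have a1 : ‖psi1 σ z * s - psi1 σ ζ1 * s‖ ≤ 18 * ν * T := by
    rw [← sub_mul, norm_mul]
    calc _ ≤ (4 * ‖z - ζ1‖) * (9 / 2 * T) := mul_le_mul (psi1_lip hσ hz h1) hs (norm_nonneg _) (by positivity)
      _ ≤ (4 * ν) * (9 / 2 * T) := by gcongr
      _ = _ := by ring
  have a2 : ‖psi1 σ z * s - psi1 σ w * s‖ ≤ 18 * D * T := by
    rw [← sub_mul, norm_mul]
    calc _ ≤ (4 * D) * (9 / 2 * T) := mul_le_mul (psi1_lip hσ hz hw) hs (norm_nonneg _) (by positivity)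
      _ = _ := by ring
  have a3 : ∀ x : ℂ, 0 ≤ x.im → ‖psi1 σ x * s‖ ≤ 9 * T := by
    intro x hx
    rw [norm_mul]
    calc _ ≤ 2 * (9 / 2 * T) := mul_le_mul (psi1_norm hσ hx) hs (norm_nonneg _) (by positivity)
      _ = _ := by ring
  have a3z := a3 z hz
  have a3w := a3 w hw
  have c1 := H.Qpsi hσ hz hw
  have c5 := H.sQ _ (psi_mem hσ hw)
  rw [← hD] at c1 b3
  have f1 := b1.trans (show _ ≤ (3 / 2 * N * √D) * ((18 * ν * T) * (9 * T) + T * (18 * ν * T)) by gcongr)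
  have f2 := b2.trans (show _ ≤ S * ((18 * D * T) * (9 * T) + (9 * T) * (18 * D * T)) by gcongr)
  rw [norm_mul] at b3
  have f3 := b3.trans (show _ ≤ 20 * S * D * ((9 / 2 * T) * (9 / 2 * T)) by gcongr)
  have sD := le_two_sqrt hD0 (by linarith)
  have sν := le_self_sqrt hν0 hν
  refine (abs_add_le _ _).trans ((add_le_add ((abs_add_le _ _).trans (add_le_add f1 f2)) f3).trans ?_)
  calc _ = (270 * ν * N * √D + 729 * S * D) * T ^ 2 := by ring
    _ ≤ (270 * √ν * N * √D + 729 * S * (2 * √D)) * T ^ 2 := by gcongr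
    _ = _ := by ring

lemma Hyp.chart_op (H : Hyp p Q ℓ lam Lam A N S F) (hlam : 0 < lam) (hLam : 0 ≤ Lam) {σ ζ1 : ℂ} (hσ : ‖σ‖ = 1) (h1 : 0 ≤ ζ1.im)
    (h2 : ‖ζ1‖ ≤ 2) {ν : ℝ} (hν : ν ≤ 1) :
    ∃ σ1 σ2 : ℂ, σ1.im = 0 ∧ √lam / 2 ≤ σ1.re ∧ √lam / 2 ≤ σ2.im ∧ ‖σ1‖ ≤ 9 * √Lam ∧ ‖σ2‖ ≤ 9 * √Lam ∧
      ∀ z ∈ closedBall ζ1 ν, ∀ w ∈ closedBall ζ1 ν, 0 ≤ z.im → 0 ≤ w.im →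
      |(Qt p Q σ z σ1 σ1 + Qt p Q σ z σ2 σ2) - (Qt p Q σ w σ1 σ1 + Qt p Q σ w σ2 σ2)| ≤
       ((3 * A + 3 + 12000 * Lam) * (√ν * N + F + S)) * √‖z - w‖ := by
  have hN := H.hN0
  have hS := H.hS0
  have hF := H.hF0
  have hA := H.hA0
  set g := psi1 σ ζ1 with hg
  have n1 : 2 / 9 ≤ ‖g‖ := psi1_lower hσ h1 h2
  have n2 : ‖g‖ ≤ 2 := psi1_norm hσ h1
  have n0 : 0 < ‖g‖ := by linarith
  have nc : (‖g‖ : ℂ) ≠ 0 := by exact_mod_cast n0.ne'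
  have g0 : g ≠ 0 := norm_pos_iff.1 n0
  set ω := g / ‖g‖ with hω
  have hω1 : ‖ω‖ = 1 := by rw [hω, norm_div, Complex.norm_real, norm_norm]; exact div_self n0.ne'
  obtain ⟨P, q, s, hP1, hs1, hP2, hq2, hs2, hdec⟩ := ell_decomp hlam (H.ell _ (psi_mem hσ h1)) hω1
  have sl : 0 < √lam := Real.sqrt_pos.2 hlam
  have i1 : √lam / 2 ≤ √lam / ‖g‖ := by gcongr
  have nt : ‖(q : ℂ) + s * Complex.I‖ ≤ 2 * √Lam := by
    refine (norm_add_le _ _).trans ?_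
    simp only [norm_mul, Complex.norm_real, Complex.norm_I, Real.norm_eq_abs]
    rw [abs_of_pos (show 0 < s by linarith)]; linarith
  have gω : ∀ x : ℂ, g * (x / ‖g‖) = x * ω := by intro x; rw [hω]; ring
  have invb : ∀ x T : ℝ, 0 ≤ x → x ≤ T → x / ‖g‖ ≤ 9 / 2 * T := by
    intro x T hx hT
    rw [div_le_iff₀ n0]
    have : 0 ≤ T := hx.trans hT
    nlinarith
  have nP : ‖(P : ℂ)‖ ≤ √Lam := by
    rw [Complex.norm_real, Real.norm_eq_abs, abs_of_pos (by linarith)]; exact hP2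
  refine ⟨P / ‖g‖, (q + s * Complex.I) / ‖g‖, ?_, ?_, ?_, ?_, ?_, ?_⟩
  · rw [← Complex.ofReal_div]; exact Complex.ofReal_im _
  · rw [← Complex.ofReal_div, Complex.ofReal_re]
    exact i1.trans (by gcongr)
  · rw [Complex.div_ofReal_im]
    simp
    exact i1.trans (by gcongr)
  · rw [norm_div, Complex.norm_real ‖g‖, norm_norm]
    have := invb _ _ (norm_nonneg _) nP
    linarith [Real.sqrt_nonneg Lam]
  · rw [norm_div, Complex.norm_real ‖g‖, norm_norm]
    have := invb _ _ (norm_nonneg _) nt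
    linarith [Real.sqrt_nonneg Lam]
  intro z hz w hw hz0 hw0
  rw [mem_closedBall, dist_eq_norm] at hz hw
  have hν0 : 0 ≤ ν := (norm_nonneg _).trans hz
  have hz' := psi_mem hσ hz0
  have hw' := psi_mem hσ hw0
  have hd := hdec (Q (psi σ z) - Q (psi σ w)) (by
    intro a b; simp only [sub_apply]; rw [H.dp.sym _ hz', H.dp.sym _ hw'])
  have fr := H.frozen (psi_mem hσ h1) hz' hw'
  rw [hd] at fr
  have t1 := H.term (T := 2 * √Lam) hσ h1 hz0 hw0 hν hz hw (s := P / ‖g‖) (by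
    rw [norm_div, Complex.norm_real ‖g‖, norm_norm]
    exact invb _ _ (norm_nonneg _) (by linarith [Real.sqrt_nonneg Lam])) (by
    rw [gω, norm_mul, hω1]; linarith [Real.sqrt_nonneg Lam])
  have t2 := H.term (T := 2 * √Lam) hσ h1 hz0 hw0 hν hz hw (s := (q + s * Complex.I) / ‖g‖) (by
    rw [norm_div, Complex.norm_real ‖g‖, norm_norm]
    exact invb _ _ (norm_nonneg _) nt) (by
    rw [gω, norm_mul, hω1]; linarith)
  rw [← hg, gω] at t1 t2
  rw [mul_pow, Real.sq_sqrt hLam] at t1 t2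
  have fr2 : |(Q (psi σ z) - Q (psi σ w)) (P * ω) (P * ω) +
      (Q (psi σ z) - Q (psi σ w)) ((q + s * Complex.I) * ω) ((q + s * Complex.I) * ω)| ≤
      (A * (3 / 2 * √ν) * N + F + A * S) * (3 / 2 * √‖z - w‖) := by
    refine fr.trans ?_
    have u1 : √‖psi σ ζ1 - psi σ z‖ ≤ 3 / 2 * √ν := by
      refine (sqrt_psi hσ h1 hz0).trans ?_
      rw [norm_sub_rev]
      gcongr
    have u2 := sqrt_psi hσ hz0 hw0
    gcongr
  rw [abs_le] at t1 t2 fr2 ⊢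
  have key : ((A * (3 / 2 * √ν) * N + F + A * S) * (3 / 2 * √‖z - w‖)) +
     2 * ((270 * (√ν * N) + 1458 * S) * (2 ^ 2 * Lam) * √‖z - w‖) ≤
     ((3 * A + 3 + 12000 * Lam) * (√ν * N + F + S)) * √‖z - w‖ := by
    have hh : 0 ≤ √ν * N := by positivity
    have : ((3 * A + 3 + 12000 * Lam) * (√ν * N + F + S)) * √‖z - w‖ -
      (((A * (3 / 2 * √ν) * N + F + A * S) * (3 / 2 * √‖z - w‖)) +
     2 * ((270 * (√ν * N) + 1458 * S) * (2 ^ 2 * Lam) * √‖z - w‖)) =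
     ((3 / 4 * A + 3 + 9840 * Lam) * (√ν * N) + (3 * A + 3 / 2 + 12000 * Lam) * F + (3 / 2 * A + 3 + 336 * Lam) * S) * √‖z - w‖ := by ring
    have : 0 ≤ ((3 / 4 * A + 3 + 9840 * Lam) * (√ν * N) + (3 * A + 3 / 2 + 12000 * Lam) * F + (3 / 2 * A + 3 + 336 * Lam) * S) * √‖z - w‖ := by positivity
    linarith
  constructor <;> linarith [t1.1, t1.2, t2.1, t2.2, fr2.1, fr2.2]

end MC

/-! part 11 -/

namespace MC
open MeasureTheory

variable {p : ℂ → Lin} {Q : ℂ → Bil} {ℓ : ℂ → Cof} {lam Lam A N S F : ℝ}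

/-- undoing the chart -/
lemma Hyp.back (H : Hyp p Q ℓ lam Lam A N S F) {σ ζ ξ : ℂ} (hσ : ‖σ‖ = 1) (h : 0 ≤ ζ.im) (h' : 0 ≤ ξ.im)
    (hz : ‖ζ‖ ≤ 2) (hx : ‖ξ‖ ≤ 2) :
    ‖Q (psi σ ζ) - Q (psi σ ξ)‖ ≤ 81 / 4 * ‖Qt p Q σ ζ - Qt p Q σ ξ‖ + 223 * S * ‖ζ - ξ‖ := by
  have hS := H.hS0
  have σ0 : σ ≠ 0 := by intro e; rw [e] at hσ; simp at hσ
  have I0 := Complex.I_ne_zero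
  set u : ℂ → ℂ := fun x => 1 - Complex.I * x with hu
  set g : ℂ → ℂ := fun x => (u x) ^ 2 / (2 * Complex.I * σ) with hg
  set k : ℂ → ℂ := fun x => u x / σ with hk
  have un : ∀ x : ℂ, ‖x‖ ≤ 2 → ‖u x‖ ≤ 3 := by
    intro x hx
    refine (norm_sub_le _ _).trans ?_
    rw [norm_mul, Complex.norm_I, norm_one]; linarith
  have gn : ∀ x : ℂ, ‖x‖ ≤ 2 → ‖g x‖ ≤ 9 / 2 := by
    intro x hx
    simp only [hg, norm_div, norm_mul, norm_pow, hσ, Complex.norm_I]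
    have := un x hx
    have h3 : ‖u x‖ ^ 2 ≤ 3 ^ 2 := by gcongr
    norm_num
    norm_num at h3
    linarith
  have gl : ‖g ζ - g ξ‖ ≤ 3 * ‖ζ - ξ‖ := by
    have : g ζ - g ξ = ((u ζ + u ξ) * (-Complex.I * (ζ - ξ))) / (2 * Complex.I * σ) := by
      simp only [hg, hu]; field_simp; ring
    rw [this]
    simp only [norm_div, norm_mul, norm_neg, hσ, Complex.norm_I]
    have h3 : ‖u ζ + u ξ‖ ≤ 6 := (norm_add_le _ _).trans (by linarith [un _ hz, un _ hx])
    norm_num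
    nlinarith [norm_nonneg (ζ - ξ)]
  have kn : ‖k ζ‖ ≤ 3 := by
    simp only [hk, norm_div, hσ, div_one]; exact un _ hz
  have kl : ‖k ζ - k ξ‖ ≤ ‖ζ - ξ‖ := by
    have : k ζ - k ξ = (-Complex.I * (ζ - ξ)) / σ := by
      simp only [hk, hu]; field_simp; ring
    rw [this]; simp [hσ]
  have rep : ∀ x : ℂ, 0 ≤ x.im → ∀ a b, Q (psi σ x) a b = Qt p Q σ x (g x * a) (g x * b) - p (psi σ x) (k x * (a * b)) := by
    intro x hx a b
    have ux := u_ne hx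
    have e1 : ∀ a, psi1 σ x * (g x * a) = a := by
      intro a
      simp only [psi1, hg, hu, ct]; field_simp
    have e2 : psi2 σ x * (g x * a) * (g x * b) = k x * (a * b) := by
      simp only [psi2, hg, hu, ct, hk]; field_simp
      rw [Complex.I_sq]; ring
    rw [Qt_apply, e1, e1, e2]; ring
  refine ContinuousLinearMap.opNorm_le_bound₂ _ (by positivity) ?_
  intro a b
  simp only [sub_apply, Real.norm_eq_abs]
  rw [rep ζ h, rep ξ h']
  have e : Qt p Q σ ζ (g ζ * a) (g ζ * b) - p (psi σ ζ) (k ζ * (a * b)) -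
      (Qt p Q σ ξ (g ξ * a) (g ξ * b) - p (psi σ ξ) (k ξ * (a * b))) =
      (Qt p Q σ ζ - Qt p Q σ ξ) (g ζ * a) (g ζ * b) +
      (Qt p Q σ ξ (g ζ * a) (g ζ * b) - Qt p Q σ ξ (g ξ * a) (g ξ * b)) -
      ((p (psi σ ζ) - p (psi σ ξ)) (k ζ * (a * b)) + p (psi σ ξ) ((k ζ - k ξ) * (a * b))) := by
    simp only [sub_apply, sub_mul, map_sub]; ring
  rw [e]
  have b1 := (Qt p Q σ ζ - Qt p Q σ ξ).le_opNorm₂ (g ζ * a) (g ζ * b)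
  have b2 := bil_diff (Qt p Q σ ξ) (g ζ * a) (g ζ * b) (g ξ * a) (g ξ * b)
  have b3 := (p (psi σ ζ) - p (psi σ ξ)).le_opNorm (k ζ * (a * b))
  have b4 := (p (psi σ ξ)).le_opNorm ((k ζ - k ξ) * (a * b))
  rw [← sub_mul, ← sub_mul] at b2
  simp only [norm_mul, Real.norm_eq_abs] at b1 b2 b3 b4
  have c1 := gn _ hz
  have c2 := gn _ hx
  have c3 := H.Qt_norm hσ h'
  have c4 : ‖p (psi σ ζ) - p (psi σ ξ)‖ ≤ S * (2 * ‖ζ - ξ‖) :=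
    (H.lipp (psi_mem hσ h) (psi_mem hσ h')).trans (by gcongr; exact psi_lip hσ h h')
  have c5 := H.sp _ (psi_mem hσ h')
  have f1 := b1.trans (show _ ≤ ‖Qt p Q σ ζ - Qt p Q σ ξ‖ * (9 / 2 * ‖a‖) * (9 / 2 * ‖b‖) by gcongr)
  have f2 := b2.trans (show _ ≤ (8 * S) * ((3 * ‖ζ - ξ‖) * ‖a‖ * (9 / 2 * ‖b‖) + 9 / 2 * ‖a‖ * ((3 * ‖ζ - ξ‖) * ‖b‖)) by gcongr)
  have f3 := b3.trans (show _ ≤ (S * (2 * ‖ζ - ξ‖)) * (3 * (‖a‖ * ‖b‖)) by gcongr)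
  have f4 := b4.trans (show _ ≤ S * (‖ζ - ξ‖ * (‖a‖ * ‖b‖)) by gcongr)
  refine (abs_sub _ _).trans ((add_le_add ((abs_add_le _ _).trans (add_le_add f1 f2)) ((abs_add_le _ _).trans (add_le_add f3 f4))).trans (le_of_eq ?_))
  ring

/-- inverse chart -/
def ich (w : ℂ) : ℂ := Complex.I * (2 * (1 + w)⁻¹ - 1)

lemma ich_psi {σ w : ℂ} (hw : 1 + w ≠ 0) : psi σ (ich w) = σ * w := by
  unfold psi ct ich
  have : 1 - Complex.I * (Complex.I * (2 * (1 + w)⁻¹ - 1)) = 2 * (1 + w)⁻¹ := by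
    rw [← mul_assoc, Complex.I_mul_I]; ring
  rw [this]; field_simp; ring

lemma ich_im {w : ℂ} (hw : 1 + w ≠ 0) (h : ‖w‖ ≤ 1) : 0 ≤ (ich w).im := by
  unfold ich
  simp [Complex.inv_re]
  have n : 0 < Complex.normSq (1 + w) := Complex.normSq_pos.2 hw
  have h2 : w.re ^ 2 + w.im ^ 2 ≤ 1 := by
    have := Complex.sq_norm w
    rw [Complex.normSq_apply] at this
    nlinarith [norm_nonneg w]
  rw [← mul_div_assoc, le_div_iff₀ n, Complex.normSq_apply]
  simp
  nlinarith

lemma ich_lip {x w : ℂ} (hx : 1 ≤ ‖1 + x‖) (hw : 1 / 2 ≤ ‖1 + w‖) : ‖ich x - ich w‖ ≤ 4 * ‖x - w‖ := by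
  have x0 : 1 + x ≠ 0 := by intro e; rw [e] at hx; norm_num at hx
  have w0 : 1 + w ≠ 0 := by intro e; rw [e] at hw; norm_num at hw
  have : ich x - ich w = -Complex.I * 2 * (x - w) / ((1 + x) * (1 + w)) := by
    unfold ich; field_simp; ring
  rw [this, norm_div, norm_mul, norm_mul, norm_mul, norm_neg, Complex.norm_I, div_le_iff₀ (by positivity)]
  norm_num
  have : 1 * (1 / 2) ≤ ‖1 + x‖ * ‖1 + w‖ := by gcongr
  nlinarith [norm_nonneg (x - w)]

set_option maxHeartbeats 1000000 in
lemma local_est (lam Lam A : ℝ) (hlam : 0 < lam) (hLam : lam ≤ Lam) (hA : 0 ≤ A) : ∃ C : ℝ, 0 ≤ C ∧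
    ∀ p Q ℓ N S F, Hyp p Q ℓ lam Lam A N S F → ∀ z ∈ DB, ∀ w ∈ DB,
    ‖Q z - Q w‖ ≤ (N / 2 + C * (F + S)) * √‖z - w‖ := by
  have sl : 0 < √lam := Real.sqrt_pos.2 hlam
  have sL : √lam ≤ √Lam := Real.sqrt_le_sqrt hLam
  obtain ⟨m, C, hm, hC, hHP⟩ := HP (√lam / 2) (9 * √Lam) (1 / 1000) (by positivity) (by linarith) (by norm_num)
  set c1 := 3 * A + 3 + 12000 * Lam with hc1
  have hc10 : 0 ≤ c1 := by have := hlam.le.trans hLam; positivity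
  set X := 81 / 2 * C * c1 with hX
  have hX0 : 0 ≤ X := by positivity
  set d0 := min (1 / 4) ((1 / (4 * (X + 1))) ^ 2 / (4 * m)) with hd0
  have d0p : 0 < d0 := by apply lt_min; norm_num; positivity
  refine ⟨3 + X + 892 + 2 / √d0, by positivity, ?_⟩
  intro p Q ℓ N S F H z hz w hw
  have hN := H.hN0
  have hS := H.hS0
  have hF := H.hF0
  set d := ‖z - w‖ with hd
  have hd00 : 0 ≤ d := norm_nonneg _
  rcases le_total d d0 with hdd | hdd
  swap
  · have s1 : 1 ≤ √d / √d0 := by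
      rw [one_le_div (Real.sqrt_pos.2 d0p)]; exact Real.sqrt_le_sqrt hdd
    calc ‖Q z - Q w‖ ≤ ‖Q z‖ + ‖Q w‖ := norm_sub_le _ _
      _ ≤ 2 * S := by linarith [H.sQ z hz, H.sQ w hw]
      _ ≤ 2 * S * (√d / √d0) := le_mul_of_one_le_right (by positivity) s1
      _ = 2 / √d0 * S * √d := by ring
      _ ≤ _ := by
        gcongr
        have : 0 ≤ N / 2 + (3 + X + 892) * (F + S) + 2 / √d0 * F := by positivity
        linarith
  · -- local case
    have hd4 : d ≤ 1 / 4 := hdd.trans (min_le_left _ _)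
    have hdm : 4 * m * d ≤ (1 / (4 * (X + 1))) ^ 2 := by
      have := hdd.trans (min_le_right _ _)
      rw [le_div_iff₀ (by positivity)] at this; linarith
    have hsm : √(4 * m * d) ≤ 1 / (4 * (X + 1)) := by
      rw [← Real.sqrt_sq (show 0 ≤ 1 / (4 * (X + 1)) by positivity)]; exact Real.sqrt_le_sqrt hdm
    have hz1 : ‖z‖ ≤ 1 := mem_closedBall_zero_iff.1 hz
    have hw1 : ‖w‖ ≤ 1 := mem_closedBall_zero_iff.1 hw
    obtain ⟨σ, hσ, hσz⟩ : ∃ σ : ℂ, ‖σ‖ = 1 ∧ z = σ * ‖z‖ := by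
      by_cases h : z = 0
      · exact ⟨1, by simp, by simp [h]⟩
      · refine ⟨z / ‖z‖, ?_, ?_⟩
        · rw [norm_div, Complex.norm_real, norm_norm, div_self (norm_ne_zero_iff.2 h)]
        · rw [div_mul_cancel₀]; exact_mod_cast norm_ne_zero_iff.2 h
    have σ0 : σ ≠ 0 := by intro e; rw [e] at hσ; simp at hσ
    set x : ℂ := ((‖z‖ : ℝ) : ℂ) with hx
    set y : ℂ := w / σ with hy
    have hσy : w = σ * y := by rw [hy]; field_simp
    have hxy : ‖x - y‖ = d := by
      rw [hd, hσz, hσy, ← mul_sub, norm_mul, hσ, one_mul]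
    have ny : ‖y‖ ≤ 1 := by rw [hy, norm_div, hσ, div_one]; exact hw1
    have nx : ‖x‖ ≤ 1 := by rw [hx, Complex.norm_real, norm_norm]; exact hz1
    have x1 : 1 ≤ ‖1 + x‖ := by
      have := Complex.re_le_norm (1 + x)
      simp [hx] at this
      rw [hx]
      linarith [norm_nonneg z]
    have y1 : 1 / 2 ≤ ‖1 + y‖ := by
      have := norm_sub_norm_le (1 + x) (x - y)
      rw [show 1 + x - (x - y) = 1 + y by ring] at this
      linarith
    have x0 : 1 + x ≠ 0 := by intro e; rw [e] at x1; norm_num at x1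
    have y0 : 1 + y ≠ 0 := by intro e; rw [e] at y1; norm_num at y1
    set ζ1 := ich x with hζ1
    set ζ2 := ich y with hζ2
    have i1 : 0 ≤ ζ1.im := ich_im x0 nx
    have i2 : 0 ≤ ζ2.im := ich_im y0 ny
    have hr : ‖ζ1 - ζ2‖ ≤ 4 * d := by rw [← hxy]; exact ich_lip x1 y1
    have n1 : ‖ζ1‖ ≤ 1 := by
      have e : ζ1 = ich x - ich 1 := by rw [hζ1]; unfold ich; norm_num
      have e2 : ich x - ich 1 = Complex.I * (1 - x) / (1 + x) := by unfold ich; field_simp; ring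
      rw [e, e2, norm_div, norm_mul, Complex.norm_I, one_mul, div_le_one (by linarith)]
      have : ‖(1 : ℂ) - x‖ ≤ 1 := by
        rw [hx, ← Complex.ofReal_one, ← Complex.ofReal_sub, Complex.norm_real, Real.norm_eq_abs, abs_le]
        constructor <;> linarith [norm_nonneg z]
      linarith
    have n2 : ‖ζ2‖ ≤ 2 := by
      have : ζ2 = ζ1 - (ζ1 - ζ2) := by ring
      rw [this]; refine (norm_sub_le _ _).trans (by linarith)
    have p1 : psi σ ζ1 = z := by rw [hζ1, ich_psi x0, ← hσz]
    have p2 : psi σ ζ2 = w := by rw [hζ2, ich_psi y0, ← hσy]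
    have bk := H.back hσ i1 i2 (by linarith) n2
    rw [p1, p2] at bk
    set r := ‖ζ1 - ζ2‖ with hrdef
    have hr0 : 0 ≤ r := norm_nonneg _
    have hmr : m * r ≤ 4 * m * d := by nlinarith
    have hmr1 : m * r ≤ 1 := by
      have : (1 / (4 * (X + 1))) ^ 2 ≤ 1 := by
        apply pow_le_one₀ (by positivity)
        rw [div_le_one (by positivity)]; linarith
      linarith
    obtain ⟨σ1, σ2, a1, a2, a3, a4, a5, a6⟩ := H.chart_op hlam (hlam.le.trans hLam) hσ i1 (by linarith) hmr1
    have est := hHP _ _ (H.dp.hc hσ) ζ1 ζ2 i1 i2 σ1 σ2 a1 a2 a3 a4 a5 (6 * N + 72 * S)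
      (c1 * (√(m * r) * N + F + S)) (by positivity) (by positivity) (by
        intro z hz w hw hz0 hw0
        refine H.Qt_holder hσ hz0 hw0 ?_
        rw [mem_closedBall, dist_eq_norm] at hz hw
        have : z - w = (z - ζ1) - (w - ζ1) := by ring
        rw [this]; refine (norm_sub_le _ _).trans (by linarith)) a6
    rw [← hrdef] at est
    have sr : √r ≤ 2 * √d := by
      have : √(4 * d) = 2 * √d := by
        rw [Real.sqrt_mul (by norm_num), show (4 : ℝ) = 2 ^ 2 by norm_num, Real.sqrt_sq (by norm_num)]
      rw [← this]; exact Real.sqrt_le_sqrt hr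
    have smr : √(m * r) ≤ 1 / (4 * (X + 1)) := (Real.sqrt_le_sqrt hmr).trans hsm
    have sd := le_self_sqrt hd00 (by linarith)
    have hXX : X * (1 / (4 * (X + 1))) ≤ 1 / 4 := by
      rw [mul_one_div, div_le_div_iff₀ (by positivity) (by norm_num)]; linarith
    calc ‖Q z - Q w‖ ≤ 81 / 4 * ((1 / 1000 * (6 * N + 72 * S) + C * (c1 * (√(m * r) * N + F + S))) * √r) + 223 * S * r :=
          bk.trans (by gcongr)
      _ ≤ 81 / 4 * ((1 / 1000 * (6 * N + 72 * S) + C * (c1 * (1 / (4 * (X + 1)) * N + F + S))) * (2 * √d)) + 223 * S * (4 * √d) := by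
          gcongr; linarith
      _ = ((243 / 1000 + X * (1 / (4 * (X + 1)))) * N + (2916 / 1000 + X + 892) * S + X * F) * √d := by rw [hX]; ring
      _ ≤ _ := by
        refine mul_le_mul_of_nonneg_right ?_ (Real.sqrt_nonneg _)
        have g1 : (243 / 1000 + X * (1 / (4 * (X + 1)))) * N ≤ 1 / 2 * N := by gcongr; linarith
        have g2 : 0 ≤ 2 / √d0 * (F + S) := by positivity
        have g3 : (3 + X + 892 + 2 / √d0) * (F + S) = (895 + X) * F + (895 + X) * S + 2 / √d0 * (F + S) := by ring
        rw [g3]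
        have g4 : (2916 / 1000 + X + 892) * S ≤ (895 + X) * S := mul_le_mul_of_nonneg_right (by linarith) hS
        have g5 : X * F ≤ (895 + X) * F := mul_le_mul_of_nonneg_right (by linarith) hF
        linarith

end MC

/-! part 12 -/

namespace MC
open MeasureTheory

structure VD (v : ℂ → ℝ) (p : ℂ → Lin) (Q : ℂ → Bil) : Prop where
  dv : ∀ z ∈ DB, HasFDerivWithinAt v (p z) DB z
  dp : ∀ z ∈ DB, HasFDerivWithinAt p (Q z) DB z
  sym : ∀ z ∈ DB, ∀ a b, Q z a b = Q z b a
  v0 : ∀ z : ℂ, ‖z‖ = 1 → v z = 0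

variable {v : ℂ → ℝ} {p : ℂ → Lin} {Q : ℂ → Bil} {ℓ : ℂ → Cof} {lam Lam A N S F V : ℝ}

def HolD (Q : ℂ → Bil) (N : ℝ) : Prop := ∀ z ∈ DB, ∀ w ∈ DB, ‖Q z - Q w‖ ≤ N * √‖z - w‖

lemma HolD.cont (h : HolD Q N) : ContinuousOn Q DB := by
  intro w hw
  rw [ContinuousWithinAt, tendsto_iff_norm_sub_tendsto_zero]
  have : Filter.Tendsto (fun z : ℂ => N * √‖z - w‖) (nhdsWithin w DB) (nhds 0) := by
    have c : Continuous (fun z : ℂ => N * √‖z - w‖) := by fun_prop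
    have := (c.tendsto w).mono_left (nhdsWithin_le_nhds (s := DB))
    simpa using this
  refine squeeze_zero' (Filter.Eventually.of_forall fun _ => norm_nonneg _) ?_ this
  filter_upwards [self_mem_nhdsWithin] with z hz
  exact h z hz w hw

lemma VD.toDP (h : VD v p Q) (hN : HolD Q N) : DP p Q := by
  refine ⟨h.dp, hN.cont, h.sym, ?_⟩
  intro z hz
  have zD : z ∈ DB := by rw [mem_closedBall_zero_iff, hz]
  have hc : HasDerivAt (fun θ : ℝ => Complex.exp (θ * Complex.I) * z) (Complex.I * z) 0 := by
    have h1 : HasDerivAt (fun θ : ℝ => (θ : ℂ) * Complex.I) Complex.I 0 := by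
      simpa using (Complex.ofRealCLM.hasDerivAt (x := (0 : ℝ))).mul_const Complex.I
    have h2 := (h1.cexp).mul_const z
    simpa using h2
  have mem : ∀ θ : ℝ, ‖Complex.exp (θ * Complex.I) * z‖ = 1 := by
    intro θ; rw [norm_mul, Complex.norm_exp_ofReal_mul_I, hz, one_mul]
  have e0 : Complex.exp (((0 : ℝ) : ℂ) * Complex.I) * z = z := by simp
  have hv : HasFDerivWithinAt v (p z) DB (Complex.exp (((0 : ℝ) : ℂ) * Complex.I) * z) := by rw [e0]; exact h.dv z zD
  have comp := hv.comp_hasDerivWithinAt (s := univ) (0 : ℝ) hc.hasDerivWithinAt (by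
    intro θ _; rw [mem_closedBall_zero_iff, mem])
  have e1 : (v ∘ fun θ : ℝ => Complex.exp (θ * Complex.I) * z) = fun _ => 0 := by
    ext θ; exact h.v0 _ (mem θ)
  rw [e1] at comp
  have := comp.hasDerivAt Filter.univ_mem
  exact this.unique (hasDerivAt_const _ _)

lemma VD.tay1 (h : VD v p Q) (hN : HolD Q N) (hN0 : 0 ≤ N) {y : ℂ} {δ : ℝ} (hδ : 0 ≤ δ) (hb : closedBall y δ ⊆ DB) {w : ℂ}
    (hw : w ∈ closedBall y δ) : ‖p w - p y - Q y (w - y)‖ ≤ N * √δ * δ := by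
  have hy : y ∈ closedBall y δ := mem_closedBall_self hδ
  have d : ∀ x ∈ closedBall y δ, HasFDerivWithinAt (fun x => p x - Q y x) (Q x - Q y) (closedBall y δ) x := by
    intro x hx
    exact ((h.dp x (hb hx)).mono hb).sub (Q y).hasFDerivWithinAt
  have := Convex.norm_image_sub_le_of_norm_hasFDerivWithin_le (C := N * √δ) d (by
    intro x hx
    refine (hN x (hb hx) y (hb hy)).trans ?_
    rw [mem_closedBall, dist_eq_norm] at hx
    gcongr) (convex_closedBall y δ) hy hw
  rw [mem_closedBall, dist_eq_norm] at hw
  calc _ = ‖p w - Q y w - (p y - Q y y)‖ := by congr 1; rw [map_sub]; abel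
    _ ≤ _ := this
    _ ≤ _ := by gcongr

lemma VD.tay2 (h : VD v p Q) (hN : HolD Q N) (hN0 : 0 ≤ N) {y : ℂ} {δ : ℝ} (hδ : 0 ≤ δ) (hb : closedBall y δ ⊆ DB) {w : ℂ}
    (hw : w ∈ closedBall y δ) : |v w - v y - p y (w - y) - 1 / 2 * Q y (w - y) (w - y)| ≤ N * √δ * δ * δ := by
  have hy : y ∈ closedBall y δ := mem_closedBall_self hδ
  have hyD := hb hy
  have d : ∀ x ∈ closedBall y δ, HasFDerivWithinAt (fun x => v x - p y x - 1 / 2 * Q y (x - y) (x - y)) (p x - p y - Q y (x - y)) (closedBall y δ) x := by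
    intro x hx
    have hq : HasFDerivAt (fun x => 1 / 2 * Q y (x - y) (x - y)) (Q y (x - y)) x := by
      have h1 : HasFDerivAt (fun x => Q y (x - y)) (Q y) x := by
        have := (Q y).hasFDerivAt.comp x ((hasFDerivAt_id x).sub_const y)
        exact this.congr_fderiv (ContinuousLinearMap.comp_id _)
      have h2 := (h1.clm_apply ((hasFDerivAt_id x).sub_const y)).const_mul (1 / 2)
      refine h2.congr_fderiv ?_
      ext <;> simp [h.sym y hyD] <;> ring
    exact (((h.dv x (hb hx)).mono hb).sub (p y).hasFDerivWithinAt).sub hq.hasFDerivWithinAt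
  have := Convex.norm_image_sub_le_of_norm_hasFDerivWithin_le (C := N * √δ * δ) d (by
    intro x hx
    exact h.tay1 hN hN0 hδ hb hx) (convex_closedBall y δ) hy hw
  rw [mem_closedBall, dist_eq_norm] at hw
  rw [Real.norm_eq_abs] at this
  calc _ = |v w - p y w - 1 / 2 * Q y (w - y) (w - y) - (v y - p y y - 1 / 2 * Q y (y - y) (y - y))| := by
        congr 1; simp [map_sub]; ring
    _ ≤ _ := this
    _ ≤ _ := by gcongr

lemma VD.second (h : VD v p Q) (hN : HolD Q N) (hN0 : 0 ≤ N) {y k : ℂ} (hb : closedBall y ‖k‖ ⊆ DB) :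
    |v (y + k) + v (y - k) - 2 * v y - Q y k k| ≤ 2 * (N * √‖k‖ * ‖k‖ ^ 2) := by
  have t1 := h.tay2 hN hN0 (norm_nonneg k) hb (w := y + k) (by simp)
  have t2 := h.tay2 hN hN0 (norm_nonneg k) hb (w := y - k) (by simp)
  have e1 : y + k - y = k := by ring
  have e2 : y - k - y = -k := by ring
  rw [e1] at t1
  rw [e2] at t2
  simp only [map_neg, neg_apply, neg_neg] at t2
  have := (abs_add_le _ _).trans (add_le_add t1 t2)
  calc _ = |v (y + k) - v y - p y k - 1 / 2 * Q y k k + (v (y - k) - v y - -p y k - 1 / 2 * Q y k k)| := by congr 1; ring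
    _ ≤ _ := this
    _ = _ := by ring

lemma bil_polar {B : Bil} (hs : ∀ a b, B a b = B b a) {M : ℝ} (hM : 0 ≤ M) (h : ∀ a : ℂ, |B a a| ≤ M * ‖a‖ ^ 2) : ‖B‖ ≤ M := by
  refine ContinuousLinearMap.opNorm_le_bound₂ _ hM ?_
  intro a b
  by_cases ha : a = 0
  · simp [ha]
  by_cases hb : b = 0
  · simp [hb]
  have na : 0 < ‖a‖ := norm_pos_iff.2 ha
  have nb : 0 < ‖b‖ := norm_pos_iff.2 hb
  set x := ‖b‖ • a
  set y := ‖a‖ • b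
  have nx : ‖x‖ = ‖a‖ * ‖b‖ := by simp [x, norm_smul]; ring
  have ny : ‖y‖ = ‖a‖ * ‖b‖ := by simp [y, norm_smul]
  have e : 4 * B x y = B (x + y) (x + y) - B (x - y) (x - y) := by
    simp only [map_add, map_sub, add_apply, sub_apply, hs y x]; ring
  have e2 : B x y = ‖a‖ * ‖b‖ * B a b := by
    simp only [x, y, map_smul, smul_apply, smul_eq_mul]; ring
  have par : ‖x + y‖ ^ 2 + ‖x - y‖ ^ 2 = 2 * (‖x‖ ^ 2 + ‖y‖ ^ 2) := by
    have := parallelogram_law_with_norm ℝ x y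
    nlinarith
  have b1 := h (x + y)
  have b2 := h (x - y)
  have : |4 * B x y| ≤ M * (4 * (‖a‖ * ‖b‖) ^ 2) := by
    rw [e]
    refine (abs_sub _ _).trans ((add_le_add b1 b2).trans (le_of_eq ?_))
    rw [← mul_add, par, nx, ny]; ring
  rw [e2, abs_mul, abs_mul, abs_of_nonneg (by positivity : 0 ≤ ‖a‖ * ‖b‖)] at this
  norm_num at this
  rw [Real.norm_eq_abs]
  have pab : 0 < ‖a‖ * ‖b‖ := by positivity
  have h2 : (‖a‖ * ‖b‖) * |B a b| ≤ (‖a‖ * ‖b‖) * (M * ‖a‖ * ‖b‖) := by nlinarith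
  exact le_of_mul_le_mul_left h2 pab

lemma ball_sub {z : ℂ} (hz : z ∈ DB) {δ : ℝ} (h0 : 0 ≤ δ) (h1 : δ ≤ 1) : closedBall ((1 - δ) • z) δ ⊆ DB := by
  intro w hw
  rw [mem_closedBall_zero_iff] at *
  rw [mem_closedBall, dist_eq_norm] at hw
  have : w = (w - (1 - δ) • z) + (1 - δ) • z := by ring
  rw [this]
  refine (norm_add_le _ _).trans ?_
  rw [norm_smul, Real.norm_eq_abs, abs_of_nonneg (by linarith)]
  nlinarith

lemma VD.interp (h : VD v p Q) (hN : HolD Q N) (hN0 : 0 ≤ N) (hV : ∀ z ∈ DB, |v z| ≤ V) {δ : ℝ} (hδ : 0 < δ) (hδ1 : δ ≤ 1) :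
    ∀ z ∈ DB, ‖Q z‖ ≤ 4 * V / δ ^ 2 + 3 * (N * √δ) := by
  intro z hz
  have hV0 : 0 ≤ V := (abs_nonneg _).trans (hV z hz)
  set y := (1 - δ) • z with hy
  have hb := ball_sub hz hδ.le hδ1
  rw [← hy] at hb
  have yD : y ∈ DB := hb (mem_closedBall_self hδ.le)
  have q1 : ‖Q y‖ ≤ 4 * V / δ ^ 2 + 2 * (N * √δ) := by
    refine bil_polar (h.sym y yD) (by positivity) ?_
    intro a
    by_cases ha : a = 0
    · simp [ha]
    have na : 0 < ‖a‖ := norm_pos_iff.2 ha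
    set k := (δ / ‖a‖) • a with hk
    have nk : ‖k‖ = δ := by
      rw [hk, norm_smul, Real.norm_eq_abs, abs_of_pos (by positivity)]; field_simp
    have s := h.second hN hN0 (y := y) (k := k) (by rw [nk]; exact hb)
    rw [nk] at s
    have m1 := hV (y + k) (hb (by simp [nk]))
    have m2 := hV (y - k) (hb (by simp [nk]))
    have m3 := hV y yD
    have ek : Q y k k = (δ / ‖a‖) ^ 2 * Q y a a := by
      simp only [hk, map_smul, smul_apply, smul_eq_mul]; ring
    have : |Q y k k| ≤ 4 * V + 2 * (N * √δ * δ ^ 2) := by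
      rw [abs_le] at *
      constructor <;> linarith [s.1, s.2, m1.1, m1.2, m2.1, m2.2, m3.1, m3.2]
    rw [ek, abs_mul, abs_of_nonneg (by positivity : 0 ≤ (δ / ‖a‖) ^ 2)] at this
    calc |Q y a a| = (‖a‖ / δ) ^ 2 * ((δ / ‖a‖) ^ 2 * |Q y a a|) := by field_simp
      _ ≤ (‖a‖ / δ) ^ 2 * (4 * V + 2 * (N * √δ * δ ^ 2)) := by gcongr
      _ = _ := by field_simp
  have q2 : ‖Q z - Q y‖ ≤ N * √δ := by
    refine (hN z hz y yD).trans ?_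
    gcongr
    rw [hy, show z - (1 - δ) • z = δ • z by simp [sub_smul, sub_mul], norm_smul, Real.norm_eq_abs, abs_of_pos hδ]
    rw [mem_closedBall_zero_iff] at hz
    nlinarith
  have : ‖Q z‖ ≤ ‖Q z - Q y‖ + ‖Q y‖ := by
    have := norm_add_le (Q z - Q y) (Q y)
    rwa [sub_add_cancel] at this
  linarith

lemma VD.interp1 (h : VD v p Q) (hS : ∀ z ∈ DB, ‖Q z‖ ≤ S) (hV : ∀ z ∈ DB, |v z| ≤ V) :
    ∀ z ∈ DB, ‖p z‖ ≤ 2 * V + 2 * S := by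
  have h0D : (0 : ℂ) ∈ DB := by simp
  have hS0 : 0 ≤ S := (norm_nonneg _).trans (hS 0 h0D)
  have hV0 : 0 ≤ V := (abs_nonneg _).trans (hV 0 h0D)
  have lip : ∀ z ∈ DB, ‖p z - p 0‖ ≤ S := by
    intro z hz
    have := Convex.norm_image_sub_le_of_norm_hasFDerivWithin_le (s := DB) h.dp hS (convex_closedBall 0 1) h0D hz
    refine this.trans ?_
    rw [mem_closedBall_zero_iff] at hz
    rw [sub_zero]; nlinarith
  have p0 : ‖p 0‖ ≤ 2 * V + S := by
    refine ContinuousLinearMap.opNorm_le_of_unit_norm (by positivity) ?_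
    intro a ha
    have aD : a ∈ DB := by rw [mem_closedBall_zero_iff, ha]
    have := Convex.norm_image_sub_le_of_norm_hasFDerivWithin_le (s := DB) (f := fun x => v x - p 0 x) (f' := fun x => p x - p 0) (C := S)
      (fun x hx => (h.dv x hx).sub (p 0).hasFDerivWithinAt) lip (convex_closedBall 0 1) h0D aD
    simp only [sub_zero, map_zero, ha, mul_one, Real.norm_eq_abs] at this
    have m1 := hV a aD
    have m2 := hV 0 h0D
    rw [Real.norm_eq_abs]
    rw [abs_le] at *
    constructor <;> linarith [this.1, this.2, m1.1, m1.2, m2.1, m2.2]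
  intro z hz
  have : ‖p z‖ ≤ ‖p z - p 0‖ + ‖p 0‖ := by
    have := norm_add_le (p z - p 0) (p 0)
    rwa [sub_add_cancel] at this
  linarith [lip z hz]

end MC

/-! part 13 -/

namespace MC
open MeasureTheory

variable {v : ℂ → ℝ} {p : ℂ → Lin} {Q : ℂ → Bil} {ℓ : ℂ → Cof} {lam Lam A N S F V : ℝ}

lemma VD.contv (h : VD v p Q) : ContinuousOn v DB := fun z hz => (h.dv z hz).continuousWithinAt

lemma VD.max_le (h : VD v p Q) (hN : HolD Q N) (hN0 : 0 ≤ N) (hlam : 0 < lam) (hell : ∀ z ∈ DB, Ell lam Lam (ℓ z))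
    (hF : ∀ z ∈ DB, -F ≤ ℓ z (Q z)) {K : ℝ} (hK : F < 4 * lam * K) (hK0 : 0 ≤ K) : ∀ z ∈ DB, v z ≤ K := by
  have cont : ContinuousOn (fun z : ℂ => v z + K * ‖z‖ ^ 2) DB :=
    h.contv.add (by fun_prop)
  obtain ⟨z0, hz0, hmax⟩ := (isCompact_closedBall (0 : ℂ) 1).exists_isMaxOn ⟨0, by simp⟩ cont
  have hmax' : ∀ z ∈ DB, v z + K * ‖z‖ ^ 2 ≤ v z0 + K * ‖z0‖ ^ 2 := fun z hz => hmax hz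
  have hz01 : ‖z0‖ ≤ 1 := mem_closedBall_zero_iff.1 hz0
  have bdry : ‖z0‖ = 1 := by
    by_contra hne
    have hlt : ‖z0‖ < 1 := lt_of_le_of_ne hz01 hne
    -- second derivative test
    have test : ∀ a : ℂ, Q z0 a a ≤ - 2 * K * ‖a‖ ^ 2 := by
      intro a
      by_cases ha : a = 0
      · simp [ha]
      have na : 0 < ‖a‖ := norm_pos_iff.2 ha
      have key : ∀ t : ℝ, 0 < t → t * ‖a‖ ≤ 1 - ‖z0‖ → Q z0 a a + 2 * K * ‖a‖ ^ 2 ≤ 2 * (N * √(t * ‖a‖) * ‖a‖ ^ 2) := by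
        intro t ht hta
        set k := t • a with hk
        have nk : ‖k‖ = t * ‖a‖ := by rw [hk, norm_smul, Real.norm_eq_abs, abs_of_pos ht]
        have hb : closedBall z0 ‖k‖ ⊆ DB := by
          intro w hw
          rw [mem_closedBall, dist_eq_norm, nk] at hw
          rw [mem_closedBall_zero_iff]
          have := norm_add_le (w - z0) z0
          rw [sub_add_cancel] at this
          linarith
        have s := h.second hN hN0 hb
        have m1 := hmax' (z0 + k) (hb (by simp))
        have m2 := hmax' (z0 - k) (hb (by simp))
        have par : ‖z0 + k‖ ^ 2 + ‖z0 - k‖ ^ 2 = 2 * (‖z0‖ ^ 2 + ‖k‖ ^ 2) := by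
          have := parallelogram_law_with_norm ℝ z0 k
          nlinarith
        have e : Q z0 k k = t ^ 2 * Q z0 a a := by
          simp only [hk, map_smul, smul_apply, smul_eq_mul]; ring
        rw [abs_le] at s
        have s1 := s.1
        have m3 : v (z0 + k) + v (z0 - k) - 2 * v z0 + 2 * K * ‖k‖ ^ 2 ≤ 0 := by
          have : K * (‖z0 + k‖ ^ 2 + ‖z0 - k‖ ^ 2) = K * (2 * (‖z0‖ ^ 2 + ‖k‖ ^ 2)) := by rw [par]
          linarith
        have m4 : t ^ 2 * (Q z0 a a + 2 * K * ‖a‖ ^ 2) ≤ t ^ 2 * (2 * (N * √(t * ‖a‖) * ‖a‖ ^ 2)) := by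
          rw [e, nk] at *
          have s2 := s.2
          nlinarith
        exact le_of_mul_le_mul_left m4 (by positivity)
      have lim : Filter.Tendsto (fun t : ℝ => 2 * (N * √(t * ‖a‖) * ‖a‖ ^ 2)) (nhdsWithin 0 (Ioi 0)) (nhds 0) := by
        have c : Continuous (fun t : ℝ => 2 * (N * √(t * ‖a‖) * ‖a‖ ^ 2)) := by fun_prop
        have := (c.tendsto 0).mono_left (nhdsWithin_le_nhds (s := Ioi 0))
        simpa using this
      have ev : ∀ᶠ t : ℝ in nhdsWithin 0 (Ioi 0), Q z0 a a + 2 * K * ‖a‖ ^ 2 ≤ 2 * (N * √(t * ‖a‖) * ‖a‖ ^ 2) := by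
        have hpos : 0 < (1 - ‖z0‖) / ‖a‖ := div_pos (by linarith) na
        filter_upwards [Ioo_mem_nhdsGT hpos] with t ht
        refine key t ht.1 ?_
        have := ht.2.le
        rwa [le_div_iff₀ na] at this
      have := ge_of_tendsto lim ev
      linarith
    obtain ⟨P, q, s, hP, hs, -, -, -, hd⟩ := ell_decomp hlam (hell z0 hz0) (norm_one (α := ℂ))
    have hq := hd (Q z0) (h.sym z0 hz0)
    have t1 := test (P * 1)
    have t2 := test ((q + s * Complex.I) * 1)
    have sl : 0 < √lam := Real.sqrt_pos.2 hlam
    have n1 : lam ≤ ‖(P * 1 : ℂ)‖ ^ 2 := by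
      rw [mul_one, Complex.norm_real, Real.norm_eq_abs, sq_abs]
      have := Real.sq_sqrt hlam.le
      nlinarith
    have n2 : lam ≤ ‖((q + s * Complex.I) * 1 : ℂ)‖ ^ 2 := by
      rw [mul_one, Complex.sq_norm, Complex.normSq_add_mul_I]
      have := Real.sq_sqrt hlam.le
      nlinarith [sq_nonneg q]
    have := hF z0 hz0
    have k1 := mul_le_mul_of_nonneg_left n1 hK0
    have k2 := mul_le_mul_of_nonneg_left n2 hK0
    rw [hq] at this
    linarith
  intro z hz
  have := hmax' z hz
  rw [h.v0 z0 bdry, bdry] at this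
  have : 0 ≤ K * ‖z‖ ^ 2 := by positivity
  linarith

lemma VD.neg (h : VD v p Q) : VD (fun z => - v z) (fun z => - p z) (fun z => - Q z) := by
  refine ⟨fun z hz => (h.dv z hz).fun_neg, fun z hz => (h.dp z hz).fun_neg, fun z hz a b => ?_, fun z hz => ?_⟩
  · simp only [neg_apply]; rw [h.sym z hz]
  · rw [h.v0 z hz, neg_zero]

lemma HolD.neg (h : HolD Q N) : HolD (fun z => - Q z) N := by
  intro z hz w hw
  have e : - Q z - - Q w = - (Q z - Q w) := by abel
  rw [e, norm_neg]
  exact h z hz w hw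

lemma VD.maxp (h : VD v p Q) (hN : HolD Q N) (hN0 : 0 ≤ N) (hlam : 0 < lam) (hell : ∀ z ∈ DB, Ell lam Lam (ℓ z))
    (hF : ∀ z ∈ DB, |ℓ z (Q z)| ≤ F) : ∀ z ∈ DB, |v z| ≤ F / (4 * lam) := by
  intro z hz
  have hF0 : 0 ≤ F := (abs_nonneg _).trans (hF z hz)
  refine le_of_forall_pos_le_add ?_
  intro ε hε
  set K := F / (4 * lam) + ε with hK
  have hK1 : F < 4 * lam * K := by
    rw [hK, mul_add, mul_div_cancel₀ _ (by positivity)]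
    have : 0 < 4 * lam * ε := by positivity
    linarith
  have hK0 : 0 ≤ K := by positivity
  rw [abs_le]
  constructor
  · have := h.neg.max_le hN.neg hN0 hlam hell (F := F) (by
      intro w hw
      have := (abs_le.1 (hF w hw)).2
      rw [map_neg]; linarith) hK1 hK0 z hz
    linarith
  · exact h.max_le hN hN0 hlam hell (fun w hw => (abs_le.1 (hF w hw)).1) hK1 hK0 z hz

lemma iterate_bound {N G a b : ℝ} {P : ℝ → Prop} (h0 : P N) (hstep : ∀ x, P x → P (3 / 4 * x + G)) 
    (hP : ∀ x, P x → a ≤ x * b) : a ≤ 4 * G * b := by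
  have hk : ∀ k : ℕ, P (4 * G + (3 / 4) ^ k * (N - 4 * G)) := by
    intro k
    induction k with
    | zero => convert h0 using 1; ring
    | succ k ih => convert hstep _ ih using 1; ring
  have lim : Filter.Tendsto (fun k : ℕ => (4 * G + (3 / 4 : ℝ) ^ k * (N - 4 * G)) * b) Filter.atTop (nhds (4 * G * b)) := by
    have h1 := tendsto_pow_atTop_nhds_zero_of_lt_one (r := (3 / 4 : ℝ)) (by norm_num) (by norm_num)
    have := ((h1.mul_const (N - 4 * G)).const_add (4 * G)).mul_const b
    simpa using this
  exact ge_of_tendsto' lim fun k => hP _ (hk k)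

lemma apriori (lam Lam A : ℝ) (hlam : 0 < lam) (hLam : lam ≤ Lam) (hA : 0 ≤ A) : ∃ C : ℝ, 0 ≤ C ∧
    ∀ (v : ℂ → ℝ) (p : ℂ → Lin) (Q : ℂ → Bil) (ℓ : ℂ → Cof) (N F : ℝ), VD v p Q → HolD Q N → 0 ≤ N → (∀ z ∈ DB, Ell lam Lam (ℓ z)) →
    (∀ z ∈ DB, ∀ w ∈ DB, ‖ℓ z - ℓ w‖ ≤ A * √‖z - w‖) → (∀ z ∈ DB, |ℓ z (Q z)| ≤ F) →
    (∀ z ∈ DB, ∀ w ∈ DB, |ℓ z (Q z) - ℓ w (Q w)| ≤ F * √‖z - w‖) →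
    HolD Q (C * F) ∧ (∀ z ∈ DB, ‖Q z‖ ≤ C * F) ∧ (∀ z ∈ DB, ‖p z‖ ≤ C * F) ∧ (∀ z ∈ DB, |v z| ≤ C * F) := by
  obtain ⟨C, hC, hloc⟩ := local_est lam Lam A hlam hLam hA
  set δ := min 1 ((1 / (24 * (C + 1))) ^ 2) with hδ
  have δp : 0 < δ := lt_min one_pos (by positivity)
  have δ1 : δ ≤ 1 := min_le_left _ _
  have sδ : √δ ≤ 1 / (24 * (C + 1)) := by
    rw [← Real.sqrt_sq (show 0 ≤ 1 / (24 * (C + 1)) by positivity)]; exact Real.sqrt_le_sqrt (min_le_right _ _)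
  have Cδ : C * √δ ≤ 1 / 24 := by
    calc C * √δ ≤ C * (1 / (24 * (C + 1))) := by gcongr
      _ ≤ 1 / 24 := by rw [mul_one_div, div_le_div_iff₀ (by positivity) (by norm_num)]; linarith
  set c0 := 1 / (4 * lam) with hc0
  set g := C * (1 + 2 * c0 + 8 * c0 / δ ^ 2) with hg
  set s := 4 * c0 / δ ^ 2 + 3 * (4 * g) with hs
  have c00 : 0 ≤ c0 := by positivity
  have g0 : 0 ≤ g := by positivity
  have s0 : 0 ≤ s := by positivity
  refine ⟨4 * g + 2 * s + 2 * c0, by positivity, ?_⟩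
  intro v p Q ℓ N F h hN hN0 hell hl hF hFh
  have hF0 : 0 ≤ F := (abs_nonneg _).trans (hF 0 (by simp))
  have hV : ∀ z ∈ DB, |v z| ≤ c0 * F := by
    intro z hz
    refine (h.maxp hN hN0 hlam hell hF z hz).trans (le_of_eq ?_)
    rw [hc0]; ring
  have hV0 : 0 ≤ c0 * F := by positivity
  have H4 : HolD Q (4 * (g * F)) := by
    intro z hz w hw
    refine iterate_bound (N := N) (P := fun x => 0 ≤ x ∧ HolD Q x) ⟨hN0, hN⟩ ?_ (fun x hx => hx.2 z hz w hw)
    rintro x ⟨hx0, hx⟩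
    have gF : 0 ≤ g * F := by positivity
    refine ⟨by positivity, ?_⟩
    have i0 := h.interp hx hx0 hV δp δ1
    have i1 := h.interp1 i0 hV
    set S0 := 4 * (c0 * F) / δ ^ 2 + 3 * (x * √δ) with hS0
    have S00 : 0 ≤ S0 := by positivity
    intro z hz w hw
    refine (hloc p Q ℓ x (2 * (c0 * F) + 2 * S0) F ⟨h.toDP hx, hell, hl, hx, fun z hz => (i0 z hz).trans (by linarith), i1, hFh, hA, hx0, by positivity, hF0⟩ z hz w hw).trans ?_
    refine mul_le_mul_of_nonneg_right ?_ (Real.sqrt_nonneg _)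
    have : C * (F + (2 * (c0 * F) + 2 * S0)) = g * F + 6 * x * (C * √δ) := by rw [hS0, hg]; ring
    rw [this]
    nlinarith
  have i0 := h.interp H4 (by positivity) hV δp δ1
  have S1 : ∀ z ∈ DB, ‖Q z‖ ≤ s * F := by
    intro z hz
    refine (i0 z hz).trans ?_
    have : √δ ≤ 1 := Real.sqrt_le_iff.2 ⟨by norm_num, by linarith⟩
    calc _ ≤ 4 * (c0 * F) / δ ^ 2 + 3 * (4 * (g * F) * 1) := by gcongr
      _ = _ := by rw [hs]; ring
  have S2 := h.interp1 S1 hV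
  have gF : 0 ≤ g * F := by positivity
  have sF : 0 ≤ s * F := by positivity
  refine ⟨?_, ?_, ?_, ?_⟩
  · intro z hz w hw
    refine (H4 z hz w hw).trans (mul_le_mul_of_nonneg_right ?_ (Real.sqrt_nonneg _))
    linarith
  · intro z hz; linarith [S1 z hz]
  · intro z hz; linarith [S2 z hz]
  · intro z hz; linarith [hV z hz]

end MC

/-! part 14 -/

namespace MC
open MeasureTheory

lemma fderiv_limit {E G : Type*} [NormedAddCommGroup E] [NormedSpace ℝ E] [NormedAddCommGroup G] [NormedSpace ℝ G]
    {s : Set E} (hs : Convex ℝ s) {f : ℕ → E → G} {f' : ℕ → E → E →L[ℝ] G} {g : E → G} {g' : E → E →L[ℝ] G}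
    {e : ℕ → ℝ} (he : Filter.Tendsto e Filter.atTop (nhds 0))
    (hd : ∀ k, ∀ z ∈ s, HasFDerivWithinAt (f k) (f' k z) s z)
    (hc : ∀ k n m, k ≤ n → k ≤ m → ∀ z ∈ s, ‖f' n z - f' m z‖ ≤ e k)
    (hl : ∀ z ∈ s, Filter.Tendsto (fun k => f k z) Filter.atTop (nhds (g z)))
    (hl' : ∀ z ∈ s, Filter.Tendsto (fun k => f' k z) Filter.atTop (nhds (g' z))) :
    ∀ z ∈ s, HasFDerivWithinAt g (g' z) s z := by
  intro z hz
  have b1 : ∀ k, ∀ x ∈ s, ‖f' k x - g' x‖ ≤ e k := by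
    intro k x hx
    have t : Filter.Tendsto (fun m => ‖f' k x - f' m x‖) Filter.atTop (nhds ‖f' k x - g' x‖) :=
      ((hl' x hx).const_sub _).norm
    refine le_of_tendsto t ?_
    filter_upwards [Filter.eventually_ge_atTop k] with m hm
    exact hc k k m le_rfl hm x hx
  have b2 : ∀ k, ∀ w ∈ s, ‖(f k w - g w) - (f k z - g z)‖ ≤ e k * ‖w - z‖ := by
    intro k w hw
    have t : Filter.Tendsto (fun m => ‖(f k w - f m w) - (f k z - f m z)‖) Filter.atTop (nhds ‖(f k w - g w) - (f k z - g z)‖) :=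
      (((hl w hw).const_sub _).sub ((hl z hz).const_sub _)).norm
    refine le_of_tendsto t ?_
    filter_upwards [Filter.eventually_ge_atTop k] with m hm
    exact Convex.norm_image_sub_le_of_norm_hasFDerivWithin_le (f := fun x => f k x - f m x)
      (fun x hx => (hd k x hx).sub (hd m x hx)) (fun x hx => hc k k m le_rfl hm x hx) hs hz hw
  rw [hasFDerivWithinAt_iff_isLittleO, Asymptotics.isLittleO_iff]
  intro c hc0
  obtain ⟨k, hk⟩ := (he.eventually (gt_mem_nhds (show (0 : ℝ) < c / 3 by positivity))).exists
  have := (hasFDerivWithinAt_iff_isLittleO.1 (hd k z hz))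
  rw [Asymptotics.isLittleO_iff] at this
  filter_upwards [this (show 0 < c / 3 by positivity), self_mem_nhdsWithin] with w hw hws
  have e1 : g w - g z - g' z (w - z) = (f k w - f k z - f' k z (w - z)) - ((f k w - g w) - (f k z - g z)) + (f' k z - g' z) (w - z) := by
    rw [ContinuousLinearMap.sub_apply]; abel
  rw [e1]
  have h3 := (f' k z - g' z).le_opNorm (w - z)
  have h4 : ‖(f' k z - g' z) (w - z)‖ ≤ c / 3 * ‖w - z‖ := h3.trans (by gcongr; exact (b1 k z hz).trans hk.le)
  have h5 : ‖(f k w - g w) - (f k z - g z)‖ ≤ c / 3 * ‖w - z‖ := (b2 k w hws).trans (by gcongr)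
  refine (norm_add_le _ _).trans ((add_le_add (norm_sub_le _ _) le_rfl).trans ?_)
  linarith

structure Tr where
  v : ℂ → ℝ
  p : ℂ → Lin
  Q : ℂ → Bil

def Tr.sub (T U : Tr) : Tr := ⟨fun z => T.v z - U.v z, fun z => T.p z - U.p z, fun z => T.Q z - U.Q z⟩
def Tr.zero : Tr := ⟨fun _ => 0, fun _ => 0, fun _ => 0⟩

/-- size at most M -/
structure Xn (T : Tr) (M : ℝ) : Prop where
  hv : ∀ z ∈ DB, |T.v z| ≤ M
  hp : ∀ z ∈ DB, ‖T.p z‖ ≤ M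
  hQ : ∀ z ∈ DB, ‖T.Q z‖ ≤ M
  hol : HolD T.Q M

structure Yb (f : ℂ → ℝ) (M : ℝ) : Prop where
  b : ∀ z ∈ DB, |f z| ≤ M
  hol : ∀ z ∈ DB, ∀ w ∈ DB, |f z - f w| ≤ M * √‖z - w‖

structure Good (T : Tr) : Prop where
  vd : VD T.v T.p T.Q
  hol : ∃ N, 0 ≤ N ∧ HolD T.Q N

lemma zero_mem_DB : (0 : ℂ) ∈ DB := by simp

lemma Xn.nonneg {T : Tr} {M : ℝ} (h : Xn T M) : 0 ≤ M := (abs_nonneg _).trans (h.hv 0 zero_mem_DB)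
lemma Yb.nonneg {f : ℂ → ℝ} {M : ℝ} (h : Yb f M) : 0 ≤ M := (abs_nonneg _).trans (h.b 0 zero_mem_DB)

lemma Xn.mono {T : Tr} {M M' : ℝ} (h : Xn T M) (hM : M ≤ M') : Xn T M' :=
  ⟨fun z hz => (h.hv z hz).trans hM, fun z hz => (h.hp z hz).trans hM, fun z hz => (h.hQ z hz).trans hM,
    fun z hz w hw => (h.hol z hz w hw).trans (by gcongr)⟩

lemma Yb.mono {f : ℂ → ℝ} {M M' : ℝ} (h : Yb f M) (hM : M ≤ M') : Yb f M' :=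
  ⟨fun z hz => (h.b z hz).trans hM, fun z hz w hw => (h.hol z hz w hw).trans (by gcongr)⟩

lemma Yb.add {f g : ℂ → ℝ} {M M' : ℝ} (h : Yb f M) (h' : Yb g M') : Yb (fun z => f z + g z) (M + M') := by
  refine ⟨fun z hz => (abs_add_le _ _).trans (add_le_add (h.b z hz) (h'.b z hz)), fun z hz w hw => ?_⟩
  rw [show f z + g z - (f w + g w) = (f z - f w) + (g z - g w) by ring, add_mul]
  exact (abs_add_le _ _).trans (add_le_add (h.hol z hz w hw) (h'.hol z hz w hw))

lemma Xn.zero {M : ℝ} (h : 0 ≤ M) : Xn Tr.zero M := by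
  refine ⟨fun z _ => ?_, fun z _ => ?_, fun z _ => ?_, fun z _ w _ => ?_⟩
  · simpa [Tr.zero] using h
  · simpa [Tr.zero] using h
  · change ‖(0 : Bil)‖ ≤ M
    rw [norm_zero]; exact h
  · change ‖(0 : Bil) - 0‖ ≤ _
    rw [sub_zero, norm_zero]; positivity

lemma Good.zero : Good Tr.zero := by
  refine ⟨⟨fun z _ => hasFDerivWithinAt_const _ _ _, fun z _ => hasFDerivWithinAt_const _ _ _, fun z _ a b => rfl, fun z _ => rfl⟩, 0, le_rfl, ?_⟩
  exact (Xn.zero le_rfl).hol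

lemma Good.sub {T U : Tr} (h : Good T) (h' : Good U) : Good (T.sub U) := by
  obtain ⟨N, hN0, hN⟩ := h.hol
  obtain ⟨N', hN0', hN'⟩ := h'.hol
  refine ⟨⟨fun z hz => (h.vd.dv z hz).sub (h'.vd.dv z hz), fun z hz => (h.vd.dp z hz).sub (h'.vd.dp z hz), fun z hz a b => ?_, fun z hz => ?_⟩, N + N', by positivity, ?_⟩
  · change T.Q z a b - U.Q z a b = T.Q z b a - U.Q z b a
    rw [h.vd.sym z hz, h'.vd.sym z hz]
  · change T.v z - U.v z = 0
    rw [h.vd.v0 z hz, h'.vd.v0 z hz, sub_zero]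
  · intro z hz w hw
    change ‖(T.Q z - U.Q z) - (T.Q w - U.Q w)‖ ≤ _
    have e : (T.Q z - U.Q z) - (T.Q w - U.Q w) = (T.Q z - T.Q w) - (U.Q z - U.Q w) := by abel
    rw [e, add_mul]
    exact (norm_sub_le _ _).trans (add_le_add (hN z hz w hw) (hN' z hz w hw))

lemma Xn.add_sub {T U W : Tr} {M M' : ℝ} (h : Xn (T.sub U) M) (h' : Xn (U.sub W) M') : Xn (T.sub W) (M + M') := by
  refine ⟨fun z hz => ?_, fun z hz => ?_, fun z hz => ?_, fun z hz w hw => ?_⟩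
  · have e : T.v z - W.v z = (T.v z - U.v z) + (U.v z - W.v z) := by ring
    change |T.v z - W.v z| ≤ _
    rw [e]
    exact (abs_add_le _ _).trans (add_le_add (h.hv z hz) (h'.hv z hz))
  · have e : T.p z - W.p z = (T.p z - U.p z) + (U.p z - W.p z) := by abel
    change ‖T.p z - W.p z‖ ≤ _
    rw [e]
    exact (norm_add_le _ _).trans (add_le_add (h.hp z hz) (h'.hp z hz))
  · have e : T.Q z - W.Q z = (T.Q z - U.Q z) + (U.Q z - W.Q z) := by abel
    change ‖T.Q z - W.Q z‖ ≤ _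
    rw [e]
    exact (norm_add_le _ _).trans (add_le_add (h.hQ z hz) (h'.hQ z hz))
  · have e : (T.Q z - W.Q z) - (T.Q w - W.Q w) = ((T.Q z - U.Q z) - (T.Q w - U.Q w)) + ((U.Q z - W.Q z) - (U.Q w - W.Q w)) := by abel
    change ‖(T.Q z - W.Q z) - (T.Q w - W.Q w)‖ ≤ _
    rw [e, add_mul]
    exact (norm_add_le _ _).trans (add_le_add (h.hol z hz w hw) (h'.hol z hz w hw))

lemma Xn.symm {T U : Tr} {M : ℝ} (h : Xn (T.sub U) M) : Xn (U.sub T) M := by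
  refine ⟨fun z hz => ?_, fun z hz => ?_, fun z hz => ?_, fun z hz w hw => ?_⟩
  · change |U.v z - T.v z| ≤ _
    rw [abs_sub_comm]; exact h.hv z hz
  · change ‖U.p z - T.p z‖ ≤ _
    rw [norm_sub_rev]; exact h.hp z hz
  · change ‖U.Q z - T.Q z‖ ≤ _
    rw [norm_sub_rev]; exact h.hQ z hz
  · have e : (U.Q z - T.Q z) - (U.Q w - T.Q w) = (T.Q w - U.Q w) - (T.Q z - U.Q z) := by abel
    change ‖(U.Q z - T.Q z) - (U.Q w - T.Q w)‖ ≤ _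
    rw [e, norm_sub_rev]; exact h.hol z hz w hw

lemma Xn.sub_zero {T : Tr} {M : ℝ} (h : Xn T M) : Xn (T.sub Tr.zero) M := by
  have e : T.sub Tr.zero = T := by
    cases T
    simp only [Tr.sub, Tr.zero, _root_.sub_zero]
  rw [e]; exact h

lemma limit_tr (T : ℕ → Tr) (hG : ∀ k, VD (T k).v (T k).p (T k).Q) {N : ℝ} (hN : ∀ k, HolD (T k).Q N) {e : ℕ → ℝ}
    (he : Filter.Tendsto e Filter.atTop (nhds 0))
    (hv : ∀ k n m, k ≤ n → k ≤ m → ∀ z ∈ DB, |(T n).v z - (T m).v z| ≤ e k)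
    (hp : ∀ k n m, k ≤ n → k ≤ m → ∀ z ∈ DB, ‖(T n).p z - (T m).p z‖ ≤ e k)
    (hQ : ∀ k n m, k ≤ n → k ≤ m → ∀ z ∈ DB, ‖(T n).Q z - (T m).Q z‖ ≤ e k) :
    ∃ U : Tr, VD U.v U.p U.Q ∧ HolD U.Q N ∧
      (∀ z ∈ DB, Filter.Tendsto (fun k => (T k).v z) Filter.atTop (nhds (U.v z))) ∧
      (∀ z ∈ DB, Filter.Tendsto (fun k => (T k).p z) Filter.atTop (nhds (U.p z))) ∧
      (∀ z ∈ DB, Filter.Tendsto (fun k => (T k).Q z) Filter.atTop (nhds (U.Q z))) := by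
  have lv : ∀ z : ℂ, ∃ x : ℝ, z ∈ DB → Filter.Tendsto (fun k => (T k).v z) Filter.atTop (nhds x) := by
    intro z
    by_cases hz : z ∈ DB
    · obtain ⟨x, hx⟩ := cauchySeq_tendsto_of_complete (cauchySeq_of_le_tendsto_0 e
        (fun n m k hn hm => by rw [Real.dist_eq]; exact hv k n m hn hm z hz) he)
      exact ⟨x, fun _ => hx⟩
    · exact ⟨0, fun h => absurd h hz⟩
  have lp : ∀ z : ℂ, ∃ x : Lin, z ∈ DB → Filter.Tendsto (fun k => (T k).p z) Filter.atTop (nhds x) := by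
    intro z
    by_cases hz : z ∈ DB
    · obtain ⟨x, hx⟩ := cauchySeq_tendsto_of_complete (cauchySeq_of_le_tendsto_0 (s := fun k => (T k).p z) e
        (fun n m k hn hm => by rw [dist_eq_norm]; exact hp k n m hn hm z hz) he)
      exact ⟨x, fun _ => hx⟩
    · exact ⟨0, fun h => absurd h hz⟩
  have lQ : ∀ z : ℂ, ∃ x : Bil, z ∈ DB → Filter.Tendsto (fun k => (T k).Q z) Filter.atTop (nhds x) := by
    intro z
    by_cases hz : z ∈ DB
    · obtain ⟨x, hx⟩ := cauchySeq_tendsto_of_complete (cauchySeq_of_le_tendsto_0 (s := fun k => (T k).Q z) e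
        (fun n m k hn hm => by rw [dist_eq_norm]; exact hQ k n m hn hm z hz) he)
      exact ⟨x, fun _ => hx⟩
    · exact ⟨0, fun h => absurd h hz⟩
  choose v hv' using lv
  choose p hp' using lp
  choose Q hQ' using lQ
  refine ⟨⟨v, p, Q⟩, ⟨?_, ?_, ?_, ?_⟩, ?_, fun z hz => hv' z hz, fun z hz => hp' z hz, fun z hz => hQ' z hz⟩
  · exact fderiv_limit (convex_closedBall 0 1) he (fun k => (hG k).dv) hp (fun z hz => hv' z hz) (fun z hz => hp' z hz)
  · exact fderiv_limit (convex_closedBall 0 1) he (fun k => (hG k).dp) hQ (fun z hz => hp' z hz) (fun z hz => hQ' z hz)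
  · intro z hz a b
    have c : ∀ a b : ℂ, Filter.Tendsto (fun k => (T k).Q z a b) Filter.atTop (nhds (Q z a b)) := by
      intro a b
      have cc : Continuous (fun B : Bil => B a b) := by fun_prop
      exact (cc.tendsto _).comp (hQ' z hz)
    refine tendsto_nhds_unique (c a b) ((c b a).congr fun k => ?_)
    exact ((hG k).sym z hz a b).symm
  · intro z hz
    have zD : z ∈ DB := by rw [mem_closedBall_zero_iff, hz]
    refine tendsto_nhds_unique (hv' z zD) ?_
    simp only [(hG _).v0 z hz]
    exact tendsto_const_nhds
  · intro z hz w hw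
    exact le_of_tendsto ((hQ' z hz).sub (hQ' w hw)).norm (Filter.Eventually.of_forall fun k => hN k z hz w hw)

end MC

/-! part 15 -/

namespace MC
open MeasureTheory

/-- a priori estimate with constant C -/
def AE (ℓ : ℂ → Cof) (C : ℝ) : Prop := ∀ T F, Good T → Yb (fun z => ℓ z (T.Q z)) F → Xn T (C * F)
/-- solvability -/
def Solv (ℓ : ℂ → Cof) : Prop := ∀ f M, Yb f M → ∃ T, Good T ∧ ∀ z ∈ DB, ℓ z (T.Q z) = f z

structure Adm (lam Lam A : ℝ) (ℓ : ℂ → Cof) : Prop where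
  ell : ∀ z ∈ DB, Ell lam Lam (ℓ z)
  hol : ∀ z ∈ DB, ∀ w ∈ DB, ‖ℓ z - ℓ w‖ ≤ A * √‖z - w‖

lemma apriori' (lam Lam A : ℝ) (hlam : 0 < lam) (hLam : lam ≤ Lam) (hA : 0 ≤ A) : ∃ C : ℝ, 0 ≤ C ∧
    ∀ ℓ : ℂ → Cof, Adm lam Lam A ℓ → AE ℓ C := by
  obtain ⟨C, hC, h⟩ := apriori lam Lam A hlam hLam hA
  refine ⟨C, hC, fun ℓ hℓ T F hT hF => ?_⟩
  obtain ⟨N, hN0, hN⟩ := hT.hol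
  obtain ⟨h1, h2, h3, h4⟩ := h T.v T.p T.Q ℓ N F hT.vd hN hN0 hℓ.ell hℓ.hol hF.b hF.hol
  exact ⟨h4, h3, h2, h1⟩

lemma Yb.congr {f g : ℂ → ℝ} {M : ℝ} (h : Yb f M) (e : ∀ z ∈ DB, g z = f z) : Yb g M := by
  refine ⟨fun z hz => ?_, fun z hz w hw => ?_⟩
  · rw [e z hz]; exact h.b z hz
  · rw [e z hz, e w hw]; exact h.hol z hz w hw

lemma Xn.lim {T : ℕ → Tr} {U W : Tr} {M : ℝ} (h : ∀ᶠ j in Filter.atTop, Xn ((T j).sub W) M)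
    (hv : ∀ z ∈ DB, Filter.Tendsto (fun k => (T k).v z) Filter.atTop (nhds (U.v z)))
    (hp : ∀ z ∈ DB, Filter.Tendsto (fun k => (T k).p z) Filter.atTop (nhds (U.p z)))
    (hQ : ∀ z ∈ DB, Filter.Tendsto (fun k => (T k).Q z) Filter.atTop (nhds (U.Q z))) : Xn (U.sub W) M := by
  refine ⟨fun z hz => ?_, fun z hz => ?_, fun z hz => ?_, fun z hz w hw => ?_⟩
  · exact le_of_tendsto ((hv z hz).sub_const _).abs (h.mono fun j hj => hj.hv z hz)
  · exact le_of_tendsto ((hp z hz).sub_const _).norm (h.mono fun j hj => hj.hp z hz)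
  · exact le_of_tendsto ((hQ z hz).sub_const _).norm (h.mono fun j hj => hj.hQ z hz)
  · exact le_of_tendsto (((hQ z hz).sub_const _).sub ((hQ w hw).sub_const _)).norm (h.mono fun j hj => hj.hol z hz w hw)

lemma Xn.of_sub_zero {T : Tr} {M : ℝ} (h : Xn (T.sub Tr.zero) M) : Xn T M := by
  have e : T.sub Tr.zero = T := by
    cases T
    simp only [Tr.sub, Tr.zero, _root_.sub_zero]
  rw [e] at h; exact h

lemma fixpt {ℓ : ℂ → Cof} {C ρ : ℝ} (hC : 0 ≤ C) (hae : AE ℓ C) (hs : Solv ℓ) (hρ : 0 ≤ ρ) (R : (ℂ → Bil) → ℂ → ℝ)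
    (hR : ∀ T U M, Good T → Good U → Xn T ρ → Xn U ρ → Xn (T.sub U) M → Yb (fun z => R T.Q z - R U.Q z) (M / (2 * (C + 1))))
    (hR0 : Yb (R Tr.zero.Q) (ρ / (2 * (C + 1)))) : ∃ T, Good T ∧ Xn T ρ ∧ ∀ z ∈ DB, ℓ z (T.Q z) = R T.Q z := by
  have step : ∀ T : {T : Tr // Good T ∧ Xn T ρ}, ∃ T' : {T : Tr // Good T ∧ Xn T ρ}, ∀ z ∈ DB, ℓ z (T'.1.Q z) = R T.1.Q z := by
    rintro ⟨T, hT, hX⟩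
    have y := (hR T Tr.zero ρ hT Good.zero hX (Xn.zero hρ) hX.sub_zero).add hR0
    have y2 : Yb (R T.Q) (ρ / (2 * (C + 1)) + ρ / (2 * (C + 1))) := y.congr fun z _ => by ring
    obtain ⟨T', hT', e⟩ := hs _ _ y2
    refine ⟨⟨T', hT', (hae T' _ hT' (y2.congr e)).mono ?_⟩, e⟩
    rw [show C * (ρ / (2 * (C + 1)) + ρ / (2 * (C + 1))) = C / (C + 1) * ρ by field_simp; ring]
    have : C / (C + 1) ≤ 1 := by rw [div_le_one (by positivity)]; linarith
    nlinarith
  choose Φ hΦ using step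
  have contr : ∀ (T U : {T : Tr // Good T ∧ Xn T ρ}) (M : ℝ), Xn (T.1.sub U.1) M → Xn ((Φ T).1.sub (Φ U).1) (M / 2) := by
    intro T U M hM
    have y := hR T.1 U.1 M T.2.1 U.2.1 T.2.2 U.2.2 hM
    have hM0 := hM.nonneg
    refine (hae ((Φ T).1.sub (Φ U).1) _ ((Φ T).2.1.sub (Φ U).2.1) (y.congr fun z hz => ?_)).mono ?_
    · change ℓ z ((Φ T).1.Q z - (Φ U).1.Q z) = _
      rw [cof_sub, hΦ T z hz, hΦ U z hz]
    · rw [show C * (M / (2 * (C + 1))) = C / (C + 1) * (M / 2) by field_simp]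
      have : C / (C + 1) ≤ 1 := by rw [div_le_one (by positivity)]; linarith
      nlinarith
  let T : ℕ → {T : Tr // Good T ∧ Xn T ρ} := fun k => Nat.rec ⟨Tr.zero, Good.zero, Xn.zero hρ⟩ (fun _ t => Φ t) k
  have T0 : (T 0).1 = Tr.zero := rfl
  have TS : ∀ k, T (k + 1) = Φ (T k) := fun k => rfl
  have cau : ∀ k j, Xn ((T (j + k)).1.sub (T k).1) (ρ / 2 ^ k) := by
    intro k
    induction k with
    | zero => intro j; rw [T0]; simpa using (T j).2.2.sub_zero
    | succ k ih =>
      intro j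
      have := contr _ _ _ (ih j)
      rw [← TS, ← TS] at this
      refine this.mono (le_of_eq ?_)
      rw [pow_succ]; field_simp
  have cau2 : ∀ k n, k ≤ n → Xn ((T n).1.sub (T k).1) (ρ / 2 ^ k) := by
    intro k n h
    obtain ⟨j, rfl⟩ := Nat.exists_eq_add_of_le h
    rw [add_comm]; exact cau k j
  have cau3 : ∀ k n m, k ≤ n → k ≤ m → Xn ((T n).1.sub (T m).1) (2 * ρ * (1 / 2) ^ k) := by
    intro k n m h1 h2
    refine ((cau2 k n h1).add_sub (cau2 k m h2).symm).mono (le_of_eq ?_)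
    rw [one_div, inv_pow]; field_simp; ring
  have tz : ∀ c : ℝ, Filter.Tendsto (fun k : ℕ => c * (1 / 2) ^ k) Filter.atTop (nhds 0) := by
    intro c
    have := (tendsto_pow_atTop_nhds_zero_of_lt_one (r := (1 / 2 : ℝ)) (by norm_num) (by norm_num)).const_mul c
    simpa using this
  obtain ⟨U, hU, hUh, l1, l2, l3⟩ := limit_tr (fun k => (T k).1) (fun k => (T k).2.1.vd) (N := ρ) (fun k => (T k).2.2.hol) (tz (2 * ρ))
    (fun k n m h1 h2 z hz => (cau3 k n m h1 h2).hv z hz) (fun k n m h1 h2 z hz => (cau3 k n m h1 h2).hp z hz)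
    (fun k n m h1 h2 z hz => (cau3 k n m h1 h2).hQ z hz)
  have UG : Good U := ⟨hU, ρ, hρ, hUh⟩
  have UT : ∀ k, Xn (U.sub (T k).1) (ρ / 2 ^ k) := fun k =>
    Xn.lim (T := fun k => (T k).1) (by filter_upwards [Filter.eventually_ge_atTop k] with j hj; exact cau2 k j hj) l1 l2 l3
  have UX : Xn U ρ := by
    have := UT 0
    rw [T0] at this
    simpa using this.of_sub_zero
  refine ⟨U, UG, UX, fun z hz => ?_⟩
  have key : ∀ k, ‖(Φ ⟨U, UG, UX⟩).1.Q z - U.Q z‖ ≤ ρ * (1 / 2) ^ k := by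
    intro k
    have a := contr ⟨U, UG, UX⟩ (T k) _ (UT k)
    rw [← TS] at a
    refine ((a.add_sub (UT (k + 1)).symm).hQ z hz).trans (le_of_eq ?_)
    rw [one_div, inv_pow, pow_succ]; field_simp; ring
  have := ge_of_tendsto' (tz ρ) key
  have e0 := sub_eq_zero.1 (norm_le_zero_iff.1 this)
  rw [← hΦ ⟨U, UG, UX⟩ z hz, e0]

end MC

/-! part 16 -/

namespace MC
open MeasureTheory

lemma Yb.smul {f : ℂ → ℝ} {M : ℝ} (h : Yb f M) (c : ℝ) : Yb (fun z => c * f z) (|c| * M) := by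
  refine ⟨fun z hz => ?_, fun z hz w hw => ?_⟩
  · rw [abs_mul]; exact mul_le_mul_of_nonneg_left (h.b z hz) (abs_nonneg _)
  · rw [← mul_sub, abs_mul, mul_assoc]; exact mul_le_mul_of_nonneg_left (h.hol z hz w hw) (abs_nonneg _)

lemma Yb_cof {D : ℂ → Cof} {q : ℂ → Bil} {K A M : ℝ} (hK : ∀ z ∈ DB, ‖D z‖ ≤ K) (hA : ∀ z ∈ DB, ∀ w ∈ DB, ‖D z - D w‖ ≤ A * √‖z - w‖)
    (hA0 : 0 ≤ A) (hM0 : 0 ≤ M)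
    (hq : ∀ z ∈ DB, ‖q z‖ ≤ M) (hqh : HolD q M) : Yb (fun z => D z (q z)) ((K + A) * M) := by
  have hK0 : 0 ≤ K := (by positivity : 0 ≤ ‖D 0‖).trans (hK 0 zero_mem_DB)
  refine ⟨fun z hz => ?_, fun z hz w hw => ?_⟩
  · have h1 := (D z).le_opNorm (q z)
    rw [Real.norm_eq_abs] at h1
    calc |D z (q z)| ≤ ‖D z‖ * ‖q z‖ := h1
      _ ≤ K * M := mul_le_mul (hK z hz) (hq z hz) (by positivity) hK0
      _ ≤ (K + A) * M := by nlinarith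
  · have e : D z (q z) - D w (q w) = D z (q z - q w) + (D z - D w) (q w) := by
      rw [cof_sub, sub_apply]; ring
    have h1 := (D z).le_opNorm (q z - q w)
    have h2 := (D z - D w).le_opNorm (q w)
    rw [Real.norm_eq_abs] at h1 h2
    rw [e]
    have h3 : ‖D z‖ * ‖q z - q w‖ ≤ K * (M * √‖z - w‖) := mul_le_mul (hK z hz) (hqh z hz w hw) (by positivity) hK0
    have h4 : ‖D z - D w‖ * ‖q w‖ ≤ (A * √‖z - w‖) * M := mul_le_mul (hA z hz w hw) (hq w hw) (by positivity) (by positivity)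
    calc |D z (q z - q w) + (D z - D w) (q w)| ≤ |D z (q z - q w)| + |(D z - D w) (q w)| := abs_add_le _ _
      _ ≤ K * (M * √‖z - w‖) + (A * √‖z - w‖) * M := by linarith
      _ = _ := by ring

def trC : Cof := LinearMap.mkContinuous (E := Bil)
  { toFun := fun B => B 1 1 + B Complex.I Complex.I
    map_add' := fun B C => by simp only [add_apply]; ring
    map_smul' := fun c B => by simp only [smul_apply, smul_eq_mul, RingHom.id_apply]; ring } 2 (by
  intro B
  have h1 := B.le_opNorm₂ 1 1
  have h2 := B.le_opNorm₂ Complex.I Complex.I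
  simp only [norm_one, mul_one, Complex.norm_I] at h1 h2
  refine (norm_add_le _ _).trans ?_
  linarith)

lemma trC_apply (B : Bil) : trC B = B 1 1 + B Complex.I Complex.I := rfl

lemma trC_ten (η : ℂ) : trC (ten η η) = ‖η‖ ^ 2 := by
  rw [trC_apply, ten_apply, ten_apply, Complex.sq_norm, Complex.normSq_apply]; simp

def ls (ℓ : ℂ → Cof) (s : ℝ) : ℂ → Cof := fun z => trC + s • (ℓ z - trC)

lemma ls_apply (ℓ : ℂ → Cof) (s : ℝ) (z : ℂ) (B : Bil) : ls ℓ s z B = trC B + s * (ℓ z B - trC B) := rfl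

lemma ls_adm {lam Lam A s : ℝ} {ℓ : ℂ → Cof} (h : Adm lam Lam A ℓ) (hl : lam ≤ 1) (hL : 1 ≤ Lam) (hA : 0 ≤ A) (h0 : 0 ≤ s) (h1 : s ≤ 1) :
    Adm lam Lam A (ls ℓ s) := by
  refine ⟨fun z hz η => ?_, fun z hz w hw => ?_⟩
  · rw [ls_apply, trC_ten]
    obtain ⟨a, b⟩ := h.ell z hz η
    have := sq_nonneg ‖η‖
    constructor
    · nlinarith [mul_le_mul_of_nonneg_left a h0, mul_le_mul_of_nonneg_left hl (mul_nonneg (sub_nonneg.2 h1) this)]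
    · nlinarith [mul_le_mul_of_nonneg_left b h0, mul_le_mul_of_nonneg_left hL (mul_nonneg (sub_nonneg.2 h1) this)]
  · have e : ls ℓ s z - ls ℓ s w = s • (ℓ z - ℓ w) := by
      ext B
      rw [sub_apply, ls_apply, ls_apply, smul_apply, sub_apply, smul_eq_mul]; ring
    rw [e, norm_smul, Real.norm_eq_abs, abs_of_nonneg h0]
    have := h.hol z hz w hw
    have p : 0 ≤ A * √‖z - w‖ := by positivity
    calc s * ‖ℓ z - ℓ w‖ ≤ s * (A * √‖z - w‖) := mul_le_mul_of_nonneg_left this h0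
      _ ≤ _ := by nlinarith

lemma cont_method {lam Lam A : ℝ} {ℓ : ℂ → Cof} (h : Adm lam Lam A ℓ) (hl0 : 0 < lam) (hl : lam ≤ 1) (hL : 1 ≤ Lam) (hA : 0 ≤ A)
    (hΔ : Solv (fun _ => trC)) : Solv ℓ := by
  obtain ⟨C, hC, hae⟩ := apriori' lam Lam A hl0 (hl.trans hL) hA
  set K := ‖ℓ 0‖ + A + ‖trC‖ with hK
  have K0 : 0 ≤ K := by positivity
  have bD : ∀ z ∈ DB, ‖ℓ z - trC‖ ≤ K := by
    intro z hz
    have h1 := h.hol z hz 0 zero_mem_DB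
    have h2 : √‖z - 0‖ ≤ 1 := by
      rw [_root_.sub_zero]; exact Real.sqrt_le_iff.2 ⟨by norm_num, by have := mem_closedBall_zero_iff.1 hz; linarith⟩
    have h3 : ‖ℓ z - ℓ 0‖ ≤ A := h1.trans (by nlinarith)
    calc ‖ℓ z - trC‖ = ‖(ℓ z - ℓ 0) + ℓ 0 - trC‖ := by congr 1; abel
      _ ≤ ‖(ℓ z - ℓ 0) + ℓ 0‖ + ‖trC‖ := norm_sub_le _ _
      _ ≤ ‖ℓ z - ℓ 0‖ + ‖ℓ 0‖ + ‖trC‖ := add_le_add (norm_add_le _ _) le_rfl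
      _ ≤ K := by rw [hK]; linarith
  have hD : ∀ z ∈ DB, ∀ w ∈ DB, ‖(ℓ z - trC) - (ℓ w - trC)‖ ≤ A * √‖z - w‖ := by
    intro z hz w hw
    have e : (ℓ z - trC) - (ℓ w - trC) = ℓ z - ℓ w := by abel
    rw [e]; exact h.hol z hz w hw
  obtain ⟨n, hn⟩ := exists_nat_gt ((K + A) * (2 * (C + 1)))
  have n0 : (0 : ℝ) < n := lt_of_le_of_lt (by positivity) hn
  have key : ∀ k : ℕ, k ≤ n → Solv (ls ℓ (k / n)) := by
    intro k
    induction k with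
    | zero =>
      intro _ f M hf
      obtain ⟨T, hT, e⟩ := hΔ f M hf
      refine ⟨T, hT, fun z hz => ?_⟩
      rw [ls_apply, ← e z hz]; simp
    | succ k ih =>
      intro hk f M hf
      have hk' : (k : ℝ) + 1 ≤ n := by exact_mod_cast hk
      have M0 := hf.nonneg
      obtain ⟨T, hT, -, e⟩ := fixpt (ρ := M * (2 * (C + 1))) hC (hae _ (ls_adm h hl hL hA (s := k / n) (by positivity)
          (by rw [div_le_one n0]; linarith))) (ih (by omega)) (by positivity)
          (fun Q z => f z - 1 / n * ((ℓ z - trC) (Q z))) (by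
        intro T U M hT hU _ _ hM
        have y := (Yb_cof bD hD hA hM.nonneg hM.hQ hM.hol).smul (-(1 / n))
        have y2 : Yb (fun z => (f z - 1 / n * ((ℓ z - trC) (T.Q z))) - (f z - 1 / n * ((ℓ z - trC) (U.Q z)))) _ := y.congr (by
          intro z hz
          change _ = -(1 / n) * ((ℓ z - trC) (T.Q z - U.Q z))
          rw [cof_sub]; ring)
        refine y2.mono ?_
        rw [abs_neg, abs_of_nonneg (by positivity), le_div_iff₀ (by positivity)]
        have := hM.nonneg
        rw [show 1 / (n : ℝ) * ((K + A) * M) * (2 * (C + 1)) = ((K + A) * (2 * (C + 1))) / n * M by field_simp]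
        have : ((K + A) * (2 * (C + 1))) / n ≤ 1 := by rw [div_le_one n0]; exact hn.le
        nlinarith) (by
        rw [mul_div_assoc, div_self (by positivity), mul_one]
        refine hf.congr fun z hz => ?_
        have : (ℓ z - trC) (Tr.zero.Q z) = 0 := map_zero _
        rw [this]; ring)
      refine ⟨T, hT, fun z hz => ?_⟩
      have := e z hz
      rw [ls_apply] at this ⊢
      rw [sub_apply] at this
      push_cast
      rw [add_div]
      linarith
  have := key n le_rfl
  rw [div_self n0.ne'] at this
  intro f M hf
  obtain ⟨T, hT, e⟩ := this f M hf
  refine ⟨T, hT, fun z hz => ?_⟩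
  rw [← e z hz, ls_apply]; ring

end MC

/-! part 17 -/

namespace MC
open MeasureTheory

/-- right-hand sides for which the Poisson problem is solvable -/
def SolvD (f : ℂ → ℝ) : Prop := ∃ T, Good T ∧ ∀ z ∈ DB, trC (T.Q z) = f z

lemma good_smooth {v : ℂ → ℝ} (hv : ContDiff ℝ 3 v) (h0 : ∀ z : ℂ, ‖z‖ = 1 → v z = 0) :
    Good ⟨v, fderiv ℝ v, fderiv ℝ (fderiv ℝ v)⟩ := by
  have c1 : ContDiff ℝ 2 (fderiv ℝ v) := hv.fderiv_right (by norm_num)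
  have c2 : ContDiff ℝ 1 (fderiv ℝ (fderiv ℝ v)) := c1.fderiv_right (by norm_num)
  refine ⟨⟨fun z _ => ((hv.differentiable (by norm_num)) z).hasFDerivAt.hasFDerivWithinAt,
    fun z _ => ((c1.differentiable (by norm_num)) z).hasFDerivAt.hasFDerivWithinAt, fun z _ a b => ?_, h0⟩, ?_⟩
  · exact second_derivative_symmetric (fun y => ((hv.differentiable (by norm_num)) y).hasFDerivAt)
      ((c1.differentiable (by norm_num)) z).hasFDerivAt a b
  · obtain ⟨L, hL⟩ := (isCompact_closedBall (0 : ℂ) 1).exists_bound_of_continuousOn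
      (c2.continuous_fderiv (by norm_num)).continuousOn
    have L0 : 0 ≤ L := (norm_nonneg _).trans (hL 0 zero_mem_DB)
    refine ⟨L * 2, by positivity, fun z hz w hw => ?_⟩
    have := Convex.norm_image_sub_le_of_norm_hasFDerivWithin_le (C := L)
      (fun x (hx : x ∈ DB) => ((c2.differentiable (by norm_num)) x).hasFDerivAt.hasFDerivWithinAt) hL (convex_closedBall 0 1) hw hz
    refine this.trans ?_
    rw [mul_assoc]
    refine mul_le_mul_of_nonneg_left ?_ L0
    have h1 := mem_closedBall_zero_iff.1 hz
    have h2 := mem_closedBall_zero_iff.1 hw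
    have h3 : ‖z - w‖ ≤ 2 := (norm_sub_le _ _).trans (by linarith)
    have h4 := Real.sq_sqrt (norm_nonneg (z - w))
    have h5 := Real.sqrt_nonneg ‖z - w‖
    have h6 : √‖z - w‖ ≤ 2 := Real.sqrt_le_iff.2 ⟨by norm_num, by linarith⟩
    nlinarith

lemma SolvD.sub {f g : ℂ → ℝ} (hf : SolvD f) (hg : SolvD g) : SolvD (fun z => f z - g z) := by
  obtain ⟨T, hT, e⟩ := hf
  obtain ⟨U, hU, e'⟩ := hg
  refine ⟨T.sub U, hT.sub hU, fun z hz => ?_⟩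
  change trC (T.Q z - U.Q z) = _
  rw [cof_sub, e z hz, e' z hz]

lemma SolvD.zero : SolvD (fun _ => 0) := ⟨Tr.zero, Good.zero, fun z _ => map_zero _⟩

lemma SolvD.congr {f g : ℂ → ℝ} (hf : SolvD f) (h : ∀ z ∈ DB, g z = f z) : SolvD g := by
  obtain ⟨T, hT, e⟩ := hf
  exact ⟨T, hT, fun z hz => by rw [e z hz, h z hz]⟩

lemma SolvD.add {f g : ℂ → ℝ} (hf : SolvD f) (hg : SolvD g) : SolvD (fun z => f z + g z) :=
  (hf.sub (SolvD.zero.sub hg)).congr fun z _ => by ring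

def mono (a b : ℕ) (z : ℂ) : ℂ := z ^ a * (starRingEnd ℂ z) ^ b

lemma mono_fd (c : ℂ) (a b : ℕ) (z : ℂ) : HasFDerivAt (fun z => (c * mono a b z).re)
    (Complex.reCLM.comp ((c * a * mono (a - 1) b z) • (ContinuousLinearMap.id ℝ ℂ) +
      (c * b * mono a (b - 1) z) • (Complex.conjCLE : ℂ →L[ℝ] ℂ))) z := by
  have h1 : HasFDerivAt (fun z : ℂ => z ^ a) _ z := HasFDerivAt.pow (hasFDerivAt_id (𝕜 := ℝ) z) a
  have h2 : HasFDerivAt (fun z : ℂ => (starRingEnd ℂ z) ^ b) _ z := HasFDerivAt.pow (Complex.conjCLE.hasFDerivAt (x := z)) b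
  have h3 := Complex.reCLM.hasFDerivAt.comp z ((h1.mul h2).const_mul c)
  refine h3.congr_fderiv ?_
  ext k
  · simp [mono, mul_add]; ring

lemma mono_fderiv (c : ℂ) (a b : ℕ) (z k : ℂ) : fderiv ℝ (fun z => (c * mono a b z).re) z k =
    ((c * a * k) * mono (a - 1) b z).re + ((c * b * starRingEnd ℂ k) * mono a (b - 1) z).re := by
  rw [(mono_fd c a b z).fderiv, ← Complex.add_re]
  simp only [ContinuousLinearMap.comp_apply, add_apply, smul_apply, Complex.reCLM_apply, ContinuousLinearMap.id_apply, smul_eq_mul]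
  congr 1
  change _ + _ * starRingEnd ℂ k = _
  ring

lemma mono_smooth (c : ℂ) (a b : ℕ) (n : WithTop ℕ∞) : ContDiff ℝ n (fun z => (c * mono a b z).re) := by
  have h1 : ContDiff ℝ n (fun z : ℂ => starRingEnd ℂ z) := Complex.conjCLE.contDiff
  have h2 : ContDiff ℝ n (fun z : ℂ => c * mono a b z) := contDiff_const.mul ((contDiff_id.pow a).mul (h1.pow b))
  exact Complex.reCLM.contDiff.comp h2

lemma mono_lap (c : ℂ) (a b : ℕ) (z : ℂ) : trC (fderiv ℝ (fderiv ℝ (fun z => (c * mono a b z).re)) z) =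
    4 * (c * (a * b) * mono (a - 1) (b - 1) z).re := by
  have s := mono_smooth c a b 2
  have d : DifferentiableAt ℝ (fderiv ℝ (fun z => (c * mono a b z).re)) z :=
    ((s.fderiv_right (m := 1) (by norm_num)).differentiable (by norm_num)) z
  have e : ∀ h k : ℂ, fderiv ℝ (fderiv ℝ (fun z => (c * mono a b z).re)) z h k =
      (((c * a * k) * ((a - 1 : ℕ) : ℂ) * h) * mono (a - 1 - 1) b z).re + (((c * a * k) * b * starRingEnd ℂ h) * mono (a - 1) (b - 1) z).re
      + ((((c * b * starRingEnd ℂ k) * a * h) * mono (a - 1) (b - 1) z).re + (((c * b * starRingEnd ℂ k) * ((b - 1 : ℕ) : ℂ) * starRingEnd ℂ h) * mono a (b - 1 - 1) z).re) := by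
    intro h k
    have e1 : fderiv ℝ (fderiv ℝ (fun z => (c * mono a b z).re)) z h k =
        fderiv ℝ (fun y => fderiv ℝ (fun z => (c * mono a b z).re) y k) z h := by
      rw [fderiv_clm_apply d (differentiableAt_const k)]; simp
    rw [e1]
    simp only [mono_fderiv]
    rw [fderiv_fun_add ((mono_smooth _ _ _ 1).differentiable (by norm_num) z) ((mono_smooth _ _ _ 1).differentiable (by norm_num) z), add_apply,
      mono_fderiv, mono_fderiv]
  rw [trC_apply, e, e]
  simp only [← Complex.add_re, map_one, Complex.conj_I]
  rw [← Complex.re_ofReal_mul]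
  congr 1
  push_cast
  linear_combination (c * a * ((a - 1 : ℕ) : ℂ) * mono (a - 1 - 1) b z + c * b * ((b - 1 : ℕ) : ℂ) * mono a (b - 1 - 1) z - 2 * c * a * b * mono (a - 1) (b - 1) z) * Complex.I_sq

lemma solvD_mono (c : ℂ) (j k : ℕ) : SolvD (fun z => (c * mono j k z).re) := by
  set c' := c / (4 * ((j + 1) * (k + 1))) with hc'
  have nz : (4 * (((j : ℂ) + 1) * (k + 1))) ≠ 0 := by
    have h1 : ((j : ℂ) + 1) ≠ 0 := by exact_mod_cast Nat.succ_ne_zero j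
    have h2 : ((k : ℂ) + 1) ≠ 0 := by exact_mod_cast Nat.succ_ne_zero k
    simp [h1, h2]
  have s1 := mono_smooth c' (j + 1) (k + 1) 3
  have s2 := mono_smooth c' (j - k) (k - j) 3
  have G := good_smooth (s1.sub s2) (by
    intro z hz
    have z1 : z * starRingEnd ℂ z = 1 := by rw [Complex.mul_conj, Complex.normSq_eq_norm_sq, hz]; simp
    have : mono (j + 1) (k + 1) z = mono (j - k) (k - j) z := by
      unfold mono
      rcases le_total j k with h | h
      · obtain ⟨d, rfl⟩ := Nat.exists_eq_add_of_le h
        rw [show j - (j + d) = 0 by omega, show j + d - j = d by omega]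
        calc z ^ (j + 1) * (starRingEnd ℂ) z ^ (j + d + 1) = (z * starRingEnd ℂ z) ^ (j + 1) * starRingEnd ℂ z ^ d := by ring
          _ = _ := by rw [z1]; ring
      · obtain ⟨d, rfl⟩ := Nat.exists_eq_add_of_le h
        rw [show k - (k + d) = 0 by omega, show k + d - k = d by omega]
        calc z ^ (k + d + 1) * (starRingEnd ℂ) z ^ (k + 1) = (z * starRingEnd ℂ z) ^ (k + 1) * z ^ d := by ring
          _ = _ := by rw [z1]; ring
    rw [this, sub_self])
  refine ⟨_, G, fun z _ => ?_⟩
  change trC (fderiv ℝ (fderiv ℝ (fun x => (c' * mono (j + 1) (k + 1) x).re - (c' * mono (j - k) (k - j) x).re)) z) = _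
  have e1 : fderiv ℝ (fun x => (c' * mono (j + 1) (k + 1) x).re - (c' * mono (j - k) (k - j) x).re) =
      fun x => fderiv ℝ (fun x => (c' * mono (j + 1) (k + 1) x).re) x - fderiv ℝ (fun x => (c' * mono (j - k) (k - j) x).re) x := by
    ext1 x
    exact fderiv_fun_sub (s1.differentiable (by norm_num) x) (s2.differentiable (by norm_num) x)
  rw [e1, fderiv_fun_sub (((s1.fderiv_right (m := 1) (by norm_num)).differentiable (by norm_num)) z) (((s2.fderiv_right (m := 1) (by norm_num)).differentiable (by norm_num)) z)]
  rw [cof_sub, mono_lap, mono_lap]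
  have e2 : ((j - k : ℕ) : ℂ) * ((k - j : ℕ) : ℂ) = 0 := by
    rcases le_total j k with h | h
    · rw [show j - k = 0 by omega]; simp
    · rw [show k - j = 0 by omega]; simp
  rw [e2]
  simp only [mul_zero, zero_mul, Complex.zero_re, _root_.sub_zero, Nat.add_sub_cancel]
  have : (4 : ℝ) = ((4 : ℝ) : ℂ).re := by simp
  rw [← Complex.re_ofReal_mul]
  congr 1
  rw [hc']
  push_cast
  field_simp

/-- polynomials in z and its conjugate -/
def PolC : Subalgebra ℂ (ℂ → ℂ) := Algebra.adjoin ℂ {(fun z => z), (fun z => starRingEnd ℂ z)}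

lemma solvD_pol {f : ℂ → ℂ} (hf : f ∈ PolC) : SolvD (fun z => (f z).re) := by
  have h1 : ∀ g ∈ Submonoid.closure ({(fun z => z), (fun z => starRingEnd ℂ z)} : Set (ℂ → ℂ)), ∃ j k, g = mono j k := by
    intro g hg
    induction hg using Submonoid.closure_induction with
    | mem x hx =>
      rcases hx with rfl | hx
      · exact ⟨1, 0, by ext z; simp [mono]⟩
      · rw [mem_singleton_iff] at hx
        exact ⟨0, 1, by rw [hx]; ext z; simp [mono]⟩
    | one => exact ⟨0, 0, by ext z; simp [mono]⟩
    | mul x y _ _ hx hy =>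
      obtain ⟨j, k, rfl⟩ := hx
      obtain ⟨j', k', rfl⟩ := hy
      exact ⟨j + j', k + k', by ext z; simp only [Pi.mul_apply, mono]; ring⟩
  have h2 : f ∈ Submodule.span ℂ (Submonoid.closure ({(fun z => z), (fun z => starRingEnd ℂ z)} : Set (ℂ → ℂ)) : Set (ℂ → ℂ)) := by
    rw [← Algebra.adjoin_eq_span]; exact hf
  have h3 : ∀ c : ℂ, SolvD (fun z => (c * f z).re) := by
    clear hf
    induction h2 using Submodule.span_induction with
    | mem x hx =>
      intro c
      obtain ⟨j, k, rfl⟩ := h1 x hx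
      exact solvD_mono c j k
    | zero => intro c; exact SolvD.zero.congr fun z _ => by simp
    | add x y _ _ hx hy => intro c; exact ((hx c).add (hy c)).congr fun z _ => by simp only [Pi.add_apply, mul_add, Complex.add_re]
    | smul a x _ hx => intro c; exact (hx (c * a)).congr fun z _ => by simp only [Pi.smul_apply, smul_eq_mul, mul_assoc]
  exact (h3 1).congr fun z _ => by rw [one_mul]

end MC

/-! part 18 -/

namespace MC
open MeasureTheory

lemma pol_int (n : ℕ) : ∀ g : ℂ → ℂ, Continuous g → HasCompactSupport g →
    (fun x : ℂ => ∫ w : ℂ, g w * (1 - (x - w) * starRingEnd ℂ (x - w) / 9) ^ n) ∈ PolC := by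
  have m1 : (fun z : ℂ => z) ∈ PolC := Algebra.subset_adjoin (by simp)
  have m2 : (fun z : ℂ => starRingEnd ℂ z) ∈ PolC := Algebra.subset_adjoin (by simp)
  induction n with
  | zero =>
    intro g _ _
    simp only [pow_zero, mul_one]
    exact PolC.algebraMap_mem (∫ w, g w)
  | succ n ih =>
    intro g hg hs
    have cc : Continuous (fun w : ℂ => starRingEnd ℂ w) := Complex.continuous_conj
    have i1 := ih (fun w => g w * (1 - w * starRingEnd ℂ w / 9)) (by fun_prop) hs.mul_right
    have i2 := ih (fun w => g w * (starRingEnd ℂ w / 9)) (by fun_prop) hs.mul_right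
    have i3 := ih (fun w => g w * (w / 9)) (by fun_prop) hs.mul_right
    have i4 := ih (fun w => g w * (-1 / 9)) (by fun_prop) hs.mul_right
    have := PolC.add_mem (PolC.add_mem i1 (PolC.mul_mem m1 i2)) (PolC.add_mem (PolC.mul_mem m2 i3) (PolC.mul_mem (PolC.mul_mem m1 m2) i4))
    convert this using 1
    ext x
    simp only [Pi.add_apply, Pi.mul_apply]
    have I : ∀ k : ℂ → ℂ, Continuous k → Integrable (fun w => g w * k w * (1 - (x - w) * starRingEnd ℂ (x - w) / 9) ^ n) := by
      intro k hk
      exact Continuous.integrable_of_hasCompactSupport (by fun_prop) (hs.mul_right.mul_right)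
    rw [← integral_const_mul, ← integral_const_mul, ← integral_const_mul, ← integral_add (I _ (by fun_prop)) ((I _ (by fun_prop)).const_mul _),
      ← integral_add ((I _ (by fun_prop)).const_mul _) ((I _ (by fun_prop)).const_mul _), ← integral_add]
    · congr 1
      ext w
      rw [map_sub]; ring
    · exact (I _ (by fun_prop)).add ((I _ (by fun_prop)).const_mul _)
    · exact ((I _ (by fun_prop)).const_mul _).add ((I _ (by fun_prop)).const_mul _)

def LK (n : ℕ) (y : ℂ) : ℝ := (max 0 (1 - ‖y‖ ^ 2 / 9)) ^ (n + 1)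

lemma LK_cont (n : ℕ) : Continuous (LK n) := by unfold LK; fun_prop

lemma LK_nonneg (n : ℕ) (y : ℂ) : 0 ≤ LK n y := by unfold LK; positivity

lemma LK_out {n : ℕ} {y : ℂ} (h : 3 ≤ ‖y‖) : LK n y = 0 := by
  unfold LK
  rw [max_eq_left (by nlinarith), zero_pow (by omega)]

lemma LK_supp (n : ℕ) : HasCompactSupport (LK n) := by
  refine HasCompactSupport.intro (isCompact_closedBall (0 : ℂ) 3) fun x hx => ?_
  rw [mem_closedBall_zero_iff, not_le] at hx
  exact LK_out hx.le

lemma LK_int (n : ℕ) : Integrable (LK n) := (LK_cont n).integrable_of_hasCompactSupport (LK_supp n)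

lemma LK_sq (n : ℕ) (y : ℂ) : ‖y‖ ^ 2 * LK n y = 9 * (LK n y - LK (n + 1) y) := by
  rcases le_total 3 ‖y‖ with h | h
  · rw [LK_out h, LK_out h]; ring
  · unfold LK
    rw [max_eq_right (by nlinarith [norm_nonneg y])]; ring

lemma radial_int (n : ℕ) : ∫ y in Ioi (0 : ℝ), y * (max 0 (1 - y ^ 2 / 9)) ^ (n + 1) = 9 / (2 * (n + 2)) := by
  have e1 : ∫ y in Ioi (0 : ℝ), y * (max 0 (1 - y ^ 2 / 9)) ^ (n + 1) = ∫ y in Ioc (0 : ℝ) 3, y * (max 0 (1 - y ^ 2 / 9)) ^ (n + 1) := by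
    refine (setIntegral_eq_of_subset_of_forall_diff_eq_zero measurableSet_Ioi (fun x hx => hx.1) ?_)
    rintro x ⟨h1, h2⟩
    have h3 : 3 < x := by
      by_contra h; exact h2 ⟨h1, not_lt.1 h⟩
    rw [max_eq_left (by nlinarith), zero_pow (by omega), mul_zero]
  rw [e1, ← intervalIntegral.integral_of_le (by norm_num)]
  have e2 : ∫ y in (0 : ℝ)..3, y * (max 0 (1 - y ^ 2 / 9)) ^ (n + 1) = ∫ y in (0 : ℝ)..3, y * (1 - y ^ 2 / 9) ^ (n + 1) := by
    refine intervalIntegral.integral_congr fun x hx => ?_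
    rw [uIcc_of_le (by norm_num)] at hx
    rw [max_eq_right (by nlinarith [hx.1, hx.2])]
  rw [e2, intervalIntegral.integral_eq_sub_of_hasDerivAt (f := fun y => -(9 / (2 * (n + 2))) * (1 - y ^ 2 / 9) ^ (n + 2))]
  · have : (1 - (3 : ℝ) ^ 2 / 9) = 0 := by norm_num
    rw [this, zero_pow (by omega)]; simp
  · intro x _
    have h1 : HasDerivAt (fun y : ℝ => 1 - y ^ 2 / 9) (-(2 * x / 9)) x := by
      have := ((hasDerivAt_pow 2 x).div_const 9).const_sub 1
      simpa using this
    have h2 := (h1.pow (n + 2)).const_mul (-(9 / (2 * ((n : ℝ) + 2))))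
    refine h2.congr_deriv ?_
    have : ((n : ℝ) + 2) ≠ 0 := by positivity
    simp only [Nat.cast_add, Nat.cast_ofNat, show n + 2 - 1 = n + 1 from rfl]
    field_simp
  · exact Continuous.intervalIntegrable (by fun_prop) _ _

lemma LK_mass : ∃ c : ℝ, 0 < c ∧ ∀ n, ∫ y, LK n y = c / (n + 2) := by
  have hp : 0 < (volume : Measure ℂ).real (ball 0 1) := by
    rw [measureReal_def]
    exact ENNReal.toReal_pos (measure_ball_pos _ _ one_pos).ne' measure_ball_lt_top.ne
  refine ⟨9 * (volume : Measure ℂ).real (ball 0 1), by positivity, fun n => ?_⟩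
  have := integral_fun_norm_addHaar (volume : Measure ℂ) (fun r : ℝ => (max 0 (1 - r ^ 2 / 9)) ^ (n + 1))
  simp only [Complex.finrank_real_complex, smul_eq_mul, nsmul_eq_mul] at this
  change ∫ y : ℂ, (max 0 (1 - ‖y‖ ^ 2 / 9)) ^ (n + 1) = _
  rw [this]
  simp only [show 2 - 1 = 1 from rfl, pow_one]
  rw [radial_int]
  have : ((n : ℝ) + 2) ≠ 0 := by positivity
  push_cast
  field_simp

end MC

/-! part 19 -/

namespace MC
open MeasureTheory

lemma retr (z w : ℂ) : ‖(max 1 ‖z‖)⁻¹ • z - (max 1 ‖w‖)⁻¹ • w‖ ≤ 2 * ‖z - w‖ := by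
  set a := max 1 ‖z‖ with ha
  set b := max 1 ‖w‖ with hb
  have a1 : 1 ≤ a := le_max_left _ _
  have b1 : 1 ≤ b := le_max_left _ _
  have b2 : ‖w‖ ≤ b := le_max_right _ _
  have ab : |b - a| ≤ ‖z - w‖ := by
    rw [ha, hb, max_comm, max_comm 1 ‖z‖]
    refine (abs_max_sub_max_le_abs _ _ _).trans ?_
    rw [norm_sub_rev]; exact abs_norm_sub_norm_le _ _
  have e : a⁻¹ • z - b⁻¹ • w = a⁻¹ • (z - w) + (a⁻¹ * b⁻¹ * (b - a)) • w := by
    have : a⁻¹ * b⁻¹ * (b - a) = a⁻¹ - b⁻¹ := by field_simp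
    rw [this, smul_sub, sub_smul]; abel
  rw [e]
  have i1 : a⁻¹ ≤ 1 := inv_le_one_of_one_le₀ a1
  have i2 : b⁻¹ * ‖w‖ ≤ 1 := by rw [inv_mul_le_iff₀ (by linarith)]; linarith
  have a0 : 0 ≤ a⁻¹ := by positivity
  refine (norm_add_le _ _).trans ?_
  rw [norm_smul, norm_smul, Real.norm_eq_abs, abs_of_nonneg a0, Real.norm_eq_abs, abs_mul, abs_mul, abs_of_nonneg a0,
    abs_of_nonneg (show 0 ≤ b⁻¹ by positivity)]
  have h1 : a⁻¹ * ‖z - w‖ ≤ ‖z - w‖ := by nlinarith [norm_nonneg (z - w)]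
  have h2 : a⁻¹ * b⁻¹ * |b - a| * ‖w‖ ≤ ‖z - w‖ := by
    calc a⁻¹ * b⁻¹ * |b - a| * ‖w‖ = a⁻¹ * (b⁻¹ * ‖w‖) * |b - a| := by ring
      _ ≤ 1 * 1 * ‖z - w‖ := by gcongr
      _ = _ := by ring
  linarith

def chi (r : ℝ) : ℝ := max 0 (min 1 (2 - r))

lemma chi_lip (r s : ℝ) : |chi r - chi s| ≤ √|r - s| := by
  have h1 : |chi r - chi s| ≤ |r - s| := by
    unfold chi
    rw [max_comm, max_comm 0, min_comm, min_comm 1]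
    refine (abs_max_sub_max_le_abs _ _ _).trans ((abs_min_sub_min_le_max _ _ _ _).trans ?_)
    rw [show 2 - r - (2 - s) = s - r by ring, abs_sub_comm s r]; simp
  have h2 : |chi r - chi s| ≤ 1 := by
    have a : ∀ t, 0 ≤ chi t ∧ chi t ≤ 1 := fun t => ⟨le_max_left _ _, max_le zero_le_one (min_le_left _ _)⟩
    rw [abs_le]; constructor <;> linarith [(a r).1, (a r).2, (a s).1, (a s).2]
  rcases le_total |r - s| 1 with h | h
  · exact h1.trans (le_self_sqrt (abs_nonneg _) h)
  · refine h2.trans ?_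
    rw [show (1 : ℝ) = √1 by simp]; exact Real.sqrt_le_sqrt h

lemma ext_hol {f : ℂ → ℝ} {M : ℝ} (hf : Yb f M) : ∃ h : ℂ → ℝ, (∀ z, |h z| ≤ 3 * M) ∧ (∀ z w, |h z - h w| ≤ 3 * M * √‖z - w‖) ∧
    (∀ z, 2 ≤ ‖z‖ → h z = 0) ∧ ∀ z ∈ DB, h z = f z := by
  have M0 := hf.nonneg
  have mem : ∀ z : ℂ, (max 1 ‖z‖)⁻¹ • z ∈ DB := by
    intro z
    have : 0 < max 1 ‖z‖ := lt_of_lt_of_le one_pos (le_max_left _ _)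
    rw [mem_closedBall_zero_iff, norm_smul, Real.norm_eq_abs, abs_of_nonneg (by positivity), inv_mul_le_iff₀ this, mul_one]
    exact le_max_right _ _
  have a : ∀ t, 0 ≤ chi t ∧ chi t ≤ 1 := fun t => ⟨le_max_left _ _, max_le zero_le_one (min_le_left _ _)⟩
  refine ⟨fun z => chi ‖z‖ * f ((max 1 ‖z‖)⁻¹ • z), fun z => ?_, fun z w => ?_, fun z hz => ?_, fun z hz => ?_⟩
  · rw [abs_mul, abs_of_nonneg (a _).1]
    have := hf.b _ (mem z)
    nlinarith [a ‖z‖, abs_nonneg (f ((max 1 ‖z‖)⁻¹ • z))]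
  · have e : chi ‖z‖ * f ((max 1 ‖z‖)⁻¹ • z) - chi ‖w‖ * f ((max 1 ‖w‖)⁻¹ • w) =
      chi ‖z‖ * (f ((max 1 ‖z‖)⁻¹ • z) - f ((max 1 ‖w‖)⁻¹ • w)) + (chi ‖z‖ - chi ‖w‖) * f ((max 1 ‖w‖)⁻¹ • w) := by ring
    simp only
    rw [e]
    refine (abs_add_le _ _).trans ?_
    rw [abs_mul, abs_mul, abs_of_nonneg (a _).1]
    have h1 := hf.hol _ (mem z) _ (mem w)
    have h2 : √‖(max 1 ‖z‖)⁻¹ • z - (max 1 ‖w‖)⁻¹ • w‖ ≤ 2 * √‖z - w‖ := by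
      refine (Real.sqrt_le_sqrt (retr z w)).trans ?_
      rw [Real.sqrt_mul (by norm_num)]
      refine mul_le_mul_of_nonneg_right ?_ (Real.sqrt_nonneg _)
      exact Real.sqrt_le_iff.2 ⟨by norm_num, by norm_num⟩
    have h3 : |chi ‖z‖ - chi ‖w‖| ≤ √‖z - w‖ := (chi_lip _ _).trans (Real.sqrt_le_sqrt (abs_norm_sub_norm_le _ _))
    have h4 := hf.b _ (mem w)
    have s0 := Real.sqrt_nonneg ‖z - w‖
    have h5 : chi ‖z‖ * |f ((max 1 ‖z‖)⁻¹ • z) - f ((max 1 ‖w‖)⁻¹ • w)| ≤ 1 * (M * (2 * √‖z - w‖)) :=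
      mul_le_mul (a _).2 (h1.trans (mul_le_mul_of_nonneg_left h2 M0)) (abs_nonneg _) zero_le_one
    have h6 : |chi ‖z‖ - chi ‖w‖| * |f ((max 1 ‖w‖)⁻¹ • w)| ≤ √‖z - w‖ * M := mul_le_mul h3 h4 (abs_nonneg _) s0
    linarith
  · have : chi ‖z‖ = 0 := by
      unfold chi; exact max_eq_left ((min_le_right _ _).trans (by linarith))
    simp only [this, zero_mul]
  · have h1 := mem_closedBall_zero_iff.1 hz
    have : chi ‖z‖ = 1 := by
      unfold chi; rw [min_eq_left (by linarith), max_eq_right zero_le_one]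
    simp only [this, one_mul, max_eq_left h1, inv_one, one_smul]

lemma sqrt_trick {t ε : ℝ} (ht : 0 ≤ t) (hε : 0 < ε) : √t ≤ ε + t ^ 2 / ε ^ 3 := by
  have h := Real.sq_sqrt ht
  set s := √t
  have s0 : 0 ≤ s := Real.sqrt_nonneg t
  rw [← h]
  rcases le_total s ε with h1 | h1
  · have : 0 ≤ (s ^ 2) ^ 2 / ε ^ 3 := by positivity
    linarith
  · have : s ≤ (s ^ 2) ^ 2 / ε ^ 3 := by
      rw [le_div_iff₀ (by positivity)]
      calc s * ε ^ 3 ≤ s * s ^ 3 := by gcongr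
        _ = _ := by ring
    linarith

lemma landau {f : ℂ → ℝ} {M : ℝ} (hf : Yb f M) : ∃ M', ∀ ε, 0 < ε → ∃ g ∈ PolC, Yb (fun z => (g z).re) M' ∧ ∀ z ∈ DB, |(g z).re - f z| ≤ ε := by
  have M0 := hf.nonneg
  obtain ⟨h, hb, hh, ho, he⟩ := ext_hol hf
  set L := 3 * M with hL
  have L0 : 0 ≤ L := by positivity
  obtain ⟨c, hc, hm⟩ := LK_mass
  have hcont : Continuous h := by
    rw [continuous_iff_continuousAt]
    intro w
    rw [ContinuousAt, tendsto_iff_norm_sub_tendsto_zero]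
    have t : Filter.Tendsto (fun z : ℂ => L * √‖z - w‖) (nhds w) (nhds 0) := by
      have c : Continuous (fun z : ℂ => L * √‖z - w‖) := by fun_prop
      simpa using c.tendsto w
    exact squeeze_zero (fun _ => norm_nonneg _) (fun z => hh z w) t
  have hsupp : HasCompactSupport h := by
    refine HasCompactSupport.intro (isCompact_closedBall (0 : ℂ) 2) fun x hx => ?_
    rw [mem_closedBall_zero_iff, not_le] at hx
    exact ho x hx.le
  refine ⟨L, fun ε hε => ?_⟩
  set δ := ε / (2 * (L + 1)) with hδ
  have δ0 : 0 < δ := by positivity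
  obtain ⟨n, hn⟩ := exists_nat_gt (9 * L / δ ^ 3 / (ε / 2))
  have m0 : 0 < ∫ y, LK n y := by rw [hm]; positivity
  set m := ∫ y, LK n y with hmm
  let G : ℂ → ℝ := fun x => ∫ y, h (x - y) * LK n y
  have GI : ∀ x, Integrable (fun y => h (x - y) * LK n y) := fun x =>
    ((hcont.comp (continuous_const.sub continuous_id)).mul (LK_cont n)).integrable_of_hasCompactSupport (LK_supp n).mul_left
  have hpol := pol_int (n + 1) (fun w => ((h w : ℝ) : ℂ)) (by fun_prop) (hsupp.comp_left (g := fun r : ℝ => (r : ℂ)) (by simp))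
  refine ⟨_, PolC.smul_mem hpol (((1 / m : ℝ)) : ℂ), ?_⟩
  have key : ∀ x ∈ DB, ((((1 / m : ℝ) : ℂ)) • (fun x : ℂ => ∫ w : ℂ, ((h w : ℝ) : ℂ) * (1 - (x - w) * starRingEnd ℂ (x - w) / 9) ^ (n + 1)) ) x =
      ((1 / m * G x : ℝ) : ℂ) := by
    intro x hx
    rw [Pi.smul_apply, smul_eq_mul, Complex.ofReal_mul]
    congr 1
    have e1 : G x = ∫ w, h w * LK n (x - w) := by
      rw [← integral_sub_left_eq_self (fun w => h w * LK n (x - w)) volume x]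
      simp only [sub_sub_cancel]; rfl
    rw [e1, ← integral_complex_ofReal]
    congr 1
    ext w
    rw [Complex.ofReal_mul]
    rcases le_total 2 ‖w‖ with h1 | h1
    · rw [ho w h1]; simp
    · congr 1
      have h2 : ‖x - w‖ ≤ 3 := (norm_sub_le _ _).trans (by have := mem_closedBall_zero_iff.1 hx; linarith)
      unfold LK
      rw [max_eq_right (by nlinarith [norm_nonneg (x - w)]), Complex.mul_conj, Complex.normSq_eq_norm_sq]
      push_cast; rfl
  have bd : ∀ (u : ℂ → ℝ) (B : ℝ), (∀ y, |u y| ≤ B) → |∫ y, u y * LK n y| ≤ B * m := by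
    intro u B hu
    rw [hmm, ← integral_const_mul]
    refine norm_integral_le_of_norm_le (f := fun y => u y * LK n y) ((LK_int n).const_mul B) (Filter.Eventually.of_forall fun y => ?_)
    rw [Real.norm_eq_abs, abs_mul, abs_of_nonneg (LK_nonneg n y)]
    exact mul_le_mul_of_nonneg_right (hu y) (LK_nonneg n y)
  constructor
  · constructor
    · intro z hz
      simp only [key z hz, Complex.ofReal_re]
      rw [abs_mul, abs_of_nonneg (by positivity)]
      have := bd (fun y => h (z - y)) L (fun y => hb _)
      rw [one_div, inv_mul_le_iff₀ m0, mul_comm m]; exact this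
    · intro z hz w hw
      simp only [key z hz, key w hw, Complex.ofReal_re]
      rw [← mul_sub, abs_mul, abs_of_nonneg (by positivity), one_div, inv_mul_le_iff₀ m0, mul_comm m]
      have := bd (fun y => h (z - y) - h (w - y)) (L * √‖z - w‖) (fun y => by
        have := hh (z - y) (w - y)
        rwa [sub_sub_sub_cancel_right] at this)
      simp only [sub_mul] at this
      rw [integral_sub (GI z) (GI w)] at this
      exact this
  · intro z hz
    simp only [key z hz, Complex.ofReal_re]
    have e1 : 1 / m * G z - f z = 1 / m * ∫ y, (h (z - y) - h z) * LK n y := by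
      simp only [sub_mul]
      rw [integral_sub (GI z) ((LK_int n).const_mul _), integral_const_mul, ← hmm, mul_sub, he z hz]
      field_simp; rfl
    rw [e1, abs_mul, abs_of_nonneg (by positivity), one_div, inv_mul_le_iff₀ m0]
    have I2 : Integrable (fun y => L * (δ * LK n y + 9 / δ ^ 3 * (LK n y - LK (n + 1) y))) :=
      (((LK_int n).const_mul _).add (((LK_int n).sub (LK_int (n + 1))).const_mul _)).const_mul _
    have b2 : |∫ y, (h (z - y) - h z) * LK n y| ≤ ∫ y, L * (δ * LK n y + 9 / δ ^ 3 * (LK n y - LK (n + 1) y)) := by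
      refine norm_integral_le_of_norm_le (f := fun y => (h (z - y) - h z) * LK n y) I2 (Filter.Eventually.of_forall fun y => ?_)
      rw [Real.norm_eq_abs, abs_mul, abs_of_nonneg (LK_nonneg n y)]
      have s1 := hh (z - y) z
      rw [show z - y - z = -y by ring, norm_neg] at s1
      have s2 := sqrt_trick (norm_nonneg y) δ0
      calc |h (z - y) - h z| * LK n y ≤ (L * (δ + ‖y‖ ^ 2 / δ ^ 3)) * LK n y :=
            mul_le_mul_of_nonneg_right (s1.trans (mul_le_mul_of_nonneg_left s2 L0)) (LK_nonneg n y)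
        _ = L * (δ * LK n y + 1 / δ ^ 3 * (‖y‖ ^ 2 * LK n y)) := by ring
        _ = _ := by rw [LK_sq]; ring
    refine b2.trans ?_
    have I3 : Integrable (fun y => 9 / δ ^ 3 * (LK n y - LK (n + 1) y)) := ((LK_int n).sub (LK_int (n + 1))).const_mul _
    rw [integral_const_mul, integral_add ((LK_int n).const_mul _) I3, integral_const_mul,
      integral_const_mul, integral_sub (LK_int n) (LK_int (n + 1)), ← hmm]
    have e3 : m - ∫ y, LK (n + 1) y = m / (n + 3) := by
      rw [hmm, hm, hm]; push_cast; field_simp; ring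
    rw [e3]
    have n3 : (0 : ℝ) < n + 3 := by positivity
    have q1 : L * δ ≤ ε / 2 := by
      rw [hδ, ← mul_div_assoc, div_le_div_iff₀ (by positivity) (by norm_num)]
      nlinarith
    have q2 : 9 * L / δ ^ 3 / (n + 3) ≤ ε / 2 := by
      rw [div_lt_iff₀ (by positivity)] at hn
      rw [div_le_iff₀ n3]
      nlinarith
    calc L * (δ * m + 9 / δ ^ 3 * (m / (n + 3))) = m * (L * δ + 9 * L / δ ^ 3 / (n + 3)) := by ring
      _ ≤ m * ε := by
        refine mul_le_mul_of_nonneg_left ?_ m0.le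
        linarith

end MC

/-! part 20 -/

namespace MC
open MeasureTheory

lemma trC_adm : Adm 1 1 0 (fun _ => trC) := by
  refine ⟨fun z _ η => ?_, fun z _ w _ => ?_⟩
  · rw [trC_ten]; simp
  · have : trC - trC = 0 := sub_self trC
    rw [this]; simp

theorem solv_lap : Solv (fun _ => trC) := by
  intro f M hf
  obtain ⟨C, hC, hae⟩ := apriori' 1 1 0 one_pos le_rfl le_rfl
  obtain ⟨M', hM'⟩ := landau hf
  let r : ℕ → ℝ := fun k => 1 / ((k : ℝ) + 1)
  have r0 : ∀ k, 0 < r k := fun k => by positivity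
  have r1 : ∀ k, r k ≤ 1 := fun k => by
    change 1 / ((k : ℝ) + 1) ≤ 1
    rw [div_le_one (by positivity)]; linarith [(Nat.cast_nonneg k : (0 : ℝ) ≤ k)]
  have rm : ∀ k n, k ≤ n → r n ≤ r k := fun k n h => by
    have : (k : ℝ) ≤ n := by exact_mod_cast h
    exact one_div_le_one_div_of_le (by positivity) (by linarith)
  have rt : Filter.Tendsto r Filter.atTop (nhds 0) := tendsto_one_div_add_atTop_nhds_zero_nat
  choose g hg hY hε using fun k => hM' (r k ^ 3) (pow_pos (r0 k) 3)
  choose T hT hTe using fun k => solvD_pol (hg k)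
  have hX : ∀ k, Xn (T k) (C * M') := fun k => hae _ trC_adm (T k) M' (hT k) ((hY k).congr (hTe k))
  have M0 : 0 ≤ M' := (hY 0).nonneg
  set N := 2 * (C * M') with hN
  have N0 : 0 ≤ N := by positivity
  have hV : ∀ k n m, k ≤ n → k ≤ m → ∀ z ∈ DB, |(T n).v z - (T m).v z| ≤ r k ^ 3 / 2 := by
    intro k n m hn hm z hz
    obtain ⟨N', hN0', hN'⟩ := ((hT n).sub (hT m)).hol
    have := ((hT n).sub (hT m)).vd.maxp (ℓ := fun _ => trC) (lam := 1) (Lam := 1) (F := 2 * r k ^ 3) hN' hN0' one_pos trC_adm.ell (by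
      intro z hz
      change |trC ((T n).Q z - (T m).Q z)| ≤ _
      rw [cof_sub, hTe n z hz, hTe m z hz]
      have a := hε n z hz
      have b := hε m z hz
      have a' : r n ^ 3 ≤ r k ^ 3 := by have := rm k n hn; have := r0 n; gcongr
      have b' : r m ^ 3 ≤ r k ^ 3 := by have := rm k m hm; have := r0 m; gcongr
      rw [abs_le] at a b ⊢
      constructor <;> linarith) z hz
    refine this.trans (le_of_eq (by ring))
  have hH : ∀ n m, HolD ((T n).sub (T m)).Q N := by
    intro n m z hz w hw
    change ‖((T n).Q z - (T m).Q z) - ((T n).Q w - (T m).Q w)‖ ≤ _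
    have e : ((T n).Q z - (T m).Q z) - ((T n).Q w - (T m).Q w) = ((T n).Q z - (T n).Q w) - ((T m).Q z - (T m).Q w) := by abel
    rw [e]
    refine (norm_sub_le _ _).trans ((add_le_add ((hX n).hol z hz w hw) ((hX m).hol z hz w hw)).trans (le_of_eq ?_))
    rw [hN]; ring
  have hQ : ∀ k n m, k ≤ n → k ≤ m → ∀ z ∈ DB, ‖((T n).sub (T m)).Q z‖ ≤ 2 * r k + 3 * (N * √(r k)) := by
    intro k n m hn hm z hz
    refine (((hT n).sub (hT m)).vd.interp (hH n m) N0 (hV k n m hn hm) (r0 k) (r1 k) z hz).trans (le_of_eq ?_)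
    have := (r0 k).ne'
    field_simp; ring
  have hp : ∀ k n m, k ≤ n → k ≤ m → ∀ z ∈ DB, ‖((T n).sub (T m)).p z‖ ≤ 2 * (r k ^ 3 / 2) + 2 * (2 * r k + 3 * (N * √(r k))) := by
    intro k n m hn hm z hz
    exact ((hT n).sub (hT m)).vd.interp1 (hQ k n m hn hm) (hV k n m hn hm) z hz
  have et : Filter.Tendsto (fun k => 2 * (r k ^ 3 / 2) + 2 * (2 * r k + 3 * (N * √(r k)))) Filter.atTop (nhds 0) := by
    have c : Continuous (fun x : ℝ => 2 * (x ^ 3 / 2) + 2 * (2 * x + 3 * (N * √x))) := by fun_prop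
    have := (c.tendsto 0).comp rt
    have z : (2 * ((0 : ℝ) ^ 3 / 2) + 2 * (2 * 0 + 3 * (N * √0))) = 0 := by simp
    rw [z] at this
    exact this
  have pos : ∀ k, 0 ≤ r k ^ 3 ∧ 0 ≤ 2 * r k + 3 * (N * √(r k)) := fun k => by
    have := r0 k
    constructor <;> positivity
  obtain ⟨U, hU, hUh, l1, l2, l3⟩ := limit_tr T (fun k => (hT k).vd) (fun k => (hX k).hol) et
    (fun k n m h1 h2 z hz => (hV k n m h1 h2 z hz).trans (by linarith [(pos k).1, (pos k).2]))
    (fun k n m h1 h2 z hz => hp k n m h1 h2 z hz)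
    (fun k n m h1 h2 z hz => (hQ k n m h1 h2 z hz).trans (by linarith [(pos k).1, (pos k).2]))
  refine ⟨U, ⟨hU, _, by positivity, hUh⟩, fun z hz => ?_⟩
  have a1 : Filter.Tendsto (fun k => trC ((T k).Q z)) Filter.atTop (nhds (trC (U.Q z))) := (trC.continuous.tendsto _).comp (l3 z hz)
  refine tendsto_nhds_unique a1 ?_
  rw [tendsto_iff_norm_sub_tendsto_zero]
  have c : Filter.Tendsto (fun k => r k ^ 3) Filter.atTop (nhds 0) := by simpa using rt.pow 3
  refine squeeze_zero (fun _ => norm_nonneg _) (fun k => ?_) c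
  rw [hTe k z hz]; exact hε k z hz

theorem solv_all {lam Lam A : ℝ} {ℓ : ℂ → Cof} (h : Adm lam Lam A ℓ) (hl0 : 0 < lam) (hl : lam ≤ 1) (hL : 1 ≤ Lam) (hA : 0 ≤ A) : Solv ℓ :=
  cont_method h hl0 hl hL hA solv_lap

end MC

/-! part 21 -/

namespace MC
open MeasureTheory

lemma exists_D {V : Type} [NormedAddCommGroup V] [NormedSpace ℝ V] {Φ : V → ℝ} (h : ContDiff ℝ 2 Φ) :
    ∃ D : V → DualN V, ContDiff ℝ 1 D ∧ ∀ x, HasFDerivAt Φ (D x) x :=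
  ⟨fderiv ℝ Φ, h.fderiv_right (by norm_num), fun x => ((h.differentiable (by norm_num)) x).hasFDerivAt⟩

lemma c1_mod {V W : Type} [NormedAddCommGroup V] [NormedSpace ℝ V] [ProperSpace V] [NormedAddCommGroup W] [NormedSpace ℝ W]
    {H : V → W} (hH : ContDiff ℝ 1 H) {r : ℝ} (hr : 0 ≤ r) : ∃ K, 0 ≤ K ∧
      (∀ x y, ‖x‖ ≤ r + 1 → ‖y‖ ≤ r + 1 → ‖H x - H y‖ ≤ K * ‖x - y‖) ∧
      ∀ η, 0 < η → ∃ ρ, 0 < ρ ∧ ρ ≤ 1 ∧ ∀ x y P P', ‖x‖ ≤ r → ‖y‖ ≤ r → ‖P‖ ≤ ρ → ‖P'‖ ≤ ρ →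
        ‖H (x + P) - H x - (H (y + P') - H y)‖ ≤ η * ‖x - y‖ + K * ‖P - P'‖ := by
  have cD : Continuous (fderiv ℝ H) := hH.continuous_fderiv (by norm_num)
  have hd : ∀ x, HasFDerivAt H (fderiv ℝ H x) x := fun x => ((hH.differentiable (by norm_num)) x).hasFDerivAt
  obtain ⟨K, hK⟩ := (isCompact_closedBall (0 : V) (r + 1)).exists_bound_of_continuousOn cD.continuousOn
  have K0 : 0 ≤ K := (norm_nonneg _).trans (hK 0 (by simp; linarith))
  have uc := (isCompact_closedBall (0 : V) (r + 1)).uniformContinuousOn_of_continuous cD.continuousOn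
  rw [Metric.uniformContinuousOn_iff] at uc
  refine ⟨K, K0, fun x y hx hy => ?_, fun η hη => ?_⟩
  · exact Convex.norm_image_sub_le_of_norm_hasFDerivWithin_le (fun z _ => (hd z).hasFDerivWithinAt) hK (convex_closedBall 0 (r + 1))
      (mem_closedBall_zero_iff.2 hy) (mem_closedBall_zero_iff.2 hx)
  · obtain ⟨δ, hδ, huc⟩ := uc η hη
    refine ⟨min 1 (δ / 2), by positivity, min_le_left _ _, fun x y P P' hx hy hP hP' => ?_⟩
    have m1 : min 1 (δ / 2) ≤ 1 := min_le_left _ _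
    have m2 : min 1 (δ / 2) ≤ δ / 2 := min_le_right _ _
    let a : ℝ → V := fun s => (y + P') + s • ((x + P) - (y + P'))
    let b : ℝ → V := fun s => y + s • (x - y)
    have da : ∀ s, HasDerivAt a ((x + P) - (y + P')) s := fun s => by
      have := ((hasDerivAt_id s).smul_const ((x + P) - (y + P'))).const_add (y + P')
      rw [one_smul] at this; exact this
    have db : ∀ s, HasDerivAt b (x - y) s := fun s => by
      have := ((hasDerivAt_id s).smul_const (x - y)).const_add y
      rw [one_smul] at this; exact this
    have dg : ∀ s, HasDerivAt (fun s => H (a s) - H (b s)) (fderiv ℝ H (a s) ((x + P) - (y + P')) - fderiv ℝ H (b s) (x - y)) s := fun s =>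
      ((hd (a s)).comp_hasDerivAt s (da s)).sub ((hd (b s)).comp_hasDerivAt s (db s))
    have bd : ∀ s ∈ Ico (0 : ℝ) 1, ‖fderiv ℝ H (a s) ((x + P) - (y + P')) - fderiv ℝ H (b s) (x - y)‖ ≤ η * ‖x - y‖ + K * ‖P - P'‖ := by
      rintro s ⟨s0, s1⟩
      have s1' : 0 ≤ 1 - s := by linarith
      have cvx : ∀ (p q : V) (R : ℝ), ‖p‖ ≤ R → ‖q‖ ≤ R → ‖(1 - s) • p + s • q‖ ≤ R := by
        intro p q R hp hq
        refine (norm_add_le _ _).trans ?_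
        rw [norm_smul, norm_smul, Real.norm_eq_abs, Real.norm_eq_abs, abs_of_nonneg s0, abs_of_nonneg s1']
        nlinarith
      have ea : a s = (1 - s) • (y + P') + s • (x + P) := by
        change (y + P') + s • ((x + P) - (y + P')) = _
        rw [smul_sub, sub_smul, one_smul]; abel
      have eb : b s = (1 - s) • y + s • x := by
        change y + s • (x - y) = _
        rw [smul_sub, sub_smul, one_smul]; abel
      have na : ‖a s‖ ≤ r + 1 := by
        rw [ea]; exact cvx _ _ _ ((norm_add_le _ _).trans (by linarith)) ((norm_add_le _ _).trans (by linarith))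
      have nb : ‖b s‖ ≤ r + 1 := by rw [eb]; exact cvx _ _ _ (by linarith) (by linarith)
      have nab : ‖a s - b s‖ ≤ δ / 2 := by
        have : a s - b s = (1 - s) • P' + s • P := by rw [ea, eb, smul_add, smul_add]; abel
        rw [this]; exact cvx _ _ _ (by linarith) (by linarith)
      have h1 := huc (a s) (mem_closedBall_zero_iff.2 na) (b s) (mem_closedBall_zero_iff.2 nb) (by rw [dist_eq_norm]; linarith)
      rw [dist_eq_norm] at h1
      have e : fderiv ℝ H (a s) ((x + P) - (y + P')) - fderiv ℝ H (b s) (x - y) =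
          (fderiv ℝ H (a s) - fderiv ℝ H (b s)) (x - y) + fderiv ℝ H (a s) (P - P') := by
        rw [sub_apply, show (x + P) - (y + P') = (x - y) + (P - P') by abel, map_add]; abel
      rw [e]
      refine (norm_add_le _ _).trans (add_le_add ?_ ?_)
      · exact ((fderiv ℝ H (a s) - fderiv ℝ H (b s)).le_opNorm _).trans (mul_le_mul_of_nonneg_right h1.le (norm_nonneg _))
      · exact ((fderiv ℝ H (a s)).le_opNorm _).trans (mul_le_mul_of_nonneg_right (hK _ (mem_closedBall_zero_iff.2 na)) (norm_nonneg _))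
    have := norm_image_sub_le_of_norm_deriv_le_segment_01' (fun s _ => (dg s).hasDerivWithinAt) bd
    simp only [a, b, one_smul, zero_smul, add_zero] at this
    refine le_trans (le_of_eq ?_) this
    congr 1
    rw [show y + P' + (x + P - (y + P')) = x + P by abel, show y + (x - y) = x by abel]

lemma Yb_mvt {e d : ℝ → ℂ → ℝ} {M : ℝ} (hd : ∀ s ∈ Icc (0 : ℝ) 1, ∀ z ∈ DB, HasDerivAt (fun s => e s z) (d s z) s)
    (hY : ∀ s ∈ Icc (0 : ℝ) 1, Yb (d s) M) : Yb (fun z => e 1 z - e 0 z) M := by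
  refine ⟨fun z hz => ?_, fun z hz w hw => ?_⟩
  · exact norm_image_sub_le_of_norm_deriv_le_segment_01' (f := fun s => e s z) (fun s hs => (hd s hs z hz).hasDerivWithinAt)
      (fun s hs => (hY s ⟨hs.1, hs.2.le⟩).b z hz)
  · have := norm_image_sub_le_of_norm_deriv_le_segment_01' (f := fun s => e s z - e s w) (fun s hs => ((hd s hs z hz).sub (hd s hs w hw)).hasDerivWithinAt)
      (fun s hs => (hY s ⟨hs.1, hs.2.le⟩).hol z hz w hw)
    rw [Real.norm_eq_abs] at this
    rw [show e 1 z - e 0 z - (e 1 w - e 0 w) = e 1 z - e 1 w - (e 0 z - e 0 w) by ring]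
    exact this

instance propBil : ProperSpace Bil := FiniteDimensional.proper ℝ Bil

end MC

/-! part 22 -/

namespace MC
open MeasureTheory

lemma sqrt_le_two_DB {z w : ℂ} (hz : z ∈ DB) (hw : w ∈ DB) : √‖z - w‖ ≤ 2 := by
  have h1 := mem_closedBall_zero_iff.1 hz
  have h2 := mem_closedBall_zero_iff.1 hw
  exact Real.sqrt_le_iff.2 ⟨by norm_num, (norm_sub_le _ _).trans (by linarith)⟩

lemma hasDeriv_line (Ψ : Bil → ℝ) (D : Bil → Cof) (hD : ∀ B, HasFDerivAt Ψ (D B) B) (a q : Bil) (s : ℝ) :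
    HasDerivAt (fun s : ℝ => Ψ (a + s • q)) (D (a + s • q) q) s := by
  have l : HasDerivAt (fun s : ℝ => a + s • q) q s := by
    have := ((hasDerivAt_id s).smul_const q).const_add a
    rw [one_smul] at this; exact this
  exact (hD (a + s • q)).comp_hasDerivAt s l

set_option maxHeartbeats 2000000 in
theorem nonlin {lam Lam : ℝ} (hl0 : 0 < lam) (hl : lam ≤ 1) (hL : 1 ≤ Lam) (Φ : Bil → ℝ) (D : Bil → Cof) (hD1 : ContDiff ℝ 1 D)
    (hD : ∀ B, HasFDerivAt Φ (D B) B) (hell : ∀ B : Bil, (∀ a b, B a b = B b a) → Ell lam Lam (D B))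
    (Q0 : ℂ → Bil) {N0 : ℝ} (hN0 : 0 ≤ N0) (hQ0 : HolD Q0 N0) (hsym : ∀ z ∈ DB, ∀ a b, Q0 z a b = Q0 z b a)
    {t0 : ℝ} (ht0 : 0 ≤ t0) (ht1 : t0 ≤ 1) (h0 : ∀ z ∈ DB, trC (Q0 z) + t0 * (Φ (Q0 z) - trC (Q0 z)) = 0) :
    ∃ ε, 0 < ε ∧ ∀ t, 0 ≤ t → t ≤ 1 → |t - t0| ≤ ε → ∃ T, Good T ∧ ∀ z ∈ DB, trC (Q0 z + T.Q z) + t * (Φ (Q0 z + T.Q z) - trC (Q0 z + T.Q z)) = 0 := by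
  set r := ‖Q0 0‖ + 2 * N0 with hr
  have r0 : 0 ≤ r := by positivity
  have br : ∀ z ∈ DB, ‖Q0 z‖ ≤ r := by
    intro z hz
    have h1 := hQ0 z hz 0 zero_mem_DB
    have h2 := sqrt_le_two_DB hz zero_mem_DB
    have h3 : ‖Q0 z‖ ≤ ‖Q0 z - Q0 0‖ + ‖Q0 0‖ := by
      calc ‖Q0 z‖ = ‖(Q0 z - Q0 0) + Q0 0‖ := by congr 1; abel
        _ ≤ _ := norm_add_le _ _
    have h4 : N0 * √‖z - 0‖ ≤ N0 * 2 := mul_le_mul_of_nonneg_left h2 hN0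
    linarith
  obtain ⟨K, K0, hK, hmod⟩ := c1_mod hD1 r0
  have hΦ1 : ContDiff ℝ 1 Φ := by
    rw [contDiff_one_iff_hasFDerivAt]
    exact ⟨D, hD1.continuous, hD⟩
  obtain ⟨K', K0', hK', -⟩ := c1_mod hΦ1 r0
  -- admissibility
  have adm : Adm lam Lam (K * N0) (fun z => D (Q0 z)) := by
    refine ⟨fun z hz => hell _ (hsym z hz), fun z hz w hw => ?_⟩
    refine (hK _ _ ((br z hz).trans (by linarith)) ((br w hw).trans (by linarith))).trans ?_
    rw [mul_assoc]; exact mul_le_mul_of_nonneg_left (hQ0 z hz w hw) K0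
  have A0 : 0 ≤ K * N0 := by positivity
  have adm0 := ls_adm (s := t0) adm hl hL A0 ht0 ht1
  have solv := solv_all adm0 hl0 hl hL A0
  obtain ⟨C, hC, hae⟩ := apriori' lam Lam (K * N0) hl0 (hl.trans hL) A0
  have ae := hae _ adm0
  -- bound on linear part
  set K3 := ‖D (Q0 0)‖ + 2 * (K * N0) + ‖trC‖ with hK3
  have bD : ∀ z ∈ DB, ‖D (Q0 z) - trC‖ ≤ K3 := by
    intro z hz
    have h1 := adm.hol z hz 0 zero_mem_DB
    have h2 := sqrt_le_two_DB hz zero_mem_DB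
    have h3 : ‖D (Q0 z) - D (Q0 0)‖ ≤ 2 * (K * N0) := h1.trans (by nlinarith)
    calc ‖D (Q0 z) - trC‖ = ‖(D (Q0 z) - D (Q0 0)) + D (Q0 0) - trC‖ := by congr 1; abel
      _ ≤ ‖(D (Q0 z) - D (Q0 0)) + D (Q0 0)‖ + ‖trC‖ := norm_sub_le _ _
      _ ≤ ‖D (Q0 z) - D (Q0 0)‖ + ‖D (Q0 0)‖ + ‖trC‖ := add_le_add (norm_add_le _ _) le_rfl
      _ ≤ K3 := by rw [hK3]; linarith
  have hDd : ∀ z ∈ DB, ∀ w ∈ DB, ‖(D (Q0 z) - trC) - (D (Q0 w) - trC)‖ ≤ (K * N0) * √‖z - w‖ := by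
    intro z hz w hw
    have e : (D (Q0 z) - trC) - (D (Q0 w) - trC) = D (Q0 z) - D (Q0 w) := by abel
    rw [e]; exact adm.hol z hz w hw
  have K30 : 0 ≤ K3 := by positivity
  -- bound on right-hand side at zero
  obtain ⟨K1, hK1⟩ : ∃ K1, Yb (fun z => Φ (Q0 z) - trC (Q0 z)) K1 := by
    have b1 : ∀ z ∈ DB, ∀ w ∈ DB, |(Φ (Q0 z) - trC (Q0 z)) - (Φ (Q0 w) - trC (Q0 w))| ≤ (K' + ‖trC‖) * N0 * √‖z - w‖ := by
      intro z hz w hw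
      have a1 := hK' _ _ ((br z hz).trans (by linarith)) ((br w hw).trans (by linarith))
      have a2 := trC.le_opNorm (Q0 z - Q0 w)
      rw [cof_sub] at a2
      rw [Real.norm_eq_abs] at a1 a2
      have a3 := hQ0 z hz w hw
      have e : (Φ (Q0 z) - trC (Q0 z)) - (Φ (Q0 w) - trC (Q0 w)) = (Φ (Q0 z) - Φ (Q0 w)) - (trC (Q0 z) - trC (Q0 w)) := by ring
      rw [e]
      have n0 : 0 ≤ K' + ‖trC‖ := by positivity
      calc _ ≤ |Φ (Q0 z) - Φ (Q0 w)| + |trC (Q0 z) - trC (Q0 w)| := abs_sub _ _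
        _ ≤ (K' + ‖trC‖) * ‖Q0 z - Q0 w‖ := by linarith
        _ ≤ (K' + ‖trC‖) * (N0 * √‖z - w‖) := mul_le_mul_of_nonneg_left a3 n0
        _ = _ := by ring
    have n1 : 0 ≤ (K' + ‖trC‖) * N0 := by positivity
    refine ⟨|Φ (Q0 0) - trC (Q0 0)| + 2 * ((K' + ‖trC‖) * N0), fun z hz => ?_, fun z hz w hw => ?_⟩
    · have a1 := b1 z hz 0 zero_mem_DB
      have a2 := sqrt_le_two_DB hz zero_mem_DB
      have a3 := abs_sub_abs_le_abs_sub (Φ (Q0 z) - trC (Q0 z)) (Φ (Q0 0) - trC (Q0 0))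
      have a4 : (K' + ‖trC‖) * N0 * √‖z - 0‖ ≤ (K' + ‖trC‖) * N0 * 2 := mul_le_mul_of_nonneg_left a2 n1
      linarith
    · refine (b1 z hz w hw).trans (mul_le_mul_of_nonneg_right ?_ (Real.sqrt_nonneg _))
      linarith [abs_nonneg (Φ (Q0 0) - trC (Q0 0))]
  have K10 := hK1.nonneg
  set κ := 1 / (2 * (C + 1)) with hκ
  have κ0 : 0 < κ := by positivity
  obtain ⟨ρ1, hρ1, hρ11, hm⟩ := hmod (κ / (4 * (N0 + 1))) (by positivity)
  set ρ := min ρ1 (κ / (8 * (K + 1))) with hρ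
  have ρ0 : 0 < ρ := by positivity
  have ρa : ρ ≤ ρ1 := min_le_left _ _
  have ρb : 2 * (K * ρ) ≤ κ / 4 := by
    have h1 : ρ ≤ κ / (8 * (K + 1)) := min_le_right _ _
    rw [le_div_iff₀ (by positivity)] at h1
    nlinarith
  have ηb : κ / (4 * (N0 + 1)) * N0 ≤ κ / 4 := by
    rw [div_mul_eq_mul_div, div_le_div_iff₀ (by positivity) (by norm_num)]
    nlinarith
  set ε := min (κ / (4 * (K3 + K * N0 + 1))) (ρ * κ / (K1 + 1)) with hε
  have ε0 : 0 < ε := by positivity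
  have εa : ε * (K3 + K * N0) ≤ κ / 4 := by
    have h1 : ε ≤ κ / (4 * (K3 + K * N0 + 1)) := min_le_left _ _
    rw [le_div_iff₀ (by positivity)] at h1
    nlinarith
  have εb : ε * K1 ≤ ρ * κ := by
    have h1 : ε ≤ ρ * κ / (K1 + 1) := min_le_right _ _
    rw [le_div_iff₀ (by positivity)] at h1
    nlinarith
  refine ⟨ε, ε0, fun t htt0 htt1 ht => ?_⟩
  obtain ⟨T, hT, -, hTe⟩ := fixpt hC ae solv ρ0.le
    (fun Q z => t0 * ((D (Q0 z) - trC) (Q z)) - t * (Φ (Q0 z + Q z) - trC (Q0 z + Q z)) - trC (Q0 z)) (by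
      intro T U M hT hU hTρ hUρ hM
      have M0 := hM.nonneg
      have y1 := (Yb_cof bD hDd A0 M0 hM.hQ hM.hol).smul (t0 - t)
      have y2 : Yb (fun z => (Φ ((Q0 z + U.Q z) + (1 : ℝ) • (T.Q z - U.Q z)) - 1 * D (Q0 z) (T.Q z - U.Q z)) -
          (Φ ((Q0 z + U.Q z) + (0 : ℝ) • (T.Q z - U.Q z)) - 0 * D (Q0 z) (T.Q z - U.Q z))) ((K * ρ + (κ / (4 * (N0 + 1)) * N0 + K * ρ)) * M) := by
        refine Yb_mvt (e := fun s z => Φ ((Q0 z + U.Q z) + s • (T.Q z - U.Q z)) - s * D (Q0 z) (T.Q z - U.Q z))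
          (d := fun s z => (D ((Q0 z + U.Q z) + s • (T.Q z - U.Q z)) - D (Q0 z)) (T.Q z - U.Q z)) ?_ ?_
        · intro s _ z hz
          have h1 := hasDeriv_line Φ D hD (Q0 z + U.Q z) (T.Q z - U.Q z) s
          have h2 := (hasDerivAt_id s).mul_const (D (Q0 z) (T.Q z - U.Q z))
          rw [one_mul] at h2
          exact h1.sub h2
        · rintro s ⟨s0, s1⟩
          have s1' : 0 ≤ 1 - s := by linarith
          have eP : ∀ z, (Q0 z + U.Q z) + s • (T.Q z - U.Q z) = Q0 z + ((1 - s) • U.Q z + s • T.Q z) := by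
            intro z
            rw [smul_sub, sub_smul, one_smul]; abel
          have cvx : ∀ (p q : Bil) (R : ℝ), ‖p‖ ≤ R → ‖q‖ ≤ R → ‖(1 - s) • p + s • q‖ ≤ R := by
            intro p q R hp hq
            refine (norm_add_le _ _).trans ?_
            rw [norm_smul, norm_smul, Real.norm_eq_abs, Real.norm_eq_abs, abs_of_nonneg s0, abs_of_nonneg s1']
            nlinarith
          have nP : ∀ z ∈ DB, ‖(1 - s) • U.Q z + s • T.Q z‖ ≤ ρ := fun z hz => cvx _ _ _ (hUρ.hQ z hz) (hTρ.hQ z hz)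
          have hP : ∀ z ∈ DB, ∀ w ∈ DB, ‖((1 - s) • U.Q z + s • T.Q z) - ((1 - s) • U.Q w + s • T.Q w)‖ ≤ ρ * √‖z - w‖ := by
            intro z hz w hw
            have e : ((1 - s) • U.Q z + s • T.Q z) - ((1 - s) • U.Q w + s • T.Q w) = (1 - s) • (U.Q z - U.Q w) + s • (T.Q z - T.Q w) := by
              rw [smul_sub, smul_sub]; abel
            rw [e]
            exact cvx _ _ _ (hUρ.hol z hz w hw) (hTρ.hol z hz w hw)
          simp only [eP]
          refine Yb_cof (D := fun z => D (Q0 z + ((1 - s) • U.Q z + s • T.Q z)) - D (Q0 z)) (q := fun z => T.Q z - U.Q z) ?_ ?_ (by positivity) M0 hM.hQ hM.hol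
          · intro z hz
            have n1 := nP z hz
            refine (hK _ _ ((norm_add_le _ _).trans (by linarith [br z hz])) ((br z hz).trans (by linarith))).trans ?_
            rw [add_sub_cancel_left]
            exact mul_le_mul_of_nonneg_left n1 K0
          · intro z hz w hw
            refine (hm _ _ _ _ (br z hz) (br w hw) ((nP z hz).trans ρa) ((nP w hw).trans ρa)).trans ?_
            rw [add_mul, mul_assoc, mul_assoc]
            exact add_le_add (mul_le_mul_of_nonneg_left (hQ0 z hz w hw) (by positivity)) (mul_le_mul_of_nonneg_left (hP z hz w hw) K0)
      have y3 := y1.add (y2.smul (-t))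
      refine (y3.congr fun z hz => ?_).mono ?_
      · change _ = (t0 - t) * ((D (Q0 z) - trC) (T.Q z - U.Q z)) + _
        have e1 : (Q0 z + U.Q z) + (1 : ℝ) • (T.Q z - U.Q z) = Q0 z + T.Q z := by rw [one_smul]; abel
        have e0 : (Q0 z + U.Q z) + (0 : ℝ) • (T.Q z - U.Q z) = Q0 z + U.Q z := by rw [zero_smul]; abel
        rw [e1, e0]
        simp only [cof_sub, sub_apply, map_add]
        ring
      · have q1 : |t0 - t| * ((K3 + K * N0) * M) ≤ κ / 4 * M := by
          rw [abs_sub_comm, ← mul_assoc]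
          refine mul_le_mul_of_nonneg_right (le_trans ?_ εa) M0
          exact mul_le_mul_of_nonneg_right ht (by positivity)
        have q2 : (K * ρ + (κ / (4 * (N0 + 1)) * N0 + K * ρ)) * M ≤ κ / 2 * M := mul_le_mul_of_nonneg_right (by linarith) M0
        have q3 : |-t| * ((K * ρ + (κ / (4 * (N0 + 1)) * N0 + K * ρ)) * M) ≤ 1 * (κ / 2 * M) := by
          rw [abs_neg, abs_of_nonneg htt0]
          exact mul_le_mul htt1 q2 (by positivity) zero_le_one
        have q4 : M / (2 * (C + 1)) = κ * M := by rw [hκ]; ring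
        rw [q4]
        have : 0 ≤ κ * M := by positivity
        linarith) (by
      refine ((hK1.smul (t0 - t)).congr fun z hz => ?_).mono ?_
      · have z0 : Tr.zero.Q z = 0 := rfl
        rw [z0, map_zero, add_zero]
        have := h0 z hz
        linarith
      · have q4 : ρ / (2 * (C + 1)) = ρ * κ := by rw [hκ]; ring
        rw [q4, abs_sub_comm]
        exact (mul_le_mul_of_nonneg_right ht K10).trans εb)
  refine ⟨T, hT, fun z hz => ?_⟩
  have := hTe z hz
  rw [ls_apply] at this
  simp only [sub_apply] at this
  rw [map_add] at this ⊢
  linarith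

end MC

/-! part 23 -/

namespace MC
open MeasureTheory

lemma eig_form (A : Mat2) (h : A.IsHermitian) (i : Fin 2) : ∃ x : Fin 2 → ℝ, h.eigenvalues i = x ⬝ᵥ A.mulVec x := by
  refine ⟨⇑(h.eigenvectorBasis i), ?_⟩
  have := h.eigenvalues_eq i
  simpa using this

lemma trace_eig (A : Mat2) (h : A.IsHermitian) : A.trace = ∑ i, h.eigenvalues i := by
  have := h.trace_eq_sum_eigenvalues
  simpa using this

lemma pos_pn (A : Mat2) (h : A.IsHermitian) (hp : ∀ x : Fin 2 → ℝ, 0 ≤ x ⬝ᵥ A.mulVec x) : posNorm A = A.trace ∧ negNorm A = 0 := by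
  have e : ∀ i, 0 ≤ h.eigenvalues i := fun i => by
    obtain ⟨x, hx⟩ := eig_form A h i
    rw [hx]; exact hp x
  constructor
  · rw [posNorm, dif_pos h, trace_eig A h]
    exact Finset.sum_congr rfl fun i _ => max_eq_left (e i)
  · rw [negNorm, dif_pos h]
    exact Finset.sum_eq_zero fun i _ => max_eq_right (by linarith [e i])

lemma neg_pn (A : Mat2) (h : A.IsHermitian) (hp : ∀ x : Fin 2 → ℝ, x ⬝ᵥ A.mulVec x ≤ 0) : posNorm A = 0 ∧ negNorm A = -A.trace := by
  have e : ∀ i, h.eigenvalues i ≤ 0 := fun i => by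
    obtain ⟨x, hx⟩ := eig_form A h i
    rw [hx]; exact hp x
  constructor
  · rw [posNorm, dif_pos h]
    exact Finset.sum_eq_zero fun i _ => max_eq_right (e i)
  · rw [negNorm, dif_pos h, trace_eig A h, ← Finset.sum_neg_distrib]
    exact Finset.sum_congr rfl fun i _ => max_eq_left (by linarith [e i])

def bs : Fin 2 → ℂ := ![1, Complex.I]

/-- matrix of a bilinear form, as a plain function -/
def bm (B : Bil) : Fin 2 → Fin 2 → ℝ := fun i j => B (bs i) (bs j)

lemma bs_norm (i : Fin 2) : ‖bs i‖ = 1 := by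
  fin_cases i <;> simp [bs]

def bmL : Bil →L[ℝ] (Fin 2 → Fin 2 → ℝ) := LinearMap.mkContinuous (E := Bil)
  { toFun := bm
    map_add' := fun B C => rfl
    map_smul' := fun c B => rfl } 1 (by
  intro B
  rw [one_mul]
  change ‖bm B‖ ≤ ‖B‖
  rw [pi_norm_le_iff_of_nonneg (by positivity)]
  intro i
  rw [pi_norm_le_iff_of_nonneg (by positivity)]
  intro j
  have := B.le_opNorm₂ (bs i) (bs j)
  rwa [bs_norm, bs_norm, mul_one, mul_one] at this)

lemma bm_le (B : Bil) (i j : Fin 2) : |bm B i j| ≤ ‖B‖ := by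
  have := B.le_opNorm₂ (bs i) (bs j)
  rwa [bs_norm, bs_norm, mul_one, mul_one] at this

def mb (H : Fin 2 → Fin 2 → ℝ) : Bil := H 0 0 • ten 1 1 + H 0 1 • ten 1 Complex.I + H 1 0 • ten Complex.I 1 + H 1 1 • ten Complex.I Complex.I

lemma mb_apply (H : Fin 2 → Fin 2 → ℝ) (a b : ℂ) : mb H a b = H 0 0 * (a.re * b.re) + H 0 1 * (a.re * b.im) + H 1 0 * (a.im * b.re) + H 1 1 * (a.im * b.im) := by
  unfold mb
  simp only [add_apply, smul_apply, ten_apply, smul_eq_mul]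
  simp

lemma bm_mb (H : Fin 2 → Fin 2 → ℝ) : bm (mb H) = H := by
  ext i j
  unfold bm
  rw [mb_apply]
  fin_cases i <;> fin_cases j <;> simp [bs]

lemma ten_norm (η θ : ℂ) : ‖ten η θ‖ ≤ ‖η‖ * ‖θ‖ := by
  refine ContinuousLinearMap.opNorm_le_bound₂ _ (by positivity) fun a b => ?_
  rw [ten_apply, norm_mul]
  have h : ∀ x y : ℂ, ‖(x.re * y.re + x.im * y.im : ℝ)‖ ≤ ‖x‖ * ‖y‖ := by
    intro x y
    have := norm_inner_le_norm (𝕜 := ℝ) x y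
    rw [Complex.inner] at this
    simpa [mul_comm] using this
  calc _ ≤ (‖η‖ * ‖a‖) * (‖θ‖ * ‖b‖) := mul_le_mul (h η a) (h θ b) (by positivity) (by positivity)
    _ = _ := by ring

lemma mb_norm (H : Fin 2 → Fin 2 → ℝ) : ‖mb H‖ ≤ matNorm (Matrix.of H) := by
  unfold mb matNorm
  simp only [Fin.sum_univ_two, Matrix.of_apply]
  have t : ∀ (c : ℝ) (η θ : ℂ), ‖η‖ = 1 → ‖θ‖ = 1 → ‖c • ten η θ‖ ≤ |c| := by
    intro c η θ h1 h2
    have := ten_norm η θ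
    rw [h1, h2, mul_one] at this
    rw [norm_smul, Real.norm_eq_abs]
    exact mul_le_of_le_one_right (abs_nonneg _) this
  have n1 : ‖(1 : ℂ)‖ = 1 := norm_one
  have nI : ‖Complex.I‖ = 1 := Complex.norm_I
  refine (norm_add_le _ _).trans ((add_le_add ((norm_add_le _ _).trans (add_le_add (norm_add_le _ _) le_rfl)) le_rfl).trans ?_)
  linarith [t (H 0 0) 1 1 n1 n1, t (H 0 1) 1 Complex.I n1 nI, t (H 1 0) Complex.I 1 nI n1, t (H 1 1) Complex.I Complex.I nI nI]

lemma mb_sub (H H' : Fin 2 → Fin 2 → ℝ) : mb H - mb H' = mb (H - H') := by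
  apply bil_ext
  intro a b
  change mb H a b - mb H' a b = _
  simp only [mb_apply, Pi.sub_apply]; ring

lemma trC_bm (B : Bil) : trC B = bm B 0 0 + bm B 1 1 := by
  rw [trC_apply]; simp [bm, bs]

lemma bm_matNorm (B : Bil) : matNorm (Matrix.of (bm B)) ≤ 4 * ‖B‖ := by
  unfold matNorm
  simp only [Fin.sum_univ_two, Matrix.of_apply]
  linarith [bm_le B 0 0, bm_le B 0 1, bm_le B 1 0, bm_le B 1 1]

lemma ell_of_unif {lam Lam : ℝ} {F : Mat2 → ℝ} (hF : UniformlyElliptic lam Lam F) {D : Bil → Cof}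
    (hD : ∀ B, HasFDerivAt (fun B : Bil => F (Matrix.of (bm B))) (D B) B) (B : Bil) (hB : ∀ a b, B a b = B b a) :
    Ell lam Lam (D B) := by
  intro η
  have hder := (hasDeriv_line (fun B : Bil => F (Matrix.of (bm B))) D hD B (ten η η) 0).tendsto_slope_zero_right
  simp only [zero_add, zero_smul, add_zero, smul_eq_mul] at hder
  have key : ∀ s : ℝ, 0 < s → lam * ‖η‖ ^ 2 * s ≤ F (Matrix.of (bm (B + s • ten η η))) - F (Matrix.of (bm B)) ∧
      F (Matrix.of (bm (B + s • ten η η))) - F (Matrix.of (bm B)) ≤ Lam * ‖η‖ ^ 2 * s := by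
    intro s hs
    have sN : (Matrix.of (bm B) : Mat2).IsHermitian := by
      ext i j
      simp [Matrix.conjTranspose, bm, hB (bs j) (bs i)]
    have sM : (Matrix.of (bm (B + s • ten η η)) : Mat2).IsHermitian := by
      ext i j
      simp only [Matrix.conjTranspose_apply, Matrix.of_apply, bm, star_trivial, add_apply, smul_apply, ten_apply, hB (bs j) (bs i), smul_eq_mul]
      ring
    have dA : (Matrix.of (bm (B + s • ten η η)) - Matrix.of (bm B) : Mat2) = Matrix.of (fun i j => s * (ten η η (bs i) (bs j))) := by
      ext i j
      simp only [Matrix.sub_apply, Matrix.of_apply, bm, add_apply, smul_apply, smul_eq_mul]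
      ring
    have dA' : (Matrix.of (bm B) - Matrix.of (bm (B + s • ten η η)) : Mat2) = -Matrix.of (fun i j => s * (ten η η (bs i) (bs j))) := by
      rw [← dA]; abel
    set A : Mat2 := Matrix.of (fun i j => s * (ten η η (bs i) (bs j))) with hA
    have hAh : A.IsHermitian := by rw [← dA]; exact sM.sub sN
    have tr : A.trace = ‖η‖ ^ 2 * s := by
      rw [Complex.sq_norm, Complex.normSq_apply]
      simp [hA, Matrix.trace, ten_apply, bs]; ring
    have q : ∀ x : Fin 2 → ℝ, x ⬝ᵥ A.mulVec x = s * (η.re * x 0 + η.im * x 1) ^ 2 := by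
      intro x
      simp [hA, Matrix.mulVec, dotProduct, ten_apply, bs]; ring
    have p1 := pos_pn A hAh (fun x => by rw [q]; positivity)
    have p2 := neg_pn (-A) hAh.neg (fun x => by
      rw [Matrix.neg_mulVec, dotProduct_neg, q]
      have : 0 ≤ s * (η.re * x 0 + η.im * x 1) ^ 2 := by positivity
      linarith)
    have f1 := hF _ _ sM sN
    have f2 := hF _ _ sN sM
    rw [dA, p1.1, p1.2, tr] at f1
    rw [dA', p2.1, p2.2, Matrix.trace_neg, tr] at f2
    constructor <;> linarith
  constructor
  · refine ge_of_tendsto hder ?_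
    filter_upwards [self_mem_nhdsWithin] with s hs
    rw [mem_Ioi] at hs
    rw [le_inv_mul_iff₀ hs, mul_comm]
    exact (key s hs).1
  · refine le_of_tendsto hder ?_
    filter_upwards [self_mem_nhdsWithin] with s hs
    rw [mem_Ioi] at hs
    rw [inv_mul_le_iff₀ hs, mul_comm s]
    exact (key s hs).2

end MC

/-! part 24 -/

namespace MC
open MeasureTheory

def eC : ℂ ≃ₗᵢ[ℝ] E2 := Complex.orthonormalBasisOneI.repr

lemma eC_bs (i : Fin 2) : eC (bs i) = EuclideanSpace.single i 1 := by
  have h : ⇑Complex.orthonormalBasisOneI = bs := by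
    rw [Complex.coe_orthonormalBasisOneI]; rfl
  rw [← h]
  exact OrthonormalBasis.repr_self _ _

lemma eC_symm_single (i : Fin 2) : eC.symm (EuclideanSpace.single i 1) = bs i := by
  rw [← eC_bs, LinearIsometryEquiv.symm_apply_apply]

def sqn (n : ℕ) : ℝ := 1 - 1 / ((n : ℝ) + 1)

lemma sq_nonneg' (n : ℕ) : 0 ≤ sqn n := by
  unfold sqn
  rw [sub_nonneg, div_le_one (by positivity)]
  linarith [Nat.cast_nonneg (α := ℝ) n]

lemma sq_lt (n : ℕ) : sqn n < 1 := by
  unfold sqn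
  have : 0 < 1 / ((n : ℝ) + 1) := by positivity
  linarith

lemma sq_tendsto : Filter.Tendsto sqn Filter.atTop (nhds 1) := by
  have := tendsto_one_div_add_atTop_nhds_zero_nat (𝕜 := ℝ)
  have h := this.const_sub 1
  rw [sub_zero] at h
  exact h

lemma sq_ball {z : ℂ} (hz : z ∈ DB) (n : ℕ) : sqn n • z ∈ ball (0 : ℂ) 1 := by
  rw [mem_closedBall_zero_iff] at hz
  rw [mem_ball_zero_iff, norm_smul, Real.norm_eq_abs, abs_of_nonneg (sq_nonneg' n)]
  nlinarith [sq_lt n, sq_nonneg' n, norm_nonneg z]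

lemma sq_z (z : ℂ) : Filter.Tendsto (fun n => sqn n • z) Filter.atTop (nhds z) := by
  simpa using sq_tendsto.smul_const z

lemma lim_rad {X : Type*} [TopologicalSpace X] {G : ℂ → X} (hG : ContinuousOn G DB) {z : ℂ} (hz : z ∈ DB) :
    Filter.Tendsto (fun n => G (sqn n • z)) Filter.atTop (nhds (G z)) := by
  refine (hG z hz).tendsto.comp ?_
  refine tendsto_nhdsWithin_iff.2 ⟨sq_z z, Filter.Eventually.of_forall fun n => ball_subset_closedBall (sq_ball hz n)⟩

abbrev cB : Set E2 := closedBall (0 : E2) 1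

lemma ud_ball {V : Type*} [NormedAddCommGroup V] [NormedSpace ℝ V] : UniqueDiffOn ℝ (closedBall (0 : V) 1) :=
  uniqueDiffOn_convex (convex_closedBall _ _) ⟨0, by
    rw [mem_interior_iff_mem_nhds]; exact closedBall_mem_nhds _ one_pos⟩

/-- two derivatives -/
structure D2 (u : E2 → ℝ) (p : E2 → E2 →L[ℝ] ℝ) (W : E2 → E2 →L[ℝ] E2 →L[ℝ] ℝ) : Prop where
  d1 : ∀ x ∈ cB, HasFDerivWithinAt u (p x) cB x
  d2 : ∀ x ∈ cB, HasFDerivWithinAt p (W x) cB x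
  c : ContinuousOn W cB

lemma cB_nhds {x : E2} (hx : x ∈ ball (0 : E2) 1) : cB ∈ nhds x :=
  Filter.mem_of_superset (isOpen_ball.mem_nhds hx) ball_subset_closedBall

variable {u : E2 → ℝ} {p : E2 → E2 →L[ℝ] ℝ} {W : E2 → E2 →L[ℝ] E2 →L[ℝ] ℝ}

lemma D2.hess (h : D2 u p W) {x : E2} (hx : x ∈ ball (0 : E2) 1) :
    hess u x = Matrix.of fun i j => W x (EuclideanSpace.single i 1) (EuclideanSpace.single j 1) := by
  unfold _root_.hess
  congr 1
  funext i j
  have ev : (fun y => fderiv ℝ u y (EuclideanSpace.single j 1)) =ᶠ[nhds x] fun y => p y (EuclideanSpace.single j 1) := by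
    filter_upwards [isOpen_ball.mem_nhds hx] with y hy
    rw [((h.d1 y (ball_subset_closedBall hy)).hasFDerivAt (cB_nhds hy)).fderiv]
  rw [ev.fderiv_eq]
  have := ((h.d2 x (ball_subset_closedBall hx)).hasFDerivAt (cB_nhds hx)).clm_apply (hasFDerivAt_const (EuclideanSpace.single j (1 : ℝ)) x)
  rw [this.fderiv]
  simp

lemma D2.symm (h : D2 u p W) {x : E2} (hx : x ∈ ball (0 : E2) 1) (a b : E2) : W x a b = W x b a := by
  refine second_derivative_symmetric_of_eventually (f := u) (f' := p) (x := x) ?_ ((h.d2 x (ball_subset_closedBall hx)).hasFDerivAt (cB_nhds hx)) a b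
  filter_upwards [isOpen_ball.mem_nhds hx] with y hy
  exact (h.d1 y (ball_subset_closedBall hy)).hasFDerivAt (cB_nhds hy)

lemma D2.contDiffOn (h : D2 u p W) : ContDiffOn ℝ 2 u cB := by
  have w : ∀ x ∈ cB, fderivWithin ℝ u cB x = p x := fun x hx => (h.d1 x hx).fderivWithin (ud_ball x hx)
  have w2 : ∀ x ∈ cB, fderivWithin ℝ p cB x = W x := fun x hx => (h.d2 x hx).fderivWithin (ud_ball x hx)
  have e2 : (2 : WithTop ℕ∞) = 1 + 1 := by norm_num
  have e1 : (1 : WithTop ℕ∞) = 0 + 1 := by norm_num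
  have hp : ContDiffOn ℝ 1 p cB := by
    rw [e1, contDiffOn_succ_iff_fderivWithin ud_ball]
    refine ⟨fun x hx => (h.d2 x hx).differentiableWithinAt, by simp, ?_⟩
    rw [contDiffOn_zero]
    exact h.c.congr w2
  rw [e2, contDiffOn_succ_iff_fderivWithin ud_ball]
  exact ⟨fun x hx => (h.d1 x hx).differentiableWithinAt, by simp, hp.congr w⟩

lemma D2.of (h : ContDiffOn ℝ 2 u cB) : ∃ p W, D2 u p W := by
  have e2 : (2 : WithTop ℕ∞) = 1 + 1 := by norm_num
  have e1 : (1 : WithTop ℕ∞) = 0 + 1 := by norm_num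
  rw [e2, contDiffOn_succ_iff_fderivWithin ud_ball] at h
  obtain ⟨h1, -, h2⟩ := h
  rw [e1, contDiffOn_succ_iff_fderivWithin ud_ball] at h2
  obtain ⟨h3, -, h4⟩ := h2
  exact ⟨_, _, fun x hx => (h1 x hx).hasFDerivWithinAt, fun x hx => (h3 x hx).hasFDerivWithinAt, h4.continuousOn⟩

lemma cont_add_aux {X V : Type*} [TopologicalSpace X] [NormedAddCommGroup V] {f g : X → V} {s : Set X}
    (hf : ContinuousOn f s) (hg : ContinuousOn g s) : ContinuousOn (fun x => f x + g x) s := hf.add hg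

lemma fd_add_aux {X V : Type*} [NormedAddCommGroup X] [NormedSpace ℝ X] [NormedAddCommGroup V] [NormedSpace ℝ V] {f g : X → V}
    {f' g' : X →L[ℝ] V} {s : Set X} {x : X}
    (hf : HasFDerivWithinAt f f' s x) (hg : HasFDerivWithinAt g g' s x) : HasFDerivWithinAt (fun x => f x + g x) (f' + g') s x := hf.add hg

lemma D2.add {u' : E2 → ℝ} {p' : E2 → E2 →L[ℝ] ℝ} {W' : E2 → E2 →L[ℝ] E2 →L[ℝ] ℝ} (h : D2 u p W) (h' : D2 u' p' W') :
    D2 (fun x => u x + u' x) (fun x => p x + p' x) (fun x => W x + W' x) :=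
  by
  refine ⟨fun x hx => (h.d1 x hx).add (h'.d1 x hx), ?_, ?_⟩
  · exact fun x hx => fd_add_aux (h.d2 x hx) (h'.d2 x hx)
  · exact cont_add_aux (V := E2 →L[ℝ] E2 →L[ℝ] ℝ) (s := cB) (f := W) (g := W') h.c h'.c

def eI : E2 →L[ℝ] ℂ := (eC.symm.toContinuousLinearEquiv : E2 →L[ℝ] ℂ)

lemma eI_apply (x : E2) : eI x = eC.symm x := rfl

lemma eI_maps : MapsTo eI cB DB := by
  intro x hx
  rw [mem_closedBall_zero_iff] at hx ⊢
  rw [eI_apply, LinearIsometryEquiv.norm_map]; exact hx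

def pre : Lin →L[ℝ] (E2 →L[ℝ] ℝ) := (ContinuousLinearMap.compL ℝ E2 ℂ ℝ).flip eI

lemma pre_apply (q : Lin) (a : E2) : pre q a = q (eI a) := rfl

lemma D2.ofGood {T : Tr} (h : Good T) : D2 (fun x => T.v (eI x)) (fun x => pre (T.p (eI x)))
    (fun x => (pre.comp (T.Q (eI x))).comp eI) := by
  obtain ⟨N, -, hN⟩ := h.hol
  refine ⟨fun x hx => ?_, fun x hx => ?_, ?_⟩
  · exact (h.vd.dv _ (eI_maps hx)).comp x eI.hasFDerivWithinAt eI_maps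
  · exact pre.hasFDerivAt.comp_hasFDerivWithinAt x ((h.vd.dp _ (eI_maps hx)).comp x eI.hasFDerivWithinAt eI_maps)
  · have c : ContinuousOn (fun x => T.Q (eI x)) cB := hN.cont.comp eI.continuous.continuousOn eI_maps
    exact (continuousOn_const.clm_comp c).clm_comp continuousOn_const

lemma eC_ball {z : ℂ} (hz : z ∈ ball (0 : ℂ) 1) : eC z ∈ ball (0 : E2) 1 := by
  rw [mem_ball_zero_iff] at hz ⊢; rwa [LinearIsometryEquiv.norm_map]
lemma eC_DB : MapsTo eC DB cB := by
  intro z hz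
  rw [mem_closedBall_zero_iff] at hz ⊢; rwa [LinearIsometryEquiv.norm_map]
lemma eI_ball {x : E2} (hx : x ∈ ball (0 : E2) 1) : eI x ∈ ball (0 : ℂ) 1 := by
  rw [mem_ball_zero_iff] at hx ⊢; rwa [eI_apply, LinearIsometryEquiv.norm_map]

/-- matrix of W -/
def hm (W : E2 → E2 →L[ℝ] E2 →L[ℝ] ℝ) (x : E2) : Fin 2 → Fin 2 → ℝ :=
  fun i j => W x (EuclideanSpace.single i 1) (EuclideanSpace.single j 1)

lemma mb_cont : Continuous mb := by
  unfold mb; fun_prop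

lemma hm_cont (h : ContinuousOn W cB) : ContinuousOn (fun z => mb (hm W (eC z))) DB := by
  refine mb_cont.comp_continuousOn ?_
  have c : ContinuousOn (fun z => W (eC z)) DB := h.comp eC.continuous.continuousOn eC_DB
  refine continuousOn_pi.2 fun i => continuousOn_pi.2 fun j => ?_
  exact (c.clm_apply continuousOn_const).clm_apply continuousOn_const

set_option maxHeartbeats 2000000 in
theorem main (lam Lam : ℝ) (hlam : 0 < lam) (hLam : lam ≤ Lam) :
    ∃ α : ℝ, α ∈ Set.Ioo (0 : ℝ) 1 ∧
      ∀ (F : Mat2 → ℝ) (g : E2 → ℝ),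
        ContDiff ℝ 2 (fun A : Fin 2 → Fin 2 → ℝ => F (Matrix.of A)) →
        UniformlyElliptic lam Lam F → F 0 = 0 →
        MemHolderCircle α g →
        ∀ t₀ ∈ Icc (0 : ℝ) 1, SolvesAt α F g t₀ →
          ∃ ε > 0, ∀ t ∈ Icc (0 : ℝ) 1, t ∈ Ioo (t₀ - ε) (t₀ + ε) → SolvesAt α F g t := by
  refine ⟨1 / 2, by norm_num, ?_⟩
  intro F g hF hE _ _ t₀ ht₀ hs
  obtain ⟨u, hu, ⟨H, hH⟩, heq, hg⟩ := hs
  obtain ⟨p, W, hD2⟩ := D2.of hu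
  have hh : ∀ x ∈ ball (0 : E2) 1, hess u x = Matrix.of (hm W x) := fun x hx => hD2.hess hx
  set Q0 : ℂ → Bil := fun z => mb (hm W (eC z)) with hQ0
  have cQ : ContinuousOn Q0 DB := hm_cont hD2.c
  have hol0 : ∀ z ∈ ball (0 : ℂ) 1, ∀ w ∈ ball (0 : ℂ) 1, ‖Q0 z - Q0 w‖ ≤ |H| * √‖z - w‖ := by
    intro z hz w hw
    have h1 := hH _ (eC_ball hz) _ (eC_ball hw)
    rw [hh _ (eC_ball hz), hh _ (eC_ball hw), ← map_sub eC, LinearIsometryEquiv.norm_map, ← Real.sqrt_eq_rpow] at h1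
    simp only [hQ0]
    rw [mb_sub]
    refine (mb_norm _).trans (h1.trans ?_)
    gcongr
    exact le_abs_self H
  have hol : HolD Q0 |H| := by
    intro z hz w hw
    have l1 := ((lim_rad cQ hz).sub (lim_rad cQ hw)).norm
    have l2 : Filter.Tendsto (fun n => |H| * √‖sqn n • z - sqn n • w‖) Filter.atTop (nhds (|H| * √‖z - w‖)) :=
      (((sq_z z).sub (sq_z w)).norm.sqrt).const_mul _
    exact le_of_tendsto_of_tendsto' l1 l2 fun n => hol0 _ (sq_ball hz n) _ (sq_ball hw n)
  have hsym : ∀ z ∈ DB, ∀ a b, Q0 z a b = Q0 z b a := by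
    intro z hz a b
    have l : ∀ a b : ℂ, Filter.Tendsto (fun n => Q0 (sqn n • z) a b) Filter.atTop (nhds (Q0 z a b)) := by
      intro a b
      exact lim_rad ((cQ.clm_apply continuousOn_const).clm_apply continuousOn_const) hz
    refine tendsto_nhds_unique (l a b) ((l b a).congr fun n => ?_)
    simp only [hQ0, mb_apply]
    have : hm W (eC (sqn n • z)) 0 1 = hm W (eC (sqn n • z)) 1 0 := hD2.symm (eC_ball (sq_ball hz n)) _ _
    rw [this]; ring
  set Φ : Bil → ℝ := fun B => F (Matrix.of (bm B)) with hΦ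
  have hΦ2 : ContDiff ℝ 2 Φ := hF.comp bmL.contDiff
  obtain ⟨D, hD1, hD⟩ := exists_D hΦ2
  have hell : ∀ B : Bil, (∀ a b, B a b = B b a) → Ell (min lam 1) (max Lam 1) (D B) := by
    intro B hB η
    obtain ⟨h1, h2⟩ := ell_of_unif hE hD B hB η
    have n : 0 ≤ ‖η‖ ^ 2 := by positivity
    exact ⟨(mul_le_mul_of_nonneg_right (min_le_left _ _) n).trans h1, h2.trans (mul_le_mul_of_nonneg_right (le_max_left _ _) n)⟩
  have h0 : ∀ z ∈ DB, trC (Q0 z) + t₀ * (Φ (Q0 z) - trC (Q0 z)) = 0 := by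
    intro z hz
    have cc : ContinuousOn (fun z => trC (Q0 z) + t₀ * (Φ (Q0 z) - trC (Q0 z))) DB := by
      have c1 : ContinuousOn (fun z => trC (Q0 z)) DB := trC.continuous.comp_continuousOn cQ
      have c2 : ContinuousOn (fun z => Φ (Q0 z)) DB := hΦ2.continuous.comp_continuousOn cQ
      exact c1.add (continuousOn_const.mul (c2.sub c1))
    refine tendsto_nhds_unique (lim_rad cc hz) (tendsto_const_nhds.congr fun n => ?_)
    have hb := eC_ball (sq_ball hz n)
    have := heq _ hb
    rw [lapl, hh _ hb] at this
    simp only [hQ0, hΦ, trC_bm, bm_mb]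
    simp only [Fin.sum_univ_two, Matrix.of_apply] at this
    linarith
  obtain ⟨ε, hε, hmain⟩ := nonlin (lt_min hlam one_pos) (min_le_right _ _) (le_max_right _ _) Φ D hD1 hD hell Q0 (abs_nonneg H) hol hsym ht₀.1 ht₀.2 h0
  refine ⟨ε, hε, fun t ht htt => ?_⟩
  obtain ⟨T, hT, hTe⟩ := hmain t ht.1 ht.2 (abs_le.2 ⟨by linarith [htt.1], by linarith [htt.2]⟩)
  obtain ⟨N, hN0, hN⟩ := hT.hol
  have hDn := hD2.add (D2.ofGood hT)
  have hn : ∀ x ∈ ball (0 : E2) 1, hess (fun x => u x + T.v (eI x)) x = Matrix.of (bm (Q0 (eI x) + T.Q (eI x))) := by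
    intro x hx
    rw [hDn.hess hx]
    congr 1
    funext i j
    have e1 : bm (Q0 (eI x) + T.Q (eI x)) i j = bm (Q0 (eI x)) i j + bm (T.Q (eI x)) i j := rfl
    have e2 : eC (eI x) = x := by rw [eI_apply, LinearIsometryEquiv.apply_symm_apply]
    rw [e1]
    simp only [hQ0]
    rw [bm_mb, e2]
    change hm W x i j + T.Q (eI x) (eI (EuclideanSpace.single i 1)) (eI (EuclideanSpace.single j 1)) = _
    rw [eI_apply (EuclideanSpace.single i 1), eI_apply (EuclideanSpace.single j 1), eC_symm_single, eC_symm_single]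
    rfl
  refine ⟨fun x => u x + T.v (eI x), hDn.contDiffOn, ⟨4 * (|H| + N), fun x hx y hy => ?_⟩, fun x hx => ?_, fun x hx => ?_⟩
  · rw [hn x hx, hn y hy, ← Real.sqrt_eq_rpow]
    have e : Matrix.of (bm (Q0 (eI x) + T.Q (eI x))) - Matrix.of (bm (Q0 (eI y) + T.Q (eI y)))
        = Matrix.of (bm ((Q0 (eI x) - Q0 (eI y)) + (T.Q (eI x) - T.Q (eI y)))) := by
      ext i j
      change (Q0 (eI x) (bs i) (bs j) + T.Q (eI x) (bs i) (bs j)) - (Q0 (eI y) (bs i) (bs j) + T.Q (eI y) (bs i) (bs j))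
        = (Q0 (eI x) (bs i) (bs j) - Q0 (eI y) (bs i) (bs j)) + (T.Q (eI x) (bs i) (bs j) - T.Q (eI y) (bs i) (bs j))
      ring
    rw [e]
    have hx' := eI_maps (ball_subset_closedBall hx)
    have hy' := eI_maps (ball_subset_closedBall hy)
    have n1 := hol _ hx' _ hy'
    have n2 := hN _ hx' _ hy'
    have n3 : ‖eI x - eI y‖ = ‖x - y‖ := by
      rw [← map_sub, eI_apply, LinearIsometryEquiv.norm_map]
    rw [n3] at n1 n2
    refine (bm_matNorm _).trans ?_
    have := norm_add_le (Q0 (eI x) - Q0 (eI y)) (T.Q (eI x) - T.Q (eI y))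
    linarith
  · have := hTe _ (eI_maps (ball_subset_closedBall hx))
    rw [lapl, hn x hx]
    simp only [hΦ, trC_bm] at this
    simp only [Fin.sum_univ_two, Matrix.of_apply]
    linarith
  · have : ‖eI x‖ = 1 := by
      rw [eI_apply, LinearIsometryEquiv.norm_map]; exact mem_sphere_zero_iff_norm.1 hx
    change u x + T.v (eI x) = g x
    rw [hT.vd.v0 _ this, add_zero]
    exact hg x hx

end MC

/-- Openness in the method of continuity: with `ᾱ` the universal Hölder exponent of the
two-dimensional `C^{2,ᾱ}` theory, for `F ∈ C²` uniformly elliptic with `F(0) = 0` and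
`g ∈ C^{2,ᾱ}(∂B₁)`, the set `A = {t ∈ [0,1] : t·F(D²u) + (1−t)Δu = 0, u|_{∂B₁} = g` is
solvable in `C^{2,ᾱ}(B̄₁)}` is open in `[0,1]`. -/
theorem method_of_continuity_open (lam Lam : ℝ) (hlam : 0 < lam) (hLam : lam ≤ Lam) :
    ∃ α : ℝ, α ∈ Set.Ioo (0 : ℝ) 1 ∧
      ∀ (F : Mat2 → ℝ) (g : E2 → ℝ),
        ContDiff ℝ 2 (fun A : Fin 2 → Fin 2 → ℝ => F (Matrix.of A)) →
        UniformlyElliptic lam Lam F → F 0 = 0 →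
        MemHolderCircle α g →
        ∀ t₀ ∈ Icc (0 : ℝ) 1, SolvesAt α F g t₀ →
          ∃ ε > 0, ∀ t ∈ Icc (0 : ℝ) 1, t ∈ Ioo (t₀ - ε) (t₀ + ε) → SolvesAt α F g t :=
  MC.main lam Lam hlam hLam
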